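/- Let R > 0 and let f : 𝔻_R → Ω be a J-holomorphic map with f(0) = p and Df_0(1) = v₀ ∈ ℂⁿ. Then for every ε ∈ (0, R) there exists an open neighborhood V of v₀ in ℂⁿ such that for every v ∈ V there is a J-holomorphic map f_v : 𝔻_{R−ε} → Ω with f_v(0) = p and D(f_v)_0(1) = v; moreover f_v can be chosen so that f_v converges to f uniformly on 𝔻_{R−ε} as v → v₀. -/

import Mathlib

open Metric Set Filter
open scoped ENNReal Topology

noncomputable section

abbrev Cn (n : ℕ) := EuclideanSpace ℂ (Fin n)

def IsAlmostComplexOn (n : ℕ) (Ω : Set (Cn n)) (J : Cn n → (Cn n →L[ℝ] Cn n)) : Prop :=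
  ContDiffOn ℝ (⊤ : ℕ∞) J Ω ∧
    ∀ x ∈ Ω, (J x).comp (J x) = -ContinuousLinearMap.id ℝ (Cn n)

def IsJHolomorphicOn (n : ℕ) (Ω : Set (Cn n)) (J : Cn n → (Cn n →L[ℝ] Cn n))
    (R : ℝ) (f : ℂ → Cn n) : Prop :=
  MapsTo f (ball (0:ℂ) R) Ω ∧
    ∀ z ∈ ball (0:ℂ) R, DifferentiableAt ℝ f z ∧
      ∀ ξ : ℂ, fderiv ℝ f z (Complex.I * ξ) = J (f z) (fderiv ℝ f z ξ)

def kobayashiRoyden (n : ℕ) (Ω : Set (Cn n)) (J : Cn n → (Cn n →L[ℝ] Cn n))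
    (p v : Cn n) : ℝ≥0∞ :=
  sInf {c : ℝ≥0∞ | ∃ r : ℝ, 0 < r ∧
    (∃ f : ℂ → Cn n, IsJHolomorphicOn n Ω J 1 f ∧ f 0 = p ∧ fderiv ℝ f 0 1 = r • v) ∧
    c = ENNReal.ofReal (1 / r)}

/-- The inverse hyperbolic tangent, `arctanh x = ½ log((1 + x)/(1 - x))`. -/
def arctanh (x : ℝ) : ℝ := (1 / 2) * Real.log ((1 + x) / (1 - x))

/-- The Poincaré distance on the unit disc. -/
def poincareDist (z w : ℂ) : ℝ :=
  arctanh (‖z - w‖ / ‖1 - (starRingEnd ℂ) z * w‖)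

/-- The Kobayashi pseudodistance `d_Ω(p, q)` of the almost complex manifold `(Ω, J)`. -/
def kobayashiDist (n : ℕ) (Ω : Set (Cn n)) (J : Cn n → (Cn n →L[ℝ] Cn n))
    (p q : Cn n) : ℝ≥0∞ :=
  sInf {c : ℝ≥0∞ | ∃ m : ℕ, ∃ z w : Fin (m + 1) → ℂ, ∃ f : Fin (m + 1) → ℂ → Cn n,
    (∀ k, z k ∈ ball (0:ℂ) 1 ∧ w k ∈ ball (0:ℂ) 1 ∧ IsJHolomorphicOn n Ω J 1 (f k)) ∧
    f 0 (z 0) = p ∧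
    (∀ k : Fin m, f k.castSucc (w k.castSucc) = f k.succ (z k.succ)) ∧
    f (Fin.last m) (w (Fin.last m)) = q ∧
    c = ENNReal.ofReal (∑ k, poincareDist (z k) (w k))}

/-- `γ` is a piecewise continuously differentiable path in `Ω`, parametrized by `[0,1]`. -/
def IsPiecewiseC1PathIn (n : ℕ) (Ω : Set (Cn n)) (γ : ℝ → Cn n) : Prop :=
  ContinuousOn γ (Icc (0:ℝ) 1) ∧ MapsTo γ (Icc (0:ℝ) 1) Ω ∧
    ∃ (k : ℕ) (t : Fin (k + 1) → ℝ), StrictMono t ∧ t 0 = 0 ∧ t (Fin.last k) = 1 ∧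
      ∀ i : Fin k, ContDiffOn ℝ 1 γ (Icc (t i.castSucc) (t i.succ))

/-- The Kobayashi–Royden length `∫₀¹ F_Ω(γ(t), γ′(t)) dt` of a path. -/
def kobayashiRoydenLength (n : ℕ) (Ω : Set (Cn n)) (J : Cn n → (Cn n →L[ℝ] Cn n))
    (γ : ℝ → Cn n) : ℝ≥0∞ :=
  ∫⁻ t in Icc (0:ℝ) 1, kobayashiRoyden n Ω J (γ t) (deriv γ t)

/-- The integrated Kobayashi–Royden pseudodistance `d̄_Ω(p, q)`. -/
def integratedKRDist (n : ℕ) (Ω : Set (Cn n)) (J : Cn n → (Cn n →L[ℝ] Cn n))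
    (p q : Cn n) : ℝ≥0∞ :=
  ⨅ γ : {γ : ℝ → Cn n // IsPiecewiseC1PathIn n Ω γ ∧ γ 0 = p ∧ γ 1 = q},
    kobayashiRoydenLength n Ω J γ

section
namespace JHP
open MeasureTheory

lemma rad_int {a b : ℝ} (ha : a < 2) (hab : 2 < a + b) :
    Integrable (fun x : ℂ => ‖x‖ ^ (-a) * (max 1 ‖x‖) ^ (-b)) := by
  have := (integrable_fun_norm_addHaar (E := ℂ) (F := ℝ) volume
    (f := fun s : ℝ => s ^ (-a) * (max 1 s) ^ (-b))).2
  apply this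
  rw [Complex.finrank_real_complex]
  have h1 : IntegrableOn (fun y : ℝ => y ^ (2 - 1) • (y ^ (-a) * (max 1 y) ^ (-b))) (Ioc 0 1) := by
    have : IntegrableOn (fun y : ℝ => y ^ (1 - a)) (Ioc 0 1) := by
      rw [← intervalIntegrable_iff_integrableOn_Ioc_of_le zero_le_one]
      exact intervalIntegral.intervalIntegrable_rpow' (by linarith)
    refine this.congr_fun (fun y hy => ?_) measurableSet_Ioc
    have hy0 : 0 < y := hy.1
    simp only [max_eq_left hy.2, Real.one_rpow, mul_one, smul_eq_mul]
    rw [sub_eq_add_neg, Real.rpow_add hy0, Real.rpow_one]; norm_num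
  have h2 : IntegrableOn (fun y : ℝ => y ^ (2 - 1) • (y ^ (-a) * (max 1 y) ^ (-b))) (Ioi 1) := by
    have : IntegrableOn (fun y : ℝ => y ^ (1 - a - b)) (Ioi 1) :=
      integrableOn_Ioi_rpow_of_lt (by linarith) one_pos
    refine this.congr_fun (fun y hy => ?_) measurableSet_Ioi
    have hy1 : 1 < y := hy
    have hy0 : 0 < y := by linarith
    simp only [max_eq_right hy1.le, smul_eq_mul]
    rw [sub_eq_add_neg, sub_eq_add_neg, Real.rpow_add hy0, Real.rpow_add hy0, Real.rpow_one]
    norm_num; ring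
  rw [← Ioc_union_Ioi_eq_Ioi (zero_le_one' ℝ)]
  exact h1.union h2

lemma ker_bound {a b : ℝ} (ha0 : 0 < a) (hb0 : 0 < b) (ρ : ℝ) (hρ : 0 < ρ) (z ζ : ℂ)
    (hz : ‖z‖ = 2 * ρ) :
    ‖ζ‖ ^ (-a) * ‖z - ζ‖ ^ (-b) ≤ ‖ζ‖ ^ (-a) * (max ρ ‖ζ‖) ^ (-b) +
      ‖z - ζ‖ ^ (-b) * (max ρ ‖z - ζ‖) ^ (-a) := by
  have htri : 2 * ρ ≤ ‖ζ‖ + ‖z - ζ‖ := by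
    rw [← hz]
    calc ‖z‖ = ‖ζ + (z - ζ)‖ := by ring_nf
      _ ≤ _ := norm_add_le _ _
  have n1 := norm_nonneg ζ
  have n2 := norm_nonneg (z - ζ)
  rcases le_total ‖ζ‖ ‖z - ζ‖ with h | h
  · have : ‖z - ζ‖ ^ (-b) ≤ (max ρ ‖ζ‖) ^ (-b) :=
      Real.rpow_le_rpow_of_nonpos (lt_max_of_lt_left hρ) (max_le (by linarith) h) (by linarith)
    have h3 : 0 ≤ ‖z - ζ‖ ^ (-b) * (max ρ ‖z - ζ‖) ^ (-a) := by positivity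
    have := mul_le_mul_of_nonneg_left this (Real.rpow_nonneg n1 (-a))
    linarith
  · have : ‖ζ‖ ^ (-a) ≤ (max ρ ‖z - ζ‖) ^ (-a) :=
      Real.rpow_le_rpow_of_nonpos (lt_max_of_lt_left hρ) (max_le (by linarith) h) (by linarith)
    have h3 : 0 ≤ ‖ζ‖ ^ (-a) * (max ρ ‖ζ‖) ^ (-b) := by positivity
    have := mul_le_mul_of_nonneg_left this (Real.rpow_nonneg n2 (-b))
    linarith

lemma rad_scale {a b : ℝ} (ρ : ℝ) (hρ : 0 < ρ) (x : ℂ) :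
    ‖x‖ ^ (-a) * (max ρ ‖x‖) ^ (-b) =
      ρ ^ (-a-b) * (‖ρ⁻¹ • x‖ ^ (-a) * (max 1 ‖ρ⁻¹ • x‖) ^ (-b)) := by
  have hx : ‖x‖ = ρ * ‖ρ⁻¹ • x‖ := by
    rw [norm_smul, Real.norm_eq_abs, abs_of_pos (inv_pos.2 hρ)]; field_simp
  have hm : max ρ ‖x‖ = ρ * max 1 ‖ρ⁻¹ • x‖ := by
    rw [mul_max_of_nonneg _ _ hρ.le, ← hx, mul_one]
  rw [hm]
  nth_rewrite 1 [hx]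
  rw [Real.mul_rpow hρ.le (norm_nonneg _), Real.mul_rpow hρ.le (by positivity),
    sub_eq_add_neg, Real.rpow_add hρ]
  ring

lemma rad_int_scale {a b : ℝ} (ha : a < 2) (hab : 2 < a + b) (ρ : ℝ) (hρ : 0 < ρ) :
    Integrable (fun x : ℂ => ‖x‖ ^ (-a) * (max ρ ‖x‖) ^ (-b)) ∧
    ∫ x : ℂ, ‖x‖ ^ (-a) * (max ρ ‖x‖) ^ (-b) =
      ρ ^ (2-a-b) * ∫ x : ℂ, ‖x‖ ^ (-a) * (max 1 ‖x‖) ^ (-b) := by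
  have e : (fun x : ℂ => ‖x‖ ^ (-a) * (max ρ ‖x‖) ^ (-b)) =
      fun x : ℂ => ρ ^ (-a-b) * (‖ρ⁻¹ • x‖ ^ (-a) * (max 1 ‖ρ⁻¹ • x‖) ^ (-b)) := by
    funext x; exact rad_scale ρ hρ x
  rw [e]
  constructor
  · exact ((rad_int ha hab).comp_smul (inv_ne_zero hρ.ne')).const_mul _
  · rw [integral_const_mul]
    rw [Measure.integral_comp_smul volume
      (fun x : ℂ => ‖x‖ ^ (-a) * (max 1 ‖x‖) ^ (-b)) ρ⁻¹, Complex.finrank_real_complex,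
      smul_eq_mul, ← mul_assoc]
    congr 1
    rw [abs_of_pos (by positivity), show 2 - a - b = (-a-b) + 2 by ring, Real.rpow_add hρ]
    simp

/-- the basic two-pole kernel estimate -/
lemma ker_int {a b : ℝ} (ha0 : 0 < a) (hb0 : 0 < b) (ha : a < 2) (hb : b < 2) (hab : 2 < a + b) :
    ∃ C : ℝ, 0 < C ∧ ∀ z : ℂ, z ≠ 0 →
      Integrable (fun ζ : ℂ => ‖ζ‖ ^ (-a) * ‖z - ζ‖ ^ (-b)) ∧
      ∫ ζ : ℂ, ‖ζ‖ ^ (-a) * ‖z - ζ‖ ^ (-b) ≤ C * ‖z‖ ^ (2 - a - b) := by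
  set I1 := ∫ x : ℂ, ‖x‖ ^ (-a) * (max 1 ‖x‖) ^ (-b)
  set I2 := ∫ x : ℂ, ‖x‖ ^ (-b) * (max 1 ‖x‖) ^ (-a)
  have hI1 : 0 ≤ I1 := integral_nonneg fun x => by positivity
  have hI2 : 0 ≤ I2 := integral_nonneg fun x => by positivity
  refine ⟨(2:ℝ)⁻¹ ^ (2 - a - b) * (I1 + I2) + 1, by positivity, fun z hz => ?_⟩
  have hzn : 0 < ‖z‖ := norm_pos_iff.2 hz
  set ρ := 2⁻¹ * ‖z‖ with hρd
  have hρ : 0 < ρ := by positivity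
  have hzρ : ‖z‖ = 2 * ρ := by rw [hρd]; ring
  obtain ⟨i1, e1⟩ := rad_int_scale ha hab ρ hρ
  obtain ⟨i2, e2⟩ := rad_int_scale hb (by linarith : 2 < b + a) ρ hρ
  have i2' : Integrable (fun ζ : ℂ => ‖z - ζ‖ ^ (-b) * (max ρ ‖z - ζ‖) ^ (-a)) :=
    i2.comp_sub_left z
  have e2' : ∫ ζ : ℂ, ‖z - ζ‖ ^ (-b) * (max ρ ‖z - ζ‖) ^ (-a) = ρ ^ (2 - b - a) * I2 := by
    rw [integral_sub_left_eq_self (fun x : ℂ => ‖x‖ ^ (-b) * (max ρ ‖x‖) ^ (-a)) volume z, e2]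
  have meas : AEStronglyMeasurable (fun ζ : ℂ => ‖ζ‖ ^ (-a) * ‖z - ζ‖ ^ (-b)) volume := by
    apply Measurable.aestronglyMeasurable; fun_prop
  have hint : Integrable (fun ζ : ℂ => ‖ζ‖ ^ (-a) * ‖z - ζ‖ ^ (-b)) := by
    refine (i1.add i2').mono' meas (Eventually.of_forall fun ζ => ?_)
    rw [Real.norm_of_nonneg (by positivity)]
    exact ker_bound ha0 hb0 ρ hρ z ζ hzρ
  refine ⟨hint, ?_⟩
  calc _ ≤ ∫ ζ : ℂ, (‖ζ‖ ^ (-a) * (max ρ ‖ζ‖) ^ (-b) +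
      ‖z - ζ‖ ^ (-b) * (max ρ ‖z - ζ‖) ^ (-a)) :=
        integral_mono hint (i1.add i2') (fun ζ => ker_bound ha0 hb0 ρ hρ z ζ hzρ)
    _ = ρ ^ (2-a-b) * (I1 + I2) := by
        rw [integral_add i1 i2', e1, e2', show 2 - b - a = 2 - a - b by ring]; ring
    _ = (2:ℝ)⁻¹ ^ (2-a-b) * (I1 + I2) * ‖z‖ ^ (2-a-b) := by
        rw [hρd, Real.mul_rpow (by norm_num) hzn.le]; ring
    _ ≤ _ := by
        have : 0 ≤ ‖z‖ ^ (2-a-b) := by positivity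
        nlinarith

end JHP
end

section
namespace JHP
open MeasureTheory

lemma norm_rpow_intOn {a : ℝ} (ha : a < 2) (M : ℝ) :
    IntegrableOn (fun x : ℂ => ‖x‖ ^ (-a)) (ball 0 M) := by
  have h := (rad_int (a := a) (b := 3 - a) ha (by linarith)).const_mul ((max 1 M) ^ (3 - a))
  refine (h.integrableOn (s := ball 0 M)).mono' ?_ ?_
  · apply Measurable.aestronglyMeasurable; fun_prop
  · refine (ae_restrict_iff' measurableSet_ball).2 (Eventually.of_forall fun x hx => ?_)
    rw [mem_ball_zero_iff] at hx
    rw [Real.norm_of_nonneg (by positivity)]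
    have h1 : (max 1 M) ^ (-(3-a)) ≤ (max 1 ‖x‖) ^ (-(3-a)) :=
      Real.rpow_le_rpow_of_nonpos (by positivity) (max_le_max le_rfl hx.le) (by linarith)
    have h2 : (1:ℝ) = (max 1 M) ^ (3-a) * (max 1 M) ^ (-(3-a)) := by
      rw [← Real.rpow_add (by positivity)]; simp
    calc ‖x‖ ^ (-a) = ((max 1 M) ^ (3-a) * (max 1 M) ^ (-(3-a))) * ‖x‖ ^ (-a) := by
          rw [← h2, one_mul]
      _ ≤ ((max 1 M) ^ (3-a) * (max 1 ‖x‖) ^ (-(3-a))) * ‖x‖ ^ (-a) := by gcongr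
      _ = _ := by ring

variable {F : Type*} [NormedAddCommGroup F] [NormedSpace ℂ F]

/-- Cauchy transform -/
def CT (g : ℂ → F) (z : ℂ) : F := (Real.pi : ℂ)⁻¹ • ∫ ζ, (z - ζ)⁻¹ • g ζ

/-- derivative coefficient of the Cauchy transform at zero -/
def c0 (g : ℂ → F) : F := -((Real.pi : ℂ)⁻¹ • ∫ ζ, (ζ ^ 2)⁻¹ • g ζ)

structure Adm (g : ℂ → F) (M B : ℝ) : Prop where
  meas : AEStronglyMeasurable g volume
  nn : 0 ≤ B
  bd : ∀ ζ, ‖g ζ‖ ≤ B * ‖ζ‖ ^ (1/2 : ℝ)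
  supp : ∀ ζ, M ≤ ‖ζ‖ → g ζ = 0

lemma rpow_half_eq {x : ℝ} (hx : 0 ≤ x) (hx0 : x ≠ 0) (k : ℕ) :
    (x ^ k)⁻¹ * x ^ (1/2 : ℝ) = x ^ (-(k - 1/2 : ℝ)) := by
  have : 0 < x := lt_of_le_of_ne hx (Ne.symm hx0)
  rw [← Real.rpow_natCast, ← Real.rpow_neg hx, ← Real.rpow_add this]
  congr 1; ring

lemma Adm.bd_pow {g : ℂ → F} {M B : ℝ} (h : Adm g M B) (k : ℕ) (ζ : ℂ) :
    ‖(ζ ^ k)⁻¹ • g ζ‖ ≤ B * ‖ζ‖ ^ (-(k - 1/2 : ℝ)) := by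
  rcases eq_or_ne ζ 0 with rfl | h0
  · have : g 0 = 0 := by
      have := h.bd 0; simpa using this
    rw [this, smul_zero, norm_zero]
    have := h.nn
    positivity
  · rw [norm_smul, norm_inv, norm_pow]
    calc _ ≤ (‖ζ‖ ^ k)⁻¹ * (B * ‖ζ‖ ^ (1/2 : ℝ)) := by gcongr; exact h.bd ζ
      _ = B * ((‖ζ‖ ^ k)⁻¹ * ‖ζ‖ ^ (1/2 : ℝ)) := by ring
      _ = _ := by rw [rpow_half_eq (norm_nonneg _) (norm_ne_zero_iff.2 h0)]

lemma Adm.int_pow {g : ℂ → F} {M B : ℝ} (h : Adm g M B) (k : ℕ) (hk : k ≤ 2) :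
    Integrable (fun ζ => (ζ ^ k)⁻¹ • g ζ) := by
  have hk2 : (k : ℝ) ≤ 2 := by exact_mod_cast hk
  rw [← integrableOn_iff_integrable_of_support_subset (s := ball 0 M)]
  · refine ((norm_rpow_intOn (a := (k - 1/2 : ℝ)) (by linarith) M).const_mul B).mono' ?_ ?_
    · refine AEStronglyMeasurable.restrict (AEStronglyMeasurable.smul ?_ h.meas)
      apply Measurable.aestronglyMeasurable; fun_prop
    · exact Eventually.of_forall fun ζ => h.bd_pow k ζ
  · intro ζ hζ
    rw [mem_ball_zero_iff]
    by_contra hc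
    exact hζ (by simp [h.supp ζ (not_lt.1 hc)])

lemma Adm.c0_le {M : ℝ} : ∃ C : ℝ, 0 < C ∧ ∀ (g : ℂ → F) (B : ℝ), Adm g M B → 
    ‖c0 g‖ ≤ C * B := by
  have hI := norm_rpow_intOn (a := 3/2) (by norm_num) M
  set I := ∫ ζ in ball (0:ℂ) M, ‖ζ‖ ^ (-(3/2) : ℝ)
  have hI0 : 0 ≤ I := integral_nonneg fun _ => by positivity
  refine ⟨Real.pi⁻¹ * I + 1, by positivity, fun g B h => ?_⟩
  have hs : ∫ ζ, (ζ ^ 2)⁻¹ • g ζ = ∫ ζ in ball (0:ℂ) M, (ζ ^ 2)⁻¹ • g ζ := by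
    symm
    apply setIntegral_eq_integral_of_forall_compl_eq_zero
    intro ζ hζ
    rw [mem_ball_zero_iff] at hζ
    simp [h.supp ζ (not_lt.1 hζ)]
  have : ‖∫ ζ, (ζ ^ 2)⁻¹ • g ζ‖ ≤ B * I := by
    rw [hs, ← integral_const_mul]
    refine norm_integral_le_of_norm_le (hI.const_mul B) (Eventually.of_forall fun ζ => ?_)
    have := h.bd_pow 2 ζ
    norm_num at this ⊢; exact this
  unfold c0
  rw [norm_neg, norm_smul, norm_inv, Complex.norm_real, Real.norm_of_nonneg Real.pi_pos.le]
  have hp : 0 ≤ Real.pi⁻¹ := by positivity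
  nlinarith [mul_le_mul_of_nonneg_left this hp, h.nn]

lemma Adm.int_two {g : ℂ → F} {M B : ℝ} (h : Adm g M B) {z : ℂ} (hz : z ≠ 0) :
    Integrable (fun ζ => ((ζ ^ 2)⁻¹ * (z - ζ)⁻¹) • g ζ) := by
  obtain ⟨C, -, hC⟩ := ker_int (a := 3/2) (b := 1) (by norm_num) (by norm_num) (by norm_num)
    (by norm_num) (by norm_num)
  refine ((hC z hz).1.const_mul B).mono' ?_ (Eventually.of_forall fun ζ => ?_)
  · refine AEStronglyMeasurable.smul ?_ h.meas
    apply Measurable.aestronglyMeasurable; fun_prop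
  · rw [mul_comm, mul_smul, norm_smul, norm_inv, Real.rpow_neg_one]
    have := h.bd_pow 2 ζ
    have h2 : (-(((2:ℕ):ℝ) - 1/2)) = -(3/2) := by norm_num
    rw [h2] at this
    calc _ ≤ ‖z - ζ‖⁻¹ * (B * ‖ζ‖ ^ (-(3/2) : ℝ)) := by gcongr
      _ = _ := by ring

lemma ae_ne (z : ℂ) : ∀ᵐ ζ : ℂ, ζ ≠ z := by
  simp [ae_iff]

lemma ker_id {z ζ : ℂ} (h0 : ζ ≠ 0) (hz : ζ ≠ z) :
    (z - ζ)⁻¹ = z ^ 2 * ((ζ ^ 2)⁻¹ * (z - ζ)⁻¹) - ζ⁻¹ - z * (ζ ^ 2)⁻¹ := by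
  have : z - ζ ≠ 0 := sub_ne_zero.2 (Ne.symm hz)
  field_simp
  ring

lemma Adm.ct_eq {g : ℂ → F} {M B : ℝ} (h : Adm g M B) (z : ℂ) :
    CT g z - CT g 0 - z • c0 g =
      (Real.pi : ℂ)⁻¹ • (z ^ 2 • ∫ ζ, ((ζ ^ 2)⁻¹ * (z - ζ)⁻¹) • g ζ) := by
  rcases eq_or_ne z 0 with rfl | hz
  · simp
  have i1 := h.int_pow 1 (by norm_num)
  have i2 := h.int_pow 2 le_rfl
  have i3 := h.int_two hz
  simp only [pow_one] at i1
  have e : ∫ ζ, (z - ζ)⁻¹ • g ζ = z ^ 2 • (∫ ζ, ((ζ ^ 2)⁻¹ * (z - ζ)⁻¹) • g ζ) -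
      (∫ ζ, ζ⁻¹ • g ζ) - z • ∫ ζ, (ζ ^ 2)⁻¹ • g ζ := by
    have i3' : Integrable (fun ζ => z ^ 2 • ((ζ ^ 2)⁻¹ * (z - ζ)⁻¹) • g ζ) := i3.smul (z^2)
    have i2' : Integrable (fun ζ => z • (ζ ^ 2)⁻¹ • g ζ) := i2.smul z
    have i4 : Integrable (fun ζ => z ^ 2 • ((ζ ^ 2)⁻¹ * (z - ζ)⁻¹) • g ζ - ζ⁻¹ • g ζ) := i3'.sub i1
    rw [← integral_smul, ← integral_smul, ← integral_sub i3' i1, ← integral_sub i4 i2']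
    refine integral_congr_ae ?_
    filter_upwards [ae_ne 0, ae_ne z] with ζ h0 h1
    rw [smul_smul, smul_smul, ← sub_smul, ← sub_smul, ← ker_id h0 h1]
  unfold CT c0
  rw [e]
  have e2 : ∫ ζ, (0 - ζ)⁻¹ • g ζ = - ∫ ζ, ζ⁻¹ • g ζ := by
    rw [← integral_neg]; congr 1; funext ζ; rw [zero_sub, inv_neg, neg_smul]
  rw [e2]
  module

lemma Adm.expand0 {M : ℝ} : ∃ C : ℝ, 0 < C ∧ ∀ (g : ℂ → F) (B : ℝ), Adm g M B → 
    ‖c0 g‖ ≤ C * B ∧ ∀ z, ‖CT g z - CT g 0 - z • c0 g‖ ≤ C * B * ‖z‖ ^ (3/2 : ℝ) := by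
  obtain ⟨C1, hC1, H1⟩ := Adm.c0_le (F := F) (M := M)
  obtain ⟨C, hC, H⟩ := ker_int (a := 3/2) (b := 1) (by norm_num) (by norm_num) (by norm_num)
    (by norm_num) (by norm_num)
  refine ⟨C1 + Real.pi⁻¹ * C, by positivity, fun g B h => ⟨?_, fun z => ?_⟩⟩
  · have := H1 g B h
    have : 0 ≤ Real.pi⁻¹ * C * B := by have := h.nn; positivity
    linarith
  · rw [h.ct_eq]
    rcases eq_or_ne z 0 with rfl | hz
    · simp
    have hzn : 0 < ‖z‖ := norm_pos_iff.2 hz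
    have b1 : ‖∫ ζ, ((ζ ^ 2)⁻¹ * (z - ζ)⁻¹) • g ζ‖ ≤ B * (C * ‖z‖ ^ (2 - 3/2 - 1 : ℝ)) := by
      refine (norm_integral_le_of_norm_le ((H z hz).1.const_mul B)
        (Eventually.of_forall fun ζ => ?_)).trans ?_
      · rw [mul_comm, mul_smul, norm_smul, norm_inv, Real.rpow_neg_one]
        have := h.bd_pow 2 ζ
        have h2 : (-(((2:ℕ):ℝ) - 1/2)) = -(3/2) := by norm_num
        rw [h2] at this
        calc _ ≤ ‖z - ζ‖⁻¹ * (B * ‖ζ‖ ^ (-(3/2) : ℝ)) := by gcongr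
          _ = _ := by ring
      · rw [integral_const_mul]
        exact mul_le_mul_of_nonneg_left (H z hz).2 h.nn
    rw [norm_smul, norm_smul, norm_inv, Complex.norm_real, Real.norm_of_nonneg Real.pi_pos.le,
      norm_pow]
    have e : ‖z‖ ^ (3/2 : ℝ) = ‖z‖ ^ 2 * ‖z‖ ^ (2 - 3/2 - 1 : ℝ) := by
      rw [← Real.rpow_natCast, ← Real.rpow_add hzn]; norm_num
    rw [e]
    calc _ ≤ Real.pi⁻¹ * (‖z‖ ^ 2 * (B * (C * ‖z‖ ^ (2 - 3/2 - 1 : ℝ)))) := by gcongr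
      _ ≤ _ := by
        have : 0 ≤ C1 * B * (‖z‖ ^ 2 * ‖z‖ ^ (2 - 3/2 - 1 : ℝ)) := by
          have := h.nn; positivity
        linarith

lemma CT_translate (g : ℂ → F) (z0 z : ℂ) : CT (fun ζ => g (z0 + ζ)) z = CT g (z0 + z) := by
  unfold CT
  congr 1
  rw [← integral_add_left_eq_self (fun ζ => (z0 + z - ζ)⁻¹ • g ζ) z0]
  congr 1; funext ζ; congr 2; ring

end JHP
end

section
namespace JHP
open MeasureTheory

/-- the operator `∂/∂z̄` -/
def dbar (u : ℂ → ℂ) (z : ℂ) : ℂ :=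
  (1/2 : ℂ) * (fderiv ℝ u z 1 + Complex.I * fderiv ℝ u z Complex.I)

/-- polar parametrisation -/
def pol (s θ : ℝ) : ℂ := (s : ℂ) * ((Real.cos θ : ℂ) + (Real.sin θ : ℂ) * Complex.I)

lemma pol_cont : Continuous (fun p : ℝ × ℝ => pol p.1 p.2) := by
  unfold pol; fun_prop

lemma norm_pol {s θ : ℝ} (hs : 0 ≤ s) : ‖pol s θ‖ = s := by
  unfold pol
  rw [norm_mul, Complex.norm_real, Real.norm_of_nonneg hs]
  have : ((Real.cos θ : ℂ) + (Real.sin θ : ℂ) * Complex.I) = Complex.exp (θ * Complex.I) := by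
    rw [Complex.exp_mul_I, Complex.ofReal_cos, Complex.ofReal_sin]
  rw [this, Complex.norm_exp_ofReal_mul_I, mul_one]

lemma pol_ds (s θ : ℝ) : HasDerivAt (fun s => pol s θ)
    ((Real.cos θ : ℂ) + (Real.sin θ : ℂ) * Complex.I) s := by
  unfold pol
  have := (Complex.ofRealCLM.hasDerivAt (x := s)).mul_const
    ((Real.cos θ : ℂ) + (Real.sin θ : ℂ) * Complex.I)
  simpa using this

lemma pol_dθ (s θ : ℝ) : HasDerivAt (fun θ => pol s θ)
    ((s : ℂ) * (-(Real.sin θ : ℂ) + (Real.cos θ : ℂ) * Complex.I)) θ := by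
  unfold pol
  have h1 : HasDerivAt (fun θ : ℝ => (Real.cos θ : ℂ)) (-(Real.sin θ : ℂ)) θ := by
    simpa using (Real.hasDerivAt_cos θ).ofReal_comp
  have h2 : HasDerivAt (fun θ : ℝ => (Real.sin θ : ℂ)) (Real.cos θ : ℂ) θ := by
    simpa using (Real.hasDerivAt_sin θ).ofReal_comp
  exact (h1.add (h2.mul_const Complex.I)).const_mul (s : ℂ)

lemma clm_expand (L : ℂ →L[ℝ] ℂ) (a b : ℝ) :
    L ((a : ℂ) + (b : ℂ) * Complex.I) = a * L 1 + b * L Complex.I := by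
  have : ((a : ℂ) + (b : ℂ) * Complex.I) = a • (1:ℂ) + b • Complex.I := by simp
  rw [this, map_add, map_smul, map_smul]; simp

lemma pompeiu0 (u : ℂ → ℂ) (hu : Differentiable ℝ u) (K : ℝ) (hK : ∀ z, ‖fderiv ℝ u z‖ ≤ K)
    (S : ℝ) (hS : 0 < S) (supp : ∀ z, S ≤ ‖z‖ → u z = 0) : CT (dbar u) 0 = u 0 := by
  set ux : ℂ → ℂ := fun z => fderiv ℝ u z 1 with hux
  set uy : ℂ → ℂ := fun z => fderiv ℝ u z Complex.I with huy
  have mux : Measurable ux := measurable_fderiv_apply_const ℝ u 1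
  have muy : Measurable uy := measurable_fderiv_apply_const ℝ u Complex.I
  have hK0 : 0 ≤ K := (norm_nonneg _).trans (hK 0)
  have bux : ∀ z, ‖ux z‖ ≤ K := fun z => by
    simpa using (fderiv ℝ u z).le_of_opNorm_le (hK z) 1
  have buy : ∀ z, ‖uy z‖ ≤ K := fun z => by
    simpa using (fderiv ℝ u z).le_of_opNorm_le (hK z) Complex.I
  have fd0 : ∀ z, S < ‖z‖ → fderiv ℝ u z = 0 := by
    intro z hz
    have : u =ᶠ[𝓝 z] fun _ => 0 := by
      filter_upwards [(isOpen_lt continuous_const continuous_norm).mem_nhds hz] with w hw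
      exact supp w (le_of_lt hw)
    rw [this.fderiv_eq]; simp
  set G1 : ℝ × ℝ → ℂ := fun p => (Real.cos p.2 : ℂ) * ux (pol p.1 p.2) +
    (Real.sin p.2 : ℂ) * uy (pol p.1 p.2) with hG1
  set G2 : ℝ × ℝ → ℂ := fun p => -(Real.sin p.2 : ℂ) * ux (pol p.1 p.2) +
    (Real.cos p.2 : ℂ) * uy (pol p.1 p.2) with hG2
  have mp : Measurable (fun p : ℝ × ℝ => pol p.1 p.2) := pol_cont.measurable
  have mux' : Measurable (fun p : ℝ × ℝ => ux (pol p.1 p.2)) := mux.comp mp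
  have muy' : Measurable (fun p : ℝ × ℝ => uy (pol p.1 p.2)) := muy.comp mp
  have mG1 : Measurable G1 := by
    refine Measurable.add (Measurable.mul ?_ mux') (Measurable.mul ?_ muy') <;> fun_prop
  have mG2 : Measurable G2 := by
    refine Measurable.add (Measurable.mul ?_ mux') (Measurable.mul ?_ muy') <;> fun_prop
  have aux : ∀ (a b : ℝ) (z : ℂ), |a| ≤ 1 → |b| ≤ 1 → ‖(a:ℂ) * ux z + (b:ℂ) * uy z‖ ≤ 2 * K := by
    intro a b z ha hb
    have h1 : ‖(a:ℂ) * ux z‖ ≤ 1 * K := by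
      rw [norm_mul, Complex.norm_real]; gcongr; exacts [ha, bux z]
    have h2 : ‖(b:ℂ) * uy z‖ ≤ 1 * K := by
      rw [norm_mul, Complex.norm_real]; gcongr; exacts [hb, buy z]
    calc _ ≤ _ := norm_add_le _ _
      _ ≤ 2 * K := by linarith
  have bG1 : ∀ p, ‖G1 p‖ ≤ 2 * K := fun p =>
    aux _ _ _ (Real.abs_cos_le_one _) (Real.abs_sin_le_one _)
  have bG2 : ∀ p, ‖G2 p‖ ≤ 2 * K := fun p => by
    have := aux (-Real.sin p.2) (Real.cos p.2) (pol p.1 p.2)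
      (by rw [abs_neg]; exact Real.abs_sin_le_one _) (Real.abs_cos_le_one _)
    simpa [hG2] using this
  set D : Set (ℝ × ℝ) := Ioc 0 (S+1) ×ˢ Ioo (-Real.pi) Real.pi with hD
  have vD : (volume : Measure (ℝ × ℝ)) D < ⊤ := by
    rw [hD, Measure.volume_eq_prod, Measure.prod_prod]
    simp [ENNReal.mul_lt_top]
  have iG1 : IntegrableOn G1 D := Measure.integrableOn_of_bounded vD.ne
    mG1.aestronglyMeasurable (Eventually.of_forall bG1)
  have iG2 : IntegrableOn G2 D := Measure.integrableOn_of_bounded vD.ne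
    mG2.aestronglyMeasurable (Eventually.of_forall bG2)
  have dU1 : ∀ s θ, HasDerivAt (fun s => u (pol s θ)) (G1 (s, θ)) s := by
    intro s θ
    have := (hu (pol s θ)).hasFDerivAt.comp_hasDerivAt s (pol_ds s θ)
    rw [clm_expand] at this
    exact this
  have dU2 : ∀ s θ, HasDerivAt (fun θ => u (pol s θ)) (s * G2 (s, θ)) θ := by
    intro s θ
    have := (hu (pol s θ)).hasFDerivAt.comp_hasDerivAt θ (pol_dθ s θ)
    rw [← Complex.real_smul, map_smul, ← Complex.ofReal_neg, clm_expand] at this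
    have e : (s:ℂ) * G2 (s, θ) = s • (((-Real.sin θ : ℝ) : ℂ) * fderiv ℝ u (pol s θ) 1 +
        (Real.cos θ : ℂ) * fderiv ℝ u (pol s θ) Complex.I) := by
      rw [Complex.real_smul, Complex.ofReal_neg]
    rw [e]; exact this
  have I1 : ∫ p in D, G1 p = -(2 * Real.pi) * u 0 := by
    rw [hD, Measure.volume_eq_prod, ← setIntegral_prod_swap, setIntegral_prod]
    · have : ∀ θ : ℝ, ∫ s in Ioc 0 (S+1), G1 (s, θ) = - u 0 := by
        intro θ
        rw [← intervalIntegral.integral_of_le (by linarith)]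
        rw [intervalIntegral.integral_eq_sub_of_hasDerivAt (f := fun s => u (pol s θ))]
        · rw [supp (pol (S+1) θ) (by rw [norm_pol (by linarith)]; linarith)]
          simp [pol]
        · intro s _; exact dU1 s θ
        · rw [intervalIntegrable_iff]
          refine Measure.integrableOn_of_bounded (M := 2 * K) (by simp) ?_
            (Eventually.of_forall fun s => bG1 (s, θ))
          exact (mG1.comp (measurable_id.prodMk measurable_const)).aestronglyMeasurable
      simp only [Prod.swap_prod_mk, this]
      rw [setIntegral_const]
      simp [Measure.real, Real.pi_pos.le]
      left; ring
    · have iG1' : IntegrableOn G1 (Ioc 0 (S+1) ×ˢ Ioo (-Real.pi) Real.pi)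
          ((volume : Measure ℝ).prod (volume : Measure ℝ)) := iG1
      exact iG1'.swap
  have I2 : ∫ p in D, G2 p = 0 := by
    rw [hD, Measure.volume_eq_prod, setIntegral_prod _ (by rw [← Measure.volume_eq_prod]; exact iG2)]
    rw [setIntegral_congr_fun (g := fun _ => (0:ℂ)) measurableSet_Ioc]
    · simp
    intro s hs
    simp only
    have hs0 : (s:ℂ) ≠ 0 := by exact_mod_cast hs.1.ne'
    have : ∫ θ in Ioo (-Real.pi) Real.pi, (s:ℂ) * G2 (s, θ) = 0 := by
      rw [← integral_Ioc_eq_integral_Ioo,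
        ← intervalIntegral.integral_of_le (by linarith [Real.pi_pos])]
      rw [intervalIntegral.integral_eq_sub_of_hasDerivAt (f := fun θ => u (pol s θ))]
      · simp [pol]
      · intro θ _; exact dU2 s θ
      · rw [intervalIntegrable_iff]
        refine Measure.integrableOn_of_bounded (M := s * (2 * K)) (by simp) ?_
            (Eventually.of_forall fun θ => ?_)
        · refine Measurable.aestronglyMeasurable (Measurable.const_mul ?_ _)
          exact (mG2.comp (measurable_const.prodMk measurable_id))
        · rw [norm_mul, Complex.norm_real, Real.norm_of_nonneg hs.1.le]
          exact mul_le_mul_of_nonneg_left (bG2 _) hs.1.le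
    rw [integral_const_mul] at this
    exact (mul_eq_zero.1 this).resolve_left hs0
  unfold CT
  rw [← Complex.integral_comp_polarCoord_symm]
  have hT : ∫ p in polarCoord.target, p.1 • ((0 - Complex.polarCoord.symm p)⁻¹ •
      dbar u (Complex.polarCoord.symm p)) = ∫ p in D, (-(1/2:ℂ)) * (G1 p + Complex.I * G2 p) := by
    have hDT : D ⊆ polarCoord.target := by
      rw [polarCoord_target]; exact prod_mono Ioc_subset_Ioi_self subset_rfl
    have key : ∀ p ∈ polarCoord.target, p.1 • ((0 - Complex.polarCoord.symm p)⁻¹ •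
      dbar u (Complex.polarCoord.symm p)) = (-(1/2:ℂ)) * (G1 p + Complex.I * G2 p) := by
      intro p hp
      rw [polarCoord_target] at hp
      have hp0 : (p.1 : ℂ) ≠ 0 := by exact_mod_cast (ne_of_gt hp.1)
      have e : Complex.polarCoord.symm p = pol p.1 p.2 := by
        rw [Complex.polarCoord_symm_apply]; simp [pol]
      rw [e]
      simp only [dbar, hG1, hG2, hux, huy]
      generalize fderiv ℝ u (pol p.1 p.2) 1 = X
      generalize fderiv ℝ u (pol p.1 p.2) Complex.I = Y
      have hcs : ((Real.cos p.2 : ℂ) + Real.sin p.2 * Complex.I) *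
          ((Real.cos p.2 : ℂ) - Real.sin p.2 * Complex.I) = 1 := by
        have h1 : (Real.cos p.2 : ℂ)^2 + (Real.sin p.2 : ℂ)^2 = 1 := by
          exact_mod_cast Real.cos_sq_add_sin_sq p.2
        linear_combination h1 - (Real.sin p.2 : ℂ)^2 * Complex.I_sq
      have hinv : (0 - pol p.1 p.2)⁻¹ = -((p.1:ℂ)⁻¹ *
          ((Real.cos p.2 : ℂ) - Real.sin p.2 * Complex.I)) := by
        rw [zero_sub, inv_neg, pol, mul_inv, eq_inv_of_mul_eq_one_right hcs]
      rw [hinv, Complex.real_smul, smul_eq_mul]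
      have : (p.1:ℂ) * (-((p.1:ℂ)⁻¹ * ((Real.cos p.2 : ℂ) - Real.sin p.2 * Complex.I)) *
        (1 / 2 * (X + Complex.I * Y))) = -(((Real.cos p.2 : ℂ) - Real.sin p.2 * Complex.I) *
        (1 / 2 * (X + Complex.I * Y))) := by field_simp
      rw [this]
      linear_combination (1/2 : ℂ) * Real.sin p.2 * Y * Complex.I_sq
    rw [setIntegral_congr_fun polarCoord.open_target.measurableSet key]
    refine setIntegral_eq_of_subset_of_forall_sdiff_eq_zero
      polarCoord.open_target.measurableSet hDT ?_
    intro p hp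
    have hp1 := hp.1
    rw [polarCoord_target] at hp1
    have hpos : 0 < p.1 := hp1.1
    have hbig : S + 1 < p.1 := by
      by_contra hc
      exact hp.2 ⟨⟨hpos, not_lt.1 hc⟩, hp1.2⟩
    have : fderiv ℝ u (pol p.1 p.2) = 0 := fd0 _ (by rw [norm_pol hpos.le]; linarith)
    simp [hG1, hG2, hux, huy, this]
  rw [hT, integral_const_mul, integral_add iG1 (iG2.const_mul _), integral_const_mul, I1, I2]
  have : (Real.pi : ℂ) ≠ 0 := by exact_mod_cast Real.pi_ne_zero
  rw [smul_eq_mul]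
  field_simp
  ring

lemma pompeiu (u : ℂ → ℂ) (hu : Differentiable ℝ u) (K : ℝ) (hK : ∀ z, ‖fderiv ℝ u z‖ ≤ K)
    (S : ℝ) (supp : ∀ z, S ≤ ‖z‖ → u z = 0) (z : ℂ) : CT (dbar u) z = u z := by
  have hfd : ∀ w, fderiv ℝ (fun ζ => u (z + ζ)) w = fderiv ℝ u (z + w) := fun w =>
    fderiv_comp_add_left z
  have := pompeiu0 (fun ζ => u (z + ζ)) (hu.comp (by fun_prop)) K
    (fun w => by rw [hfd]; exact hK _) (|S| + ‖z‖ + 1) (by positivity)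
    (fun w hw => supp _ (by
      have h1 := norm_sub_le (z + w) z
      have : ‖z + w - z‖ = ‖w‖ := by ring_nf
      rw [this] at h1
      linarith [le_abs_self S]))
  have e : dbar (fun ζ => u (z + ζ)) = fun ζ => dbar u (z + ζ) := by
    funext w; simp only [dbar, hfd]
  rw [e, CT_translate] at this
  simpa using this

end JHP
end

section
namespace JHP
open MeasureTheory

lemma cutoff (r s : ℝ) (hr : 0 < r) (hrs : r < s) : ∃ (χ : ℂ → ℝ) (K : ℝ), ContDiff ℝ (⊤ : ℕ∞) χ ∧
    (∀ z, ‖z‖ ≤ r → χ z = 1) ∧ (∀ z, s ≤ ‖z‖ → χ z = 0) ∧ (∀ z, 0 ≤ χ z ∧ χ z ≤ 1) ∧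
    (∀ z, ‖fderiv ℝ χ z‖ ≤ K) ∧ 0 ≤ K := by
  let χ : ContDiffBump (0:ℂ) := ⟨r, s, hr, hrs⟩
  have hc : ContDiff ℝ (⊤ : ℕ∞) χ := χ.contDiff
  have hb : ∃ K, ∀ z, ‖fderiv ℝ χ z‖ ≤ K := by
    have h1 : HasCompactSupport (fderiv ℝ χ) := χ.hasCompactSupport.fderiv ℝ
    have h2 : Continuous (fderiv ℝ χ) := hc.continuous_fderiv (by simp)
    obtain ⟨K, hK⟩ := h1.exists_bound_of_continuous h2
    exact ⟨K, hK⟩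
  obtain ⟨K, hK⟩ := hb
  refine ⟨χ, K, hc, ?_, ?_, fun z => ⟨χ.nonneg, χ.le_one⟩, hK, (norm_nonneg _).trans (hK 0)⟩
  · intro z hz; exact χ.one_of_mem_closedBall (by simpa using hz)
  · intro z hz; exact χ.zero_of_le_dist (by simpa using hz)

lemma rpow_three_half_isLittleO {C : ℝ} {u : ℂ → ℂ} {c : ℂ} {σ : ℝ} (hσ : 0 < σ) (u0 : u 0 = 0)
    (h : ∀ z, ‖z‖ < σ → ‖u z - z * c‖ ≤ C * ‖z‖^(3/2:ℝ)) :
    HasFDerivAt u ((ContinuousLinearMap.mul ℝ ℂ).flip c) 0 := by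
  rw [hasFDerivAt_iff_isLittleO_nhds_zero]
  have hO : (fun z : ℂ => u (0 + z) - u 0 - ((ContinuousLinearMap.mul ℝ ℂ).flip c) z) =O[𝓝 0]
      fun z => ‖z‖^(3/2:ℝ) := by
    refine Asymptotics.IsBigO.of_bound C ?_
    filter_upwards [ball_mem_nhds (0:ℂ) hσ] with z hz
    have := h z (by simpa using hz)
    rw [Real.norm_of_nonneg (by positivity)]
    simpa [u0, mul_comm c] using this
  refine hO.trans_isLittleO ?_
  refine Asymptotics.isLittleO_norm_right.1 ?_
  have h2 : (fun z : ℂ => ‖z‖^(3/2:ℝ)) = fun z => ‖z‖^(1/2:ℝ) * ‖z‖ := by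
    funext z
    conv_rhs => rw [← Real.rpow_one ‖z‖, ← Real.rpow_mul (norm_nonneg _)]
    rw [← Real.rpow_add_of_nonneg (norm_nonneg _) (by norm_num) (by norm_num)]; norm_num
  rw [h2]
  have h3 : Tendsto (fun z : ℂ => ‖z‖^(1/2:ℝ)) (𝓝 0) (𝓝 0) := by
    have : ContinuousAt (fun z : ℂ => ‖z‖^(1/2:ℝ)) 0 :=
      continuousAt_id.norm.rpow_const (Or.inr (by norm_num))
    simpa [ContinuousAt] using this
  have h4 := ((Asymptotics.isLittleO_one_iff ℝ).2 h3).mul_isBigO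
    (Asymptotics.isBigO_refl (fun z : ℂ => ‖z‖) (𝓝 0))
  simpa using h4

lemma reg_scalar : ∃ C > 0, ∀ (φ : ℂ → ℂ) (A B K : ℝ), 0 ≤ A → 0 ≤ B →
    (∀ z, ‖z‖ < 1 → DifferentiableAt ℝ φ z) → (∀ z, ‖z‖ < 1 → ‖fderiv ℝ φ z‖ ≤ K) →
    φ 0 = 0 → (∀ z, ‖z‖ < 1 → ‖φ z‖ ≤ A) → (∀ z, ‖z‖ < 1 → ‖dbar φ z‖ ≤ B * ‖z‖) →
    (∀ ξ, ‖fderiv ℝ φ 0 ξ‖ ≤ C * (A + B) * ‖ξ‖) ∧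
    ∀ z, ‖z‖ < 1/2 → ‖φ z - fderiv ℝ φ 0 z‖ ≤ C * (A + B) * ‖z‖^(3/2:ℝ) := by
  obtain ⟨χ, Kχ, χs, χ1, χ0, χb, χK, Kχ0⟩ := cutoff (1/2) (3/4) (by norm_num) (by norm_num)
  obtain ⟨C, hC, hexp⟩ := Adm.expand0 (F := ℂ) (M := 1)
  refine ⟨C * (2 * Kχ + 1), by positivity, ?_⟩
  intro φ A B K hA hB hd hK φ0 hφA hφB
  have hK0 : 0 ≤ K := (norm_nonneg _).trans (hK 0 (by simp))
  have χd : Differentiable ℝ χ := χs.differentiable (by simp)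
  set u : ℂ → ℂ := fun z => χ z • φ z with hu
  have uout : ∀ z, 3/4 ≤ ‖z‖ → u z = 0 := fun z hz => by simp [hu, χ0 z hz]
  have uder : ∀ z, ‖z‖ < 1 → HasFDerivAt u (χ z • fderiv ℝ φ z +
      (fderiv ℝ χ z).smulRight (φ z)) z := fun z hz => (χd z).hasFDerivAt.smul (hd z hz).hasFDerivAt
  have uder0 : ∀ z, 3/4 < ‖z‖ → HasFDerivAt u (0 : ℂ →L[ℝ] ℂ) z := by
    intro z hz
    refine (hasFDerivAt_const (0:ℂ) z).congr_of_eventuallyEq ?_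
    filter_upwards [(isOpen_lt continuous_const continuous_norm).mem_nhds hz] with w hw
    exact uout w (le_of_lt hw)
  have hdu : Differentiable ℝ u := by
    intro z
    rcases lt_or_ge ‖z‖ 1 with h | h
    · exact (uder z h).differentiableAt
    · exact (uder0 z (by linarith)).differentiableAt
  have hKu : ∀ z, ‖fderiv ℝ u z‖ ≤ K + Kχ * A := by
    intro z
    rcases lt_or_ge ‖z‖ 1 with h | h
    · rw [(uder z h).fderiv]
      refine (norm_add_le _ _).trans (add_le_add ?_ ?_)
      · rw [norm_smul, Real.norm_of_nonneg (χb z).1]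
        calc _ ≤ 1 * K := mul_le_mul (χb z).2 (hK z h) (norm_nonneg _) zero_le_one
          _ = K := one_mul K
      · rw [ContinuousLinearMap.norm_smulRight_apply]
        exact mul_le_mul (χK z) (hφA z h) (norm_nonneg _) Kχ0
    · rw [(uder0 z (by linarith)).fderiv]; simp; positivity
  have P := pompeiu u hdu _ hKu (3/4) uout
  have fχ0 : ∀ z, ‖z‖ < 1/2 → fderiv ℝ χ z = 0 := by
    intro z hz
    have : χ =ᶠ[𝓝 z] fun _ => 1 := by
      filter_upwards [(isOpen_lt continuous_norm continuous_const).mem_nhds hz] with w hw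
      exact χ1 w (le_of_lt hw)
    rw [this.fderiv_eq]; simp
  have dbu : ∀ z, ‖z‖ < 1 → dbar u z = χ z * dbar φ z + dbar (fun w => (χ w : ℂ)) z * φ z := by
    intro z hz
    have hχc : HasFDerivAt (fun w => (χ w : ℂ)) (Complex.ofRealCLM.comp (fderiv ℝ χ z)) z :=
      Complex.ofRealCLM.hasFDerivAt.comp z (χd z).hasFDerivAt
    simp only [dbar, (uder z hz).fderiv, hχc.fderiv]
    simp
    ring
  have dχ : ∀ z, ‖dbar (fun w => (χ w : ℂ)) z‖ ≤ Kχ := by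
    intro z
    have hχc : HasFDerivAt (fun w => (χ w : ℂ)) (Complex.ofRealCLM.comp (fderiv ℝ χ z)) z :=
      Complex.ofRealCLM.hasFDerivAt.comp z (χd z).hasFDerivAt
    simp only [dbar, hχc.fderiv]
    have h1 : ‖fderiv ℝ χ z 1‖ ≤ Kχ := by simpa using (fderiv ℝ χ z).le_of_opNorm_le (χK z) 1
    have h2 : ‖fderiv ℝ χ z Complex.I‖ ≤ Kχ := by
      simpa using (fderiv ℝ χ z).le_of_opNorm_le (χK z) Complex.I
    rw [norm_mul]
    have : ‖(Complex.ofRealCLM.comp (fderiv ℝ χ z)) 1 +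
      Complex.I * (Complex.ofRealCLM.comp (fderiv ℝ χ z)) Complex.I‖ ≤ Kχ + Kχ := by
      refine (norm_add_le _ _).trans (add_le_add ?_ ?_)
      · simpa using h1
      · simpa using h2
    have h3 : ‖(1/2:ℂ)‖ = 1/2 := by norm_num
    rw [h3]; linarith
  have dχ0 : ∀ z, ‖z‖ < 1/2 → dbar (fun w => (χ w : ℂ)) z = 0 := by
    intro z hz
    have hχc : HasFDerivAt (fun w => (χ w : ℂ)) (Complex.ofRealCLM.comp (fderiv ℝ χ z)) z :=
      Complex.ofRealCLM.hasFDerivAt.comp z (χd z).hasFDerivAt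
    simp only [dbar, hχc.fderiv, fχ0 z hz]
    simp
  have adm : Adm (dbar u) 1 ((2 * Kχ + 1) * (A + B)) := by
    refine ⟨?_, by positivity, ?_, ?_⟩
    · have m1 : Measurable (fun z => fderiv ℝ u z 1) := measurable_fderiv_apply_const ℝ u 1
      have m2 : Measurable (fun z => fderiv ℝ u z Complex.I) := measurable_fderiv_apply_const ℝ u _
      exact ((m1.add (m2.const_mul _)).const_mul _).aestronglyMeasurable
    · intro z
      have hz0 : 0 ≤ ‖z‖^(1/2:ℝ) := by positivity
      rcases lt_or_ge ‖z‖ 1 with h | h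
      · rw [dbu z h]
        have hle : ‖z‖ ≤ ‖z‖^(1/2:ℝ) := by
          simpa using Real.rpow_le_rpow_of_exponent_ge' (norm_nonneg z) h.le
            (by norm_num) (show (1/2:ℝ) ≤ 1 by norm_num)
        have e1 : ‖(χ z:ℂ) * dbar φ z‖ ≤ B * ‖z‖^(1/2:ℝ) := by
          rw [norm_mul, Complex.norm_real, Real.norm_of_nonneg (χb z).1]
          calc _ ≤ 1 * (B * ‖z‖) := mul_le_mul (χb z).2 (hφB z h) (norm_nonneg _) zero_le_one
            _ ≤ _ := by rw [one_mul]; gcongr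
        have e2 : ‖dbar (fun w => (χ w : ℂ)) z * φ z‖ ≤ 2 * Kχ * A * ‖z‖^(1/2:ℝ) := by
          rcases lt_or_ge ‖z‖ (1/2) with h' | h'
          · rw [dχ0 z h']; simp; positivity
          · rw [norm_mul]
            calc _ ≤ Kχ * A := mul_le_mul (dχ z) (hφA z h) (norm_nonneg _) Kχ0
              _ = 2 * Kχ * A * (1/2) := by ring
              _ ≤ _ := by gcongr; linarith
        refine (norm_add_le _ _).trans ((add_le_add e1 e2).trans ?_)
        have : 0 ≤ A * ‖z‖^(1/2:ℝ) := by positivity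
        have : 0 ≤ Kχ * B * ‖z‖^(1/2:ℝ) := by positivity
        nlinarith
      · have : dbar u z = 0 := by simp [dbar, (uder0 z (by linarith)).fderiv]
        rw [this]; simp; positivity
    · intro z hz; simp [dbar, (uder0 z (by linarith)).fderiv]
  obtain ⟨hc, hz⟩ := hexp _ _ adm
  set c := c0 (dbar u) with hcdef
  have u0 : u 0 = 0 := by simp [hu, φ0]
  have hφu : ∀ z, ‖z‖ < 1/2 → φ z = u z := fun z hz => by simp [hu, χ1 z hz.le]
  have rem : ∀ z, ‖z‖ < 1/2 → ‖φ z - z * c‖ ≤ C * ((2 * Kχ + 1) * (A + B)) * ‖z‖^(3/2:ℝ) := by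
    intro z hz'
    have := hz z
    rw [P, P, u0, ← hφu z hz'] at this
    simpa using this
  have der : fderiv ℝ φ 0 = (ContinuousLinearMap.mul ℝ ℂ).flip c :=
    (rpow_three_half_isLittleO (by norm_num) φ0 rem).fderiv
  constructor
  · intro ξ
    rw [der]
    simp only [ContinuousLinearMap.flip_apply, ContinuousLinearMap.mul_apply', norm_mul]
    rw [mul_comm ‖ξ‖]
    gcongr
    rw [mul_assoc]; exact hc
  · intro z hz'
    rw [der, mul_assoc C]
    exact rem z hz'

variable {E : Type*} [NormedAddCommGroup E] [NormedSpace ℝ E]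

lemma reg_unit : ∃ C > 0, ∀ (Λ a b K : ℝ) (j0 : E →L[ℝ] E) (f : ℂ → E), 0 ≤ a → 0 ≤ b →
    (∀ v, j0 (j0 v) = -v) → ‖j0‖ ≤ Λ →
    (∀ z, ‖z‖ < 1 → DifferentiableAt ℝ f z) → (∀ z, ‖z‖ < 1 → ‖fderiv ℝ f z‖ ≤ K) →
    (∀ z, ‖z‖ < 1 → ‖f z - f 0‖ ≤ a) →
    (∀ z, ‖z‖ < 1 → ‖fderiv ℝ f z 1 + j0 (fderiv ℝ f z Complex.I)‖ ≤ b * ‖z‖) →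
    ‖fderiv ℝ f 0‖ ≤ C * (1 + Λ) * (a + b) ∧
    ∀ z, ‖z‖ < 1/2 → ‖f z - f 0 - fderiv ℝ f 0 z‖ ≤ C * (1 + Λ) * (a + b) * ‖z‖^(3/2:ℝ) := by
  obtain ⟨C, hC, key⟩ := reg_scalar
  refine ⟨C, hC, ?_⟩
  intro Λ a b K j0 f ha hb hj hΛ hd hK hfa hfb
  have hΛ0 : 0 ≤ Λ := (norm_nonneg _).trans hΛ
  have main : ∀ l : E →L[ℝ] ℝ, ‖l‖ ≤ 1 → (∀ ξ, |l (fderiv ℝ f 0 ξ)| ≤ C * (1 + Λ) * (a + b) * ‖ξ‖) ∧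
      ∀ z, ‖z‖ < 1/2 → |l (f z - f 0 - fderiv ℝ f 0 z)| ≤
        C * (1 + Λ) * (a + b) * ‖z‖^(3/2:ℝ) := by
    intro l hl
    set Q : E →L[ℝ] ℂ := Complex.ofRealCLM.comp l -
      (ContinuousLinearMap.mul ℝ ℂ Complex.I).comp (Complex.ofRealCLM.comp (l.comp j0)) with hQ
    have Qa : ∀ v, Q v = (l v : ℂ) - Complex.I * (l (j0 v) : ℂ) := fun v => by simp [hQ]
    have Qj : ∀ v, Q (j0 v) = Complex.I * Q v := by
      intro v; rw [Qa, Qa, hj]; simp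
      linear_combination (l (j0 v) : ℂ) * Complex.I_sq
    have lb : ∀ v, ‖(l v : ℂ)‖ ≤ ‖v‖ := fun v => by
      rw [Complex.norm_real]; simpa using l.le_of_opNorm_le hl v
    have Qn : ∀ v, ‖Q v‖ ≤ (1 + Λ) * ‖v‖ := by
      intro v
      rw [Qa]
      refine (norm_sub_le _ _).trans ?_
      have h2 : ‖Complex.I * (l (j0 v) : ℂ)‖ ≤ Λ * ‖v‖ := by
        rw [norm_mul, Complex.norm_I, one_mul]
        exact (lb _).trans (j0.le_of_opNorm_le hΛ v)
      linarith [lb v]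
    have Qre : ∀ v, |l v| ≤ ‖Q v‖ := by
      intro v
      have : l v = (Q v).re := by rw [Qa]; simp
      rw [this]; exact Complex.abs_re_le_norm _
    set φ : ℂ → ℂ := fun z => Q (f z - f 0) with hφ
    have φd : ∀ z, ‖z‖ < 1 → HasFDerivAt φ (Q.comp (fderiv ℝ f z)) z := fun z hz =>
      Q.hasFDerivAt.comp z ((hd z hz).hasFDerivAt.sub_const (f 0))
    obtain ⟨h1, h2⟩ := key φ ((1+Λ)*a) ((1+Λ)*b) ((1+Λ)*K) (by positivity) (by positivity)
      (fun z hz => (φd z hz).differentiableAt)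
      (fun z hz => by
        rw [(φd z hz).fderiv]
        have hK0 := (norm_nonneg _).trans (hK z hz)
        refine (ContinuousLinearMap.opNorm_comp_le _ _).trans (mul_le_mul ?_ (hK z hz)
          (norm_nonneg _) (by positivity))
        exact ContinuousLinearMap.opNorm_le_bound _ (by positivity) Qn)
      (by simp [hφ])
      (fun z hz => (Qn _).trans (by have := hfa z hz; gcongr))
      (fun z hz => by
        simp only [dbar, (φd z hz).fderiv, ContinuousLinearMap.comp_apply]
        rw [← Qj, ← map_add, norm_mul]
        have h3 : ‖(1/2:ℂ)‖ = 1/2 := by norm_num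
        rw [h3]
        have h4 := Qn (fderiv ℝ f z 1 + j0 (fderiv ℝ f z Complex.I))
        have h5 : (1 + Λ) * ‖fderiv ℝ f z 1 + j0 (fderiv ℝ f z Complex.I)‖ ≤ (1+Λ) * (b * ‖z‖) := by
          have := hfb z hz; gcongr
        have h6 := norm_nonneg (Q (fderiv ℝ f z 1 + j0 (fderiv ℝ f z Complex.I)))
        linarith)
    rw [(φd 0 (by simp)).fderiv] at h1 h2
    constructor
    · intro ξ
      refine (Qre _).trans ((h1 ξ).trans (le_of_eq (by ring)))
    · intro z hz
      refine (Qre _).trans ?_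
      have := h2 z hz
      rw [ContinuousLinearMap.comp_apply, hφ] at this
      simp only at this
      rw [← map_sub] at this
      exact this.trans (le_of_eq (by ring))
  have dual : ∀ (v : E) (N : ℝ), (∀ l : E →L[ℝ] ℝ, ‖l‖ ≤ 1 → |l v| ≤ N) → ‖v‖ ≤ N := by
    intro v N h
    obtain ⟨g, hg, hv⟩ := exists_dual_vector'' ℝ v
    have := h g hg
    rw [hv] at this
    simpa using this
  constructor
  · refine ContinuousLinearMap.opNorm_le_bound _ (by positivity) fun ξ => ?_
    exact dual _ _ fun l hl => (main l hl).1 ξ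
  · intro z hz
    exact dual _ _ fun l hl => (main l hl).2 z hz

lemma reg_ball : ∃ C > 0, ∀ (Λ a b K σ : ℝ) (w : ℂ) (j0 : E →L[ℝ] E) (f : ℂ → E), 0 < σ →
    0 ≤ a → 0 ≤ b → (∀ v, j0 (j0 v) = -v) → ‖j0‖ ≤ Λ →
    (∀ z ∈ ball w σ, DifferentiableAt ℝ f z) → (∀ z ∈ ball w σ, ‖fderiv ℝ f z‖ ≤ K) →
    (∀ z ∈ ball w σ, ‖f z - f w‖ ≤ a) →
    (∀ z ∈ ball w σ, ‖fderiv ℝ f z 1 + j0 (fderiv ℝ f z Complex.I)‖ ≤ b * ‖z - w‖) →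
    ‖fderiv ℝ f w‖ ≤ C * (1 + Λ) * (a / σ + b * σ) ∧
    ∀ z ∈ ball w (σ/2), ‖f z - f w - fderiv ℝ f w (z - w)‖ ≤
      C * (1 + Λ) * (a + b * σ^2) * (‖z - w‖ / σ)^(3/2:ℝ) := by
  obtain ⟨C, hC, key⟩ := reg_unit (E := E)
  refine ⟨C, hC, ?_⟩
  intro Λ a b K σ w j0 f hσ ha hb hj hΛ hd hK hfa hfb
  have mem : ∀ z : ℂ, ‖z‖ < 1 → w + (σ:ℂ) * z ∈ ball w σ := by
    intro z hz
    rw [mem_ball, dist_eq_norm]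
    simp only [add_sub_cancel_left, norm_mul, Complex.norm_real, Real.norm_of_nonneg hσ.le]
    nlinarith
  set g : ℂ → E := fun z => f (w + (σ:ℂ) * z) with hg
  have gd : ∀ z, ‖z‖ < 1 → HasFDerivAt g (σ • fderiv ℝ f (w + (σ:ℂ) * z)) z := by
    intro z hz
    have h1 : HasFDerivAt (fun z : ℂ => w + (σ:ℂ) * z) (σ • ContinuousLinearMap.id ℝ ℂ) z := by
      have := ((σ • ContinuousLinearMap.id ℝ ℂ).hasFDerivAt (x := z)).const_add w
      refine this.congr_of_eventuallyEq (Eventually.of_forall fun y => ?_)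
      simp
    have := (hd _ (mem z hz)).hasFDerivAt.comp z h1
    have e : σ • fderiv ℝ f (w + (σ:ℂ) * z) = (fderiv ℝ f (w + (σ:ℂ) * z)).comp
        (σ • ContinuousLinearMap.id ℝ ℂ) := by ext; simp
    rw [e]; exact this
  obtain ⟨h1, h2⟩ := key Λ a (b*σ^2) (σ * K) j0 g ha (by positivity) hj hΛ
    (fun z hz => (gd z hz).differentiableAt)
    (fun z hz => by
      rw [(gd z hz).fderiv, norm_smul, Real.norm_of_nonneg hσ.le]
      have := hK _ (mem z hz); gcongr)
    (fun z hz => by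
      have := hfa _ (mem z hz)
      simpa [hg] using this)
    (fun z hz => by
      rw [(gd z hz).fderiv]
      have := hfb _ (mem z hz)
      simp only [add_sub_cancel_left, norm_mul, Complex.norm_real, Real.norm_of_nonneg hσ.le] at this
      simp only [_root_.smul_apply, map_smul]
      rw [← smul_add, norm_smul, Real.norm_of_nonneg hσ.le]
      calc _ ≤ σ * (b * (σ * ‖z‖)) := by gcongr
        _ = _ := by ring)
  have e0 : w + (σ:ℂ) * 0 = w := by simp
  rw [(gd 0 (by simp)).fderiv, e0] at h1 h2
  constructor
  · rw [norm_smul, Real.norm_of_nonneg hσ.le] at h1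
    have : C * (1 + Λ) * (a / σ + b * σ) = (C * (1 + Λ) * (a + b * σ^2)) / σ := by
      field_simp
    rw [this, le_div_iff₀ hσ]; linarith
  · intro z hz
    have hσ' : (σ:ℂ) ≠ 0 := by exact_mod_cast hσ.ne'
    have hz' : ‖(z - w) / (σ:ℂ)‖ = ‖z - w‖ / σ := by
      rw [norm_div, Complex.norm_real, Real.norm_of_nonneg hσ.le]
    have := h2 ((z - w)/(σ:ℂ)) (by
      rw [hz', div_lt_iff₀ hσ]; rw [mem_ball, dist_eq_norm] at hz; linarith)
    rw [hz'] at this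
    have e1 : g ((z - w)/(σ:ℂ)) = f z := by
      simp only [hg]; congr 1; field_simp; ring
    have e2 : g 0 = f w := by simp [hg]
    have e3 : (σ • fderiv ℝ f w) ((z-w)/(σ:ℂ)) = fderiv ℝ f w (z - w) := by
      rw [_root_.smul_apply, ← map_smul]
      congr 1; rw [Complex.real_smul]; field_simp
    rw [e1, e2, e3] at this
    exact this

end JHP
end

section
namespace JHP
open MeasureTheory
variable {E : Type*} [NormedAddCommGroup E] [NormedSpace ℝ E]

lemma rpow_split (x : ℝ) (hx : 0 ≤ x) : x^(3/2:ℝ) = x^(1/2:ℝ) * x := by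
  conv_rhs => rw [← Real.rpow_one x, ← Real.rpow_mul hx]
  rw [← Real.rpow_add_of_nonneg hx (by norm_num) (by norm_num)]; norm_num

lemma two_rpow : (2:ℝ)^(3/2:ℝ) ≤ 3 := by
  rw [rpow_split 2 (by norm_num), ← Real.sqrt_eq_rpow]
  have : Real.sqrt 2 ≤ 3/2 := by
    rw [Real.sqrt_le_left (by norm_num)]; norm_num
  linarith

lemma conv_taylor {S : Set ℂ} {u : ℂ → E} {L : ℂ → (ℂ →L[ℝ] E)} {σ C : ℝ} (hC : 0 ≤ C)
    (h : ∀ z0 ∈ S, ∀ z, ‖z - z0‖ < σ → ‖u z - u z0 - L z0 (z - z0)‖ ≤ C * ‖z - z0‖^(3/2:ℝ))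
    {z0 z1 : ℂ} (h0 : z0 ∈ S) (h1 : z1 ∈ S) (hd : 2 * ‖z1 - z0‖ < σ) :
    ‖L z0 - L z1‖ ≤ 5 * C * ‖z1 - z0‖^(1/2:ℝ) := by
  set δ := ‖z1 - z0‖ with hδ
  rcases (norm_nonneg (z1 - z0)).eq_or_lt with h00 | hpos
  · have : z1 = z0 := by rw [← sub_eq_zero, ← norm_eq_zero, ← h00]
    subst this; simp; positivity
  refine ContinuousLinearMap.opNorm_le_bound _ (by positivity) fun ξ => ?_
  rcases eq_or_ne ξ 0 with rfl | hξ
  · simp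
  have hξ' : 0 < ‖ξ‖ := norm_pos_iff.2 hξ
  set h' : ℂ := (δ / ‖ξ‖) • ξ with hh
  have hn : ‖h'‖ = δ := by
    rw [hh, norm_smul, Real.norm_of_nonneg (by positivity)]; field_simp
  have hs : δ < σ := by linarith
  have A1 := h z1 h1 (z1 + h') (by rw [add_sub_cancel_left, hn]; exact hs)
  have nb : ‖z1 + h' - z0‖ ≤ 2 * δ := by
    have : z1 + h' - z0 = (z1 - z0) + h' := by ring
    rw [this]; refine (norm_add_le _ _).trans ?_; rw [hn]; linarith
  have A2 := h z0 h0 (z1 + h') (lt_of_le_of_lt nb hd)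
  have A3 := h z0 h0 z1 (by linarith)
  rw [add_sub_cancel_left, hn] at A1
  have A2' : C * ‖z1 + h' - z0‖^(3/2:ℝ) ≤ 3 * C * δ^(3/2:ℝ) := by
    calc _ ≤ C * (2 * δ)^(3/2:ℝ) := by gcongr
      _ = C * ((2:ℝ)^(3/2:ℝ) * δ^(3/2:ℝ)) := by rw [Real.mul_rpow (by norm_num) hpos.le]
      _ ≤ C * (3 * δ^(3/2:ℝ)) := by gcongr; exact two_rpow
      _ = _ := by ring
  have e : (L z0 - L z1) h' = (u (z1 + h') - u z1 - L z1 h') - (u (z1 + h') - u z0 -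
      L z0 (z1 + h' - z0)) + (u z1 - u z0 - L z0 (z1 - z0)) := by
    have : z1 + h' - z0 = (z1 - z0) + h' := by ring
    rw [this, map_add, _root_.sub_apply]; abel
  have B : ‖(L z0 - L z1) h'‖ ≤ 5 * C * δ^(3/2:ℝ) := by
    rw [e]
    refine (norm_add_le _ _).trans ((add_le_add_left (norm_sub_le _ _) _).trans ?_)
    linarith
  rw [hh, map_smul, norm_smul, Real.norm_of_nonneg (by positivity), rpow_split _ hpos.le] at B
  have : δ / ‖ξ‖ * ‖(L z0 - L z1) ξ‖ = δ * (‖(L z0 - L z1) ξ‖ / ‖ξ‖) := by ring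
  rw [this] at B
  have B2 : ‖(L z0 - L z1) ξ‖ / ‖ξ‖ ≤ 5 * C * δ^(1/2:ℝ) := by
    refine le_of_mul_le_mul_left ?_ hpos
    calc _ ≤ _ := B
      _ = _ := by ring
  rwa [div_le_iff₀ hξ'] at B2

lemma conv_taylor' {S : Set ℂ} {u : ℂ → E} {L : ℂ → (ℂ →L[ℝ] E)} {σ C K : ℝ} (hC : 0 ≤ C)
    (hσ : 0 < σ) (hK : ∀ z ∈ S, ‖L z‖ ≤ K)
    (h : ∀ z0 ∈ S, ∀ z, ‖z - z0‖ < σ → ‖u z - u z0 - L z0 (z - z0)‖ ≤ C * ‖z - z0‖^(3/2:ℝ))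
    {z0 z1 : ℂ} (h0 : z0 ∈ S) (h1 : z1 ∈ S) :
    ‖L z0 - L z1‖ ≤ (5 * C + 2 * K * (2 / σ)^(1/2:ℝ)) * ‖z1 - z0‖^(1/2:ℝ) := by
  have hK0 : 0 ≤ K := (norm_nonneg _).trans (hK _ h0)
  rcases lt_or_ge (2 * ‖z1 - z0‖) σ with hd | hd
  · refine (conv_taylor hC h h0 h1 hd).trans ?_
    gcongr
    have : 0 ≤ 2 * K * (2 / σ)^(1/2:ℝ) := by positivity
    linarith
  · have e : 1 ≤ (2 / σ)^(1/2:ℝ) * ‖z1 - z0‖^(1/2:ℝ) := by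
      rw [← Real.mul_rpow (by positivity) (norm_nonneg _)]
      refine Real.one_le_rpow ?_ (by norm_num)
      rw [div_mul_eq_mul_div, le_div_iff₀ hσ]; linarith
    have e2 : ‖L z0 - L z1‖ ≤ 2 * K := (norm_sub_le _ _).trans (by linarith [hK _ h0, hK _ h1])
    have e3 : 2 * K * 1 ≤ 2 * K * ((2 / σ)^(1/2:ℝ) * ‖z1 - z0‖^(1/2:ℝ)) := by gcongr
    have : 0 ≤ 5 * C * ‖z1 - z0‖^(1/2:ℝ) := by positivity
    nlinarith

/-- `f` is pseudo-holomorphic on `U` for the pulled back structure `j`, with a Lipschitz control. -/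
structure Jh (f : ℂ → E) (j : ℂ → (E →L[ℝ] E)) (U : Set ℂ) (Λ : ℝ) : Prop where
  diff : ∀ z ∈ U, DifferentiableAt ℝ f z
  sq : ∀ z ∈ U, ∀ v, j z (j z v) = -v
  nn : 0 ≤ Λ
  bd : ∀ z ∈ U, ‖j z‖ ≤ Λ
  eq : ∀ z ∈ U, fderiv ℝ f z 1 + j z (fderiv ℝ f z Complex.I) = 0
  lip : ∀ z ∈ U, ∀ w ∈ U, ‖j z - j w‖ ≤ Λ * ‖f z - f w‖

lemma Jh.mono {f : ℂ → E} {j : ℂ → (E →L[ℝ] E)} {U V : Set ℂ} {Λ : ℝ} (h : Jh f j U Λ)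
    (hV : V ⊆ U) : Jh f j V Λ :=
  ⟨fun z hz => h.diff z (hV hz), fun z hz => h.sq z (hV hz), h.nn, fun z hz => h.bd z (hV hz),
    fun z hz => h.eq z (hV hz), fun z hz w hw => h.lip z (hV hz) w (hV hw)⟩

lemma jh_local : ∃ C > 0, ∀ (Λ a K σ : ℝ) (w : ℂ) (j : ℂ → (E →L[ℝ] E)) (f : ℂ → E), 0 < σ →
    0 ≤ a → 0 ≤ K → Jh f j (ball w σ) Λ → (∀ z ∈ ball w σ, ‖fderiv ℝ f z‖ ≤ K) →
    (∀ z ∈ ball w σ, ‖f z - f w‖ ≤ a) →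
    ‖fderiv ℝ f w‖ ≤ C * (1 + Λ) * (a / σ + Λ * K^2 * σ) ∧
    ∀ z ∈ ball w (σ/2), ‖f z - f w - fderiv ℝ f w (z - w)‖ ≤
      C * (1 + Λ) * (a + Λ * K^2 * σ^2) * (‖z - w‖ / σ)^(3/2:ℝ) := by
  obtain ⟨C, hC, key⟩ := reg_ball (E := E)
  refine ⟨C, hC, ?_⟩
  intro Λ a K σ w j f hσ ha hK0 H hK hfa
  have hw : w ∈ ball w σ := mem_ball_self hσ
  have nn := H.nn
  refine key Λ a (Λ * K^2) K σ w (j w) f hσ ha (by positivity) (H.sq w hw) (H.bd w hw) H.diff hK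
    hfa ?_
  intro z hz
  have e : fderiv ℝ f z 1 + j w (fderiv ℝ f z Complex.I) =
      (j w - j z) (fderiv ℝ f z Complex.I) := by
    have := H.eq z hz
    rw [_root_.sub_apply, eq_neg_of_add_eq_zero_left this]; abel
  rw [e]
  have h1 : ‖f w - f z‖ ≤ K * ‖w - z‖ :=
    (convex_ball w σ).norm_image_sub_le_of_norm_fderiv_le (𝕜 := ℝ) H.diff hK hz hw
  have h2 : ‖fderiv ℝ f z Complex.I‖ ≤ K := by
    simpa using (fderiv ℝ f z).le_of_opNorm_le (hK z hz) Complex.I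
  calc _ ≤ ‖j w - j z‖ * ‖fderiv ℝ f z Complex.I‖ := ContinuousLinearMap.le_opNorm _ _
    _ ≤ (Λ * (K * ‖w - z‖)) * K := by
      refine mul_le_mul ((H.lip w hw z hz).trans ?_) h2 (norm_nonneg _) (by positivity)
      gcongr
    _ = _ := by rw [norm_sub_rev]; ring

lemma jh_grad (Λ : ℝ) (hΛ : 0 ≤ Λ) : ∃ a0 > 0, ∃ C > 0, ∀ (a K d : ℝ) (z : ℂ)
    (j : ℂ → (E →L[ℝ] E)) (f : ℂ → E), 0 < d → 0 ≤ a → a ≤ a0 → Jh f j (ball z d) Λ →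
    (∀ w ∈ ball z d, ‖fderiv ℝ f w‖ ≤ K) → (∀ w ∈ ball z d, ‖f w - f z‖ ≤ a) →
    ‖fderiv ℝ f z‖ ≤ C * a / d := by
  obtain ⟨C, hC, key⟩ := jh_local (E := E)
  set D := 4 * (C * (1 + Λ)) * (1 + Λ) with hD
  have hD0 : 0 < D := by positivity
  refine ⟨1 / (8 * D^2), by positivity, 4 * D, by positivity, ?_⟩
  intro a K d z j f hd ha haa H hK hfa
  set S : Set ℝ := (fun w => (d - ‖w - z‖) * ‖fderiv ℝ f w‖) '' ball z d with hS
  have hzb : z ∈ ball z d := mem_ball_self hd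
  have hK0 : 0 ≤ K := (norm_nonneg _).trans (hK z hzb)
  have bdd : BddAbove S := by
    refine ⟨d * K, ?_⟩
    rintro _ ⟨w, hw, rfl⟩
    have h1 := hK w hw
    simp only
    gcongr
    linarith [norm_nonneg (w - z)]
  set M := sSup S with hM
  have hle : ∀ w ∈ ball z d, (d - ‖w - z‖) * ‖fderiv ℝ f w‖ ≤ M := fun w hw =>
    le_csSup bdd ⟨w, hw, rfl⟩
  have hM0 : d * ‖fderiv ℝ f z‖ ≤ M := by simpa using hle z hzb
  have hMn : 0 ≤ M := le_trans (by positivity) hM0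
  have step : ∀ s, 0 < s → s ≤ 1/2 → M ≤ D * (a / s + M^2 * s) := by
    intro s hs hs2
    refine csSup_le ⟨_, ⟨z, hzb, rfl⟩⟩ ?_
    rintro _ ⟨w, hw, rfl⟩
    simp only
    have hwn : ‖w - z‖ < d := by rwa [mem_ball, dist_eq_norm] at hw
    set ρ := d - ‖w - z‖ with hρ
    have hρ0 : 0 < ρ := by linarith
    have hsub : ∀ x ∈ ball w (s * ρ), ρ / 2 ≤ d - ‖x - z‖ ∧ x ∈ ball z d := by
      intro x hx
      rw [mem_ball, dist_eq_norm] at hx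
      have h1 : ‖x - z‖ ≤ ‖x - w‖ + ‖w - z‖ := norm_sub_le_norm_sub_add_norm_sub _ _ _
      have h2 : s * ρ ≤ ρ / 2 := by nlinarith
      have h3 : ρ / 2 ≤ d - ‖x - z‖ := by linarith
      refine ⟨h3, ?_⟩
      rw [mem_ball, dist_eq_norm]; linarith
    have hb : ∀ x ∈ ball w (s * ρ), ‖fderiv ℝ f x‖ ≤ 2 * M / ρ := by
      intro x hx
      obtain ⟨h1, h2⟩ := hsub x hx
      have h3 := hle x h2
      rw [le_div_iff₀ hρ0]
      have : ρ / 2 * ‖fderiv ℝ f x‖ ≤ M := le_trans (by gcongr) h3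
      linarith
    obtain ⟨h1, -⟩ := key Λ (2 * a) (2 * M / ρ) (s * ρ) w j f (by positivity) (by positivity)
      (by positivity) (H.mono fun x hx => (hsub x hx).2) hb (by
        intro x hx
        have e : f x - f w = (f x - f z) - (f w - f z) := by abel
        rw [e]
        refine (norm_sub_le _ _).trans ?_
        linarith [hfa x (hsub x hx).2, hfa w hw])
    calc ρ * ‖fderiv ℝ f w‖ ≤ ρ * (C * (1 + Λ) * (2 * a / (s * ρ) +
          Λ * (2 * M / ρ)^2 * (s * ρ))) := by gcongr
      _ = C * (1 + Λ) * (2 * (a / s) + 4 * Λ * (M^2 * s)) := by field_simp; ring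
      _ ≤ C * (1 + Λ) * (4 * (1 + Λ) * (a / s + M^2 * s)) := by
        have : 0 ≤ a / s := by positivity
        have : 0 ≤ M^2 * s := by positivity
        have : 0 ≤ Λ * (a / s) := by positivity
        gcongr
        nlinarith
      _ = _ := by rw [hD]; ring
  have fin : M ≤ 4 * D * a := by
    rcases le_or_gt (D * M) 1 with h | h
    · have h1 := step (1/2) (by norm_num) le_rfl
      have h2 : D * M * M ≤ 1 * M := by gcongr
      have h3 : D * (a / (1/2) + M^2 * (1/2)) = 2 * D * a + D * M * M / 2 := by ring
      linarith
    · exfalso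
      have hMp : 0 < M := by
        by_contra hc
        have : M = 0 := le_antisymm (not_lt.1 hc) hMn
        rw [this] at h; norm_num at h
      have h1 := step (1 / (2 * D * M)) (by positivity) (by
        rw [div_le_div_iff₀ (by positivity) (by norm_num)]; linarith)
      have h2 : D * (a / (1 / (2 * D * M)) + M^2 * (1 / (2 * D * M))) = M * (2 * D^2 * a + 1/2) := by
        field_simp
      have h3 : 2 * D^2 * a ≤ 1/4 := by
        calc 2 * D^2 * a ≤ 2 * D^2 * (1 / (8 * D^2)) := by gcongr
          _ = 1/4 := by field_simp; norm_num
      rw [h2] at h1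
      nlinarith
  rw [le_div_iff₀ hd]; linarith

end JHP
end

section
namespace JHP
open MeasureTheory
variable {E : Type*} [NormedAddCommGroup E] [NormedSpace ℝ E]

/-- derivative bounded near `z` -/
def Good (f : ℂ → E) (U : Set ℂ) (z : ℂ) : Prop :=
  ∃ ρ > 0, ∃ K, ball z ρ ⊆ U ∧ ∀ w ∈ ball z ρ, ‖fderiv ℝ f w‖ ≤ K

lemma good_nhds {f : ℂ → E} {U : Set ℂ} {z : ℂ} {ρ K : ℝ} (h : ball z ρ ⊆ U)
    (hK : ∀ w ∈ ball z ρ, ‖fderiv ℝ f w‖ ≤ K) : ∀ w ∈ ball z ρ, Good f U w := by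
  intro w hw
  obtain ⟨δ, hδ, hs⟩ := Metric.isOpen_iff.1 isOpen_ball w hw
  exact ⟨δ, hδ, K, hs.trans h, fun x hx => hK x (hs hx)⟩

lemma good_compact {f : ℂ → E} {U k : Set ℂ} (hk : IsCompact k) (h : ∀ z ∈ k, Good f U z) :
    ∃ K, ∀ z ∈ k, ‖fderiv ℝ f z‖ ≤ K := by
  refine hk.induction_on (p := fun s => ∃ K, ∀ z ∈ s, ‖fderiv ℝ f z‖ ≤ K) ⟨0, by simp⟩ ?_ ?_ ?_
  · rintro s t hst ⟨K, hK⟩; exact ⟨K, fun z hz => hK z (hst hz)⟩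
  · rintro s t ⟨K, hK⟩ ⟨K', hK'⟩
    refine ⟨max K K', ?_⟩
    rintro z (hz | hz)
    exacts [(hK z hz).trans (le_max_left _ _), (hK' z hz).trans (le_max_right _ _)]
  · intro z hz
    obtain ⟨ρ, hρ, K, -, hK⟩ := h z hz
    exact ⟨ball z ρ, mem_nhdsWithin_of_mem_nhds (ball_mem_nhds z hρ), K, hK⟩

lemma jh_good {f : ℂ → E} {j : ℂ → (E →L[ℝ] E)} {U : Set ℂ} {Λ : ℝ} (hU : IsOpen U)
    (H : Jh f j U Λ) : ∀ z ∈ U, Good f U z := by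
  obtain ⟨a0, ha0, C, hC, key⟩ := jh_grad (E := E) Λ H.nn
  set E0 : Set ℂ := U ∩ {z | Good f U z}ᶜ with hE0
  have openG : IsOpen {z | Good f U z} := by
    rw [Metric.isOpen_iff]
    rintro z ⟨ρ, hρ, K, h1, h2⟩
    exact ⟨ρ, hρ, fun w hw => good_nhds h1 h2 w hw⟩
  by_contra hne
  push Not at hne
  obtain ⟨z1, hz1, hz1'⟩ := hne
  have lc : IsLocallyClosed E0 := hU.isLocallyClosed.inter openG.isClosed_compl.isLocallyClosed
  have : LocallyCompactSpace E0 := lc.locallyCompactSpace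
  have : Nonempty E0 := ⟨⟨z1, hz1, hz1'⟩⟩
  have fc : ContinuousOn f U := fun z hz => (H.diff z hz).continuousAt.continuousWithinAt
  set Fk : ℕ → Set E0 := fun k => {z | ∀ w ∈ U, ‖w - z‖ < 1 / ((k:ℝ)+1) →
    ‖f w - f z‖ ≤ ((k:ℝ)+1) * ‖w - z‖} with hFk
  have fE : Continuous (fun z : E0 => f z) := by
    have := fc.mono (show E0 ⊆ U from inter_subset_left)
    exact continuousOn_iff_continuous_domRestrict.1 this
  have closedF : ∀ k, IsClosed (Fk k) := by
    intro k
    have : Fk k = ⋂ w ∈ U, {z : E0 | 1 / ((k:ℝ)+1) ≤ ‖w - z‖} ∪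
        {z : E0 | ‖f w - f z‖ ≤ ((k:ℝ)+1) * ‖w - z‖} := by
      ext z
      simp only [hFk, mem_ofPred_eq, mem_iInter, mem_union]
      constructor
      · intro h w hw
        rcases lt_or_ge ‖w - z‖ (1 / ((k:ℝ)+1)) with h' | h'
        · exact Or.inr (h w hw h')
        · exact Or.inl h'
      · intro h w hw h'
        exact (h w hw).resolve_left (not_le.2 h')
    rw [this]
    refine isClosed_biInter fun w _ => IsClosed.union ?_ ?_
    · exact isClosed_le continuous_const (by fun_prop)
    · exact isClosed_le (continuous_const.sub fE).norm (by fun_prop)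
  have cover : ⋃ k, Fk k = univ := by
    rw [eq_univ_iff_forall]
    intro z
    have hz : (z:ℂ) ∈ U := z.2.1
    have h1 := (H.diff z hz).hasFDerivAt.isBigO_sub
    obtain ⟨c, hc⟩ := h1.bound
    obtain ⟨ρ, hρ, hb⟩ := Metric.eventually_nhds_iff_ball.1 hc
    obtain ⟨k, hk⟩ := exists_nat_gt (max c (1/ρ))
    refine mem_iUnion.2 ⟨k, ?_⟩
    intro w hw hwz
    have hk1 : c < k := lt_of_le_of_lt (le_max_left _ _) hk
    have hk2 : 1/ρ < k := lt_of_le_of_lt (le_max_right _ _) hk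
    have hk0 : (0:ℝ) < k := lt_trans (by positivity) hk2
    have h3 : 1 / ((k:ℝ)+1) < ρ := by
      rw [div_lt_iff₀ (by positivity)]
      rw [div_lt_iff₀ hρ] at hk2
      nlinarith
    have := hb w (by rw [mem_ball, dist_eq_norm]; linarith)
    refine this.trans ?_
    gcongr
    linarith
  obtain ⟨k, hk⟩ := nonempty_interior_of_iUnion_of_closed closedF cover
  obtain ⟨e0, he0⟩ := hk
  rw [mem_interior_iff_mem_nhds, nhds_subtype_eq_comap, mem_comap] at he0
  obtain ⟨t, ht, htF⟩ := he0
  obtain ⟨ρ0, hρ0, htb⟩ := Metric.mem_nhds_iff.1 ht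
  have inF : ∀ z (hz : z ∈ E0), z ∈ ball (e0:ℂ) ρ0 → (⟨z, hz⟩ : E0) ∈ Fk k := fun z hz hb =>
    htF (show (⟨z, hz⟩ : E0) ∈ _ from htb hb)
  set κ : ℝ := (k:ℝ) + 1 with hκ
  have hκ0 : 0 < κ := by positivity
  obtain ⟨ρU, hρU, hUb⟩ := Metric.isOpen_iff.1 hU e0 e0.2.1
  obtain ⟨ρ1, hρ1, h1a, h1b, h1c, h1d⟩ : ∃ ρ1 > 0, 4 * ρ1 ≤ ρ0 ∧ 4 * ρ1 ≤ ρU ∧ 4 * ρ1 ≤ 1 / κ ∧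
      5 * κ * ρ1 ≤ a0 := by
    refine ⟨min (min (ρ0/4) (ρU/4)) (min (1/κ/4) (a0/(5*κ))), by positivity, ?_, ?_, ?_, ?_⟩
    · have := (min_le_left (min (ρ0/4) (ρU/4)) (min (1/κ/4) (a0/(5*κ)))).trans (min_le_left _ _)
      linarith
    · have := (min_le_left (min (ρ0/4) (ρU/4)) (min (1/κ/4) (a0/(5*κ)))).trans (min_le_right _ _)
      linarith
    · have := (min_le_right (min (ρ0/4) (ρU/4)) (min (1/κ/4) (a0/(5*κ)))).trans (min_le_left _ _)
      linarith
    · have := (min_le_right (min (ρ0/4) (ρU/4)) (min (1/κ/4) (a0/(5*κ)))).trans (min_le_right _ _)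
      rw [le_div_iff₀ (by positivity)] at this
      linarith
  refine e0.2.2 ⟨ρ1, hρ1, max κ (C * (5 * κ) * 2), ?_, ?_⟩
  · exact (ball_subset_ball (by linarith)).trans hUb
  intro z hz
  have hzn : ‖z - e0‖ < ρ1 := by rwa [mem_ball, dist_eq_norm] at hz
  have inU : ∀ w : ℂ, ‖w - e0‖ < 4 * ρ1 → w ∈ U := fun w hw => hUb (by
    rw [mem_ball, dist_eq_norm]; linarith)
  have hzU : z ∈ U := inU z (by linarith)
  by_cases hzE : z ∈ E0
  · refine le_max_of_le_left ?_
    have hF := inF z hzE (by rw [mem_ball, dist_eq_norm]; linarith)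
    refine (H.diff z hzU).hasFDerivAt.le_of_lip' hκ0.le ?_
    have : U ∩ ball z (1/κ) ∈ 𝓝 z := inter_mem (hU.mem_nhds hzU) (ball_mem_nhds z (by positivity))
    filter_upwards [this] with w hw
    exact hF w hw.1 (by rw [← dist_eq_norm]; exact hw.2)
  · refine le_max_of_le_right ?_
    have hzG : Good f U z := by
      by_contra hc; exact hzE ⟨hzU, hc⟩
    have E0ne : E0.Nonempty := ⟨e0, e0.2⟩
    obtain ⟨ρ, hρ, K, hs, hb⟩ := hzG
    set d := infDist z E0 with hd
    have hd0 : 0 < d := by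
      refine lt_of_lt_of_le hρ ?_
      rw [hd, le_infDist E0ne]
      intro y hy
      by_contra hc
      refine hy.2 (good_nhds hs hb y ?_)
      rw [mem_ball, dist_comm]; exact not_le.1 hc
    have hdρ : d ≤ ‖z - e0‖ := by rw [← dist_eq_norm]; exact infDist_le_dist_of_mem e0.2
    obtain ⟨e, heE, hze⟩ := (infDist_lt_iff E0ne).1 (show infDist z E0 < 2 * d by linarith)
    rw [dist_eq_norm] at hze
    have hee : ‖e - e0‖ < 3 * ρ1 := by
      have : ‖e - e0‖ ≤ ‖e - z‖ + ‖z - e0‖ := norm_sub_le_norm_sub_add_norm_sub _ _ _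
      rw [norm_sub_rev] at hze
      linarith
    have hF := inF e heE (by rw [mem_ball, dist_eq_norm]; linarith)
    have hnear : ∀ w ∈ ball z d, w ∈ U ∧ Good f U w := by
      intro w hw
      rw [mem_ball] at hw
      have hwU : w ∈ U := inU w (by
        rw [← dist_eq_norm] at hzn hdρ ⊢
        linarith [dist_triangle w z e0])
      refine ⟨hwU, ?_⟩
      by_contra hc
      have := infDist_le_dist_of_mem (show w ∈ E0 from ⟨hwU, hc⟩) (x := z)
      rw [dist_comm] at hw
      linarith
    have hsub : ball z (d/2) ⊆ ball z d := ball_subset_ball (by linarith)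
    obtain ⟨K', hK'⟩ := good_compact (isCompact_closedBall z (d/2)) (f := f) (U := U) (by
      intro w hw; exact (hnear w (closedBall_subset_ball (by linarith) hw)).2)
    have hze2 : ‖f z - f e‖ ≤ κ * (2 * d) := by
      have := hF z hzU (by linarith)
      refine this.trans ?_
      gcongr
    have fin := key (5 * κ * d) K' (d/2) z j f (by positivity) (by positivity)
      (by refine le_trans ?_ h1d; gcongr; linarith)
      (H.mono fun w hw => (hnear w (hsub hw)).1)
      (fun w hw => hK' w (ball_subset_closedBall hw)) (by
        intro w hw
        have hw' := hsub hw
        rw [mem_ball, dist_eq_norm] at hw'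
        have hwe : ‖w - e‖ ≤ 3 * d := by
          have : ‖w - e‖ ≤ ‖w - z‖ + ‖z - e‖ := norm_sub_le_norm_sub_add_norm_sub _ _ _
          linarith
        have h5 : ‖f w - f e‖ ≤ κ * (3 * d) := by
          have := hF w (hnear w (hsub hw)).1 (by linarith)
          refine this.trans ?_
          gcongr
        have e1 : f w - f z = (f w - f e) - (f z - f e) := by abel
        rw [e1]
        refine (norm_sub_le _ _).trans ?_
        linarith)
    refine fin.trans (le_of_eq ?_)
    field_simp

lemma jh_reg {f : ℂ → E} {j : ℂ → (E →L[ℝ] E)} {r r' Λ : ℝ} (hr : r' < r)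
    (H : Jh f j (ball 0 r) Λ) : ∃ K > 0, (∀ z ∈ ball (0:ℂ) r', ‖fderiv ℝ f z‖ ≤ K) ∧
      ∀ z ∈ ball (0:ℂ) r', ∀ w ∈ ball (0:ℂ) r', ‖fderiv ℝ f z - fderiv ℝ f w‖ ≤
        K * ‖z - w‖^(1/2:ℝ) := by
  set r1 := (r + r')/2 with hr1
  obtain ⟨K, hK⟩ := good_compact (isCompact_closedBall (0:ℂ) r1) (f := f) (U := ball 0 r)
    (fun z hz => jh_good isOpen_ball H z (closedBall_subset_ball (by linarith) hz))
  obtain ⟨C, hC, key⟩ := jh_local (E := E)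
  set K1 := max K 0 with hK1
  have hK10 : 0 ≤ K1 := le_max_right _ _
  have nn := H.nn
  set σ := (r - r')/2 with hσ
  have hσ0 : 0 < σ := by linarith
  have sub : ∀ w ∈ ball (0:ℂ) r', ball w σ ⊆ ball 0 r1 := by
    intro w hw
    refine ball_subset_ball' ?_
    rw [mem_ball] at hw; linarith
  have bK : ∀ z ∈ ball (0:ℂ) r1, ‖fderiv ℝ f z‖ ≤ K1 := fun z hz =>
    (hK z (ball_subset_closedBall hz)).trans (le_max_left _ _)
  have sub2 : ball (0:ℂ) r1 ⊆ ball 0 r := ball_subset_ball (by linarith)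
  have sub3 : ball (0:ℂ) r' ⊆ ball 0 r1 := ball_subset_ball (by linarith)
  set CT0 := C * (1 + Λ) * (K1 * σ + Λ * K1^2 * σ^2) * (1 / σ)^(3/2:ℝ) with hCT0
  have hCT00 : 0 ≤ CT0 := by positivity
  have tay : ∀ z0 ∈ ball (0:ℂ) r', ∀ z, ‖z - z0‖ < σ/2 →
      ‖f z - f z0 - fderiv ℝ f z0 (z - z0)‖ ≤ CT0 * ‖z - z0‖^(3/2:ℝ) := by
    intro w hw z hz
    have := (key Λ (K1 * σ) K1 σ w j f hσ0 (by positivity) hK10 (H.mono ((sub w hw).trans sub2))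
      (fun x hx => bK x (sub w hw hx)) (by
        intro x hx
        have := (convex_ball w σ).norm_image_sub_le_of_norm_fderiv_le (𝕜 := ℝ) (f := f)
          (fun y hy => H.diff y (sub2 (sub w hw hy))) (fun y hy => bK y (sub w hw hy))
          (mem_ball_self hσ0) hx
        rw [mem_ball, dist_eq_norm] at hx
        refine this.trans ?_
        gcongr)).2 z (by rwa [mem_ball, dist_eq_norm])
    refine this.trans (le_of_eq ?_)
    rw [hCT0, div_eq_mul_one_div, Real.mul_rpow (norm_nonneg _) (by positivity)]; ring
  set K2 := (5 * CT0 + 2 * K1 * (2 / (σ/2))^(1/2:ℝ)) with hK2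
  have hK20 : 0 ≤ K2 := by positivity
  refine ⟨K1 + K2 + 1, by positivity, fun z hz => (bK z (sub3 hz)).trans (by linarith), ?_⟩
  intro z hz w hw
  have := conv_taylor' (S := ball (0:ℂ) r') hCT00 (half_pos hσ0) (fun z hz => bK z (sub3 hz)) tay hz hw
  rw [norm_sub_rev w z] at this
  refine this.trans ?_
  refine mul_le_mul_of_nonneg_right ?_ (by positivity)
  linarith

end JHP
end

section
namespace JHP
open MeasureTheory

lemma hasFDeriv_of_taylor {G : Type*} [NormedAddCommGroup G] [NormedSpace ℝ G]
    {u : ℂ → G} {L : ℂ →L[ℝ] G} {z0 : ℂ} {σ C : ℝ} (hσ : 0 < σ)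
    (h : ∀ z, ‖z - z0‖ < σ → ‖u z - u z0 - L (z - z0)‖ ≤ C * ‖z - z0‖^(3/2:ℝ)) :
    HasFDerivAt u L z0 := by
  rw [hasFDerivAt_iff_isLittleO_nhds_zero]
  have hO : (fun z : ℂ => u (z0 + z) - u z0 - L z) =O[𝓝 0] fun z => ‖z‖^(3/2:ℝ) := by
    refine Asymptotics.IsBigO.of_bound C ?_
    filter_upwards [ball_mem_nhds (0:ℂ) hσ] with z hz
    have := h (z0 + z) (by simpa using hz)
    rw [Real.norm_of_nonneg (by positivity)]
    simpa using this
  refine hO.trans_isLittleO ?_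
  refine Asymptotics.isLittleO_norm_right.1 ?_
  have h2 : (fun z : ℂ => ‖z‖^(3/2:ℝ)) = fun z => ‖z‖^(1/2:ℝ) * ‖z‖ := by
    funext z; exact rpow_split _ (norm_nonneg _)
  rw [h2]
  have h3 : Tendsto (fun z : ℂ => ‖z‖^(1/2:ℝ)) (𝓝 0) (𝓝 0) := by
    have : ContinuousAt (fun z : ℂ => ‖z‖^(1/2:ℝ)) 0 :=
      continuousAt_id.norm.rpow_const (Or.inr (by norm_num))
    simpa [ContinuousAt] using this
  have h4 := ((Asymptotics.isLittleO_one_iff ℝ).2 h3).mul_isBigO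
    (Asymptotics.isBigO_refl (fun z : ℂ => ‖z‖) (𝓝 0))
  simpa using h4

set_option linter.unusedSectionVars false
variable {F : Type*} [NormedAddCommGroup F] [NormedSpace ℂ F]

/-- Hölder functions supported in a ball and vanishing at zero -/
structure Hol (g : ℂ → F) (M B : ℝ) : Prop where
  zero : g 0 = 0
  nn : 0 ≤ B
  hol : ∀ x y, ‖g x - g y‖ ≤ B * ‖x - y‖ ^ (1/2 : ℝ)
  supp : ∀ ζ, M ≤ ‖ζ‖ → g ζ = 0

lemma cont_of_hol {G : Type*} [NormedAddCommGroup G] {g : ℂ → G} {B : ℝ}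
    (h : ∀ x y, ‖g x - g y‖ ≤ B * ‖x - y‖ ^ (1/2 : ℝ)) : Continuous g := by
  rw [continuous_iff_continuousAt]
  intro x
  rw [ContinuousAt, tendsto_iff_norm_sub_tendsto_zero]
  have h3 : Tendsto (fun z : ℂ => B * ‖z - x‖^(1/2:ℝ)) (𝓝 x) (𝓝 0) := by
    have : ContinuousAt (fun z : ℂ => B * ‖z - x‖^(1/2:ℝ)) x :=
      continuousAt_const.mul
        ((continuousAt_id.sub continuousAt_const).norm.rpow_const (Or.inr (by norm_num)))
    simpa [ContinuousAt] using this
  exact squeeze_zero (fun _ => norm_nonneg _) (fun z => h z x) h3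

lemma Hol.cont {g : ℂ → F} {M B : ℝ} (h : Hol g M B) : Continuous g := cont_of_hol h.hol

lemma Hol.adm {g : ℂ → F} {M B : ℝ} (h : Hol g M B) : Adm g M B :=
  ⟨h.cont.aestronglyMeasurable, h.nn, fun ζ => by simpa [h.zero] using h.hol ζ 0, h.supp⟩

lemma int_CT {g : ℂ → F} {M B : ℝ} (hm : AEStronglyMeasurable g volume) (hb : ∀ ζ, ‖g ζ‖ ≤ B)
    (hs : ∀ ζ, M ≤ ‖ζ‖ → g ζ = 0) (z : ℂ) : Integrable (fun ζ => (z - ζ)⁻¹ • g ζ) := by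
  have hB : 0 ≤ B := (norm_nonneg _).trans (hb 0)
  have h1 : Integrable (fun ζ : ℂ => ζ⁻¹ • g (z - ζ)) := by
    rw [← integrableOn_iff_integrable_of_support_subset (s := ball 0 (M + ‖z‖))]
    · refine ((norm_rpow_intOn (a := 1) (by norm_num) (M + ‖z‖)).const_mul B).mono' ?_ ?_
      · refine AEStronglyMeasurable.restrict (AEStronglyMeasurable.smul ?_ ?_)
        · apply Measurable.aestronglyMeasurable; fun_prop
        · exact hm.comp_measurePreserving (Measure.measurePreserving_sub_left volume z)
      · refine Eventually.of_forall fun ζ => ?_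
        rw [norm_smul, norm_inv, mul_comm, Real.rpow_neg (norm_nonneg _), Real.rpow_one]
        have := hb (z - ζ)
        gcongr
    · intro ζ hζ
      rw [mem_ball_zero_iff]
      by_contra hc
      refine hζ ?_
      simp only
      rw [hs, smul_zero]
      have := norm_sub_norm_le ζ z
      rw [norm_sub_rev] at this
      linarith [not_lt.1 hc]
  have h2 := h1.comp_sub_left z
  refine h2.congr (Eventually.of_forall fun ζ => ?_)
  simp

lemma CT_sub {g h : ℂ → F} {z : ℂ} (i1 : Integrable (fun ζ => (z - ζ)⁻¹ • g ζ))
    (i2 : Integrable (fun ζ => (z - ζ)⁻¹ • h ζ)) :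
    CT (fun ζ => g ζ - h ζ) z = CT g z - CT h z := by
  unfold CT
  simp only [smul_sub]
  rw [integral_sub i1 i2, smul_sub]

lemma hol_of_lip {G : Type*} [NormedAddCommGroup G] {g : ℂ → G} {C D : ℝ} (hC : 0 ≤ C) (hD : 0 ≤ D)
    {x y : ℂ} (h1 : ‖g x - g y‖ ≤ C * ‖x - y‖) (h2 : ‖g x - g y‖ ≤ D) :
    ‖g x - g y‖ ≤ (C + D) * ‖x - y‖^(1/2:ℝ) := by
  have hn : 0 ≤ ‖x - y‖^(1/2:ℝ) := by positivity
  rcases le_or_gt ‖x - y‖ 1 with h | h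
  · have hle : ‖x - y‖ ≤ ‖x - y‖^(1/2:ℝ) := by
      simpa using Real.rpow_le_rpow_of_exponent_ge' (norm_nonneg _) h
        (by norm_num) (show (1/2:ℝ) ≤ 1 by norm_num)
    calc _ ≤ _ := h1
      _ ≤ C * ‖x - y‖^(1/2:ℝ) := by gcongr
      _ ≤ _ := by gcongr; linarith
  · have : 1 ≤ ‖x - y‖^(1/2:ℝ) := Real.one_le_rpow h.le (by norm_num)
    calc _ ≤ D * 1 := by linarith
      _ ≤ D * ‖x - y‖^(1/2:ℝ) := by gcongr
      _ ≤ _ := by gcongr; linarith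

lemma phi0 (M : ℝ) (hM : 0 < M) : ∃ (φ : ℂ → ℂ) (K : ℝ), 0 ≤ K ∧
    (∀ z, ‖z‖ ≤ M + 1 → φ z = (starRingEnd ℂ) z) ∧ (∀ z, CT (dbar φ) z = φ z) ∧
    (∀ z, ‖z‖ < M + 1 → dbar φ z = 1) ∧ (∀ z, M + 3 ≤ ‖z‖ → dbar φ z = 0) ∧
    (∀ x y, ‖dbar φ x - dbar φ y‖ ≤ K * ‖x - y‖^(1/2:ℝ)) ∧ (∀ z, ‖dbar φ z‖ ≤ K) := by
  obtain ⟨χ, -, χs, χ1, χ0, -, -, -⟩ := cutoff (M+1) (M+2) (by linarith) (by linarith)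
  set φ : ℂ → ℂ := fun z => χ z • (starRingEnd ℂ) z with hφ
  have φs : ContDiff ℝ (⊤:ℕ∞) φ := χs.smul Complex.conjCLE.contDiff
  have φ0 : ∀ z, M + 2 ≤ ‖z‖ → φ z = 0 := fun z hz => by simp [hφ, χ0 z hz]
  have φcs : HasCompactSupport φ := by
    refine HasCompactSupport.intro (isCompact_closedBall (0:ℂ) (M+2)) fun z hz => φ0 z ?_
    rw [mem_closedBall_zero_iff, not_le] at hz; exact hz.le
  have d1 : ContDiff ℝ (⊤:ℕ∞) (fderiv ℝ φ) := φs.fderiv_right (by simp)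
  have ds : ContDiff ℝ (⊤:ℕ∞) (dbar φ) := by
    unfold dbar
    exact contDiff_const.mul ((d1.clm_apply contDiff_const).add
      (contDiff_const.mul (d1.clm_apply contDiff_const)))
  have fcs := φcs.fderiv ℝ
  have d0 : ∀ z, M + 3 ≤ ‖z‖ → dbar φ z = 0 := by
    intro z hz
    have : φ =ᶠ[𝓝 z] fun _ => 0 := by
      filter_upwards [(isOpen_lt continuous_const continuous_norm).mem_nhds
        (show M + 2 < ‖z‖ by linarith)] with w hw
      exact φ0 w (le_of_lt hw)
    simp [dbar, this.fderiv_eq]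
  have dcs : HasCompactSupport (dbar φ) := by
    refine HasCompactSupport.intro (isCompact_closedBall (0:ℂ) (M+3)) fun z hz => d0 z ?_
    rw [mem_closedBall_zero_iff, not_le] at hz; exact hz.le
  obtain ⟨L, hL⟩ := ds.lipschitzWith_of_hasCompactSupport dcs (by simp)
  obtain ⟨D, hD⟩ := dcs.exists_bound_of_continuous ds.continuous
  obtain ⟨K1, hK1⟩ := fcs.exists_bound_of_continuous d1.continuous
  have hD0 : 0 ≤ D := (norm_nonneg _).trans (hD 0)
  refine ⟨φ, L + 2 * D, by positivity, fun z hz => by simp [hφ, χ1 z hz],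
    pompeiu φ (φs.differentiable (by simp)) K1 hK1 (M+2) φ0, ?_, d0, ?_, ?_⟩
  · intro z hz
    have : φ =ᶠ[𝓝 z] Complex.conjCLE := by
      filter_upwards [(isOpen_lt continuous_norm continuous_const).mem_nhds hz] with w hw
      simp [hφ, χ1 w (le_of_lt hw)]
    simp only [dbar, this.fderiv_eq, ContinuousLinearEquiv.fderiv]
    simp; norm_num
  · intro x y
    refine hol_of_lip (by positivity) (by positivity) ?_ ?_
    · simpa [dist_eq_norm] using hL.dist_le_mul x y
    · exact (norm_sub_le _ _).trans (by linarith [hD x, hD y])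
  · intro z
    have := hD z
    have : (0:ℝ) ≤ L := L.2
    linarith

lemma ct_expand [CompleteSpace F] (M : ℝ) (hM : 0 < M) : ∃ C > 0, ∀ (g : ℂ → F) (B : ℝ),
    Hol g M B → ∀ z0, ‖z0‖ ≤ M → ∃ c : F, ‖c‖ ≤ C * B ∧ ∀ h : ℂ, ‖h‖ < 1 →
    ‖CT g (z0 + h) - CT g z0 - h • c - (starRingEnd ℂ h) • g z0‖ ≤ C * B * ‖h‖^(3/2:ℝ) := by
  obtain ⟨φ, K, hK, φ1, φCT, d1, d0, dh, db⟩ := phi0 M hM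
  obtain ⟨C, hC, hexp⟩ := Adm.expand0 (F := F) (M := 2 * M + 3)
  refine ⟨C * (1 + M^(1/2:ℝ) * K), by positivity, ?_⟩
  intro g B H z0 hz0
  have nn := H.nn
  have gz0 : ‖g z0‖ ≤ B * M^(1/2:ℝ) := (H.adm.bd z0).trans (by gcongr)
  have dcont : Continuous (dbar φ) := cont_of_hol dh
  set q : ℂ → F := fun ζ => g ζ - dbar φ ζ • g z0 with hq
  have adm : Adm (fun ζ => q (z0 + ζ)) (2 * M + 3) ((1 + M^(1/2:ℝ) * K) * B) := by
    refine ⟨?_, by positivity, ?_, ?_⟩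
    · apply Continuous.aestronglyMeasurable
      have := H.cont
      simp only [hq]; fun_prop
    · intro ζ
      have e : q (z0 + ζ) = (g (z0 + ζ) - g z0) - (dbar φ (z0 + ζ) - dbar φ z0) • g z0 := by
        rw [d1 z0 (by linarith)]; simp only [hq, sub_smul, one_smul]; abel
      rw [e]
      have h1 : ‖g (z0 + ζ) - g z0‖ ≤ B * ‖ζ‖^(1/2:ℝ) := by simpa using H.hol (z0 + ζ) z0
      have h2 : ‖dbar φ (z0 + ζ) - dbar φ z0‖ ≤ K * ‖ζ‖^(1/2:ℝ) := by simpa using dh (z0 + ζ) z0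
      refine (norm_sub_le _ _).trans ?_
      rw [norm_smul]
      calc _ ≤ B * ‖ζ‖^(1/2:ℝ) + (K * ‖ζ‖^(1/2:ℝ)) * (B * M^(1/2:ℝ)) := by gcongr
        _ = _ := by ring
    · intro ζ hζ
      have : M + 3 ≤ ‖z0 + ζ‖ := by
        have := norm_sub_norm_le ζ (-z0)
        rw [sub_neg_eq_add, norm_neg, add_comm ζ] at this
        linarith
      simp only [hq]
      rw [H.supp _ (by linarith), d0 _ this]; simp
  obtain ⟨hc, hz⟩ := hexp _ _ adm
  set c := c0 (fun ζ => q (z0 + ζ)) with hcdef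
  refine ⟨c, hc.trans (le_of_eq (by ring)), ?_⟩
  have ig := int_CT H.adm.meas (B := B * M^(1/2:ℝ)) (fun ζ => by
    rcases lt_or_ge ‖ζ‖ M with h | h
    · exact (H.adm.bd ζ).trans (by gcongr)
    · rw [H.supp ζ h]; simp; positivity) H.supp
  have idb := int_CT dcont.aestronglyMeasurable db d0
  have ct : ∀ z, CT q z = CT g z - φ z • g z0 := by
    intro z
    have ih : Integrable (fun ζ => (z - ζ)⁻¹ • (dbar φ ζ • g z0)) := by
      have := (idb z).smul_const (g z0)
      simpa only [smul_assoc] using this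
    rw [hq, CT_sub (ig z) ih]
    congr 1
    rw [← φCT z]
    unfold CT
    simp only [← smul_assoc]
    rw [integral_smul_const]
    rw [smul_assoc]
  intro h hh
  have := hz h
  rw [CT_translate, CT_translate, ct, ct, add_zero, φ1 (z0 + h) ((norm_add_le _ _).trans (by linarith)),
    φ1 z0 (by linarith), map_add] at this
  have e : CT g (z0 + h) - CT g z0 - h • c - (starRingEnd ℂ h) • g z0 =
      CT g (z0 + h) - ((starRingEnd ℂ) z0 + (starRingEnd ℂ) h) • g z0 -
      (CT g z0 - (starRingEnd ℂ) z0 • g z0) - h • c := by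
    rw [add_smul]; abel
  rw [e]
  exact this.trans (le_of_eq (by ring))

end JHP
end

section
namespace JHP
open MeasureTheory

/-- `(e^w - 1)/w` -/
def expE : ℂ → ℂ := dslope Complex.exp 0

lemma expE_diff : Differentiable ℂ expE := by
  rw [← differentiableOn_univ]
  exact (Complex.differentiableOn_dslope univ_mem).2 Complex.differentiable_exp.differentiableOn

lemma expE_mul (w : ℂ) : w * expE w = Complex.exp w - 1 := by
  have := sub_smul_dslope Complex.exp 0 w
  simpa [expE] using this

def nk (t : ℝ) (z ζ : ℂ) : ℂ :=
  z^2 * (2 * t * (starRingEnd ℂ ζ) * expE (2 * t * (starRingEnd ℂ ζ) * (z - ζ)))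

def nk' (t : ℝ) (z ζ : ℂ) : ℂ :=
  2 * z * (2 * t * (starRingEnd ℂ ζ) * expE (2 * t * (starRingEnd ℂ ζ) * (z - ζ))) +
  z^2 * (2 * t * (starRingEnd ℂ ζ) * (deriv expE (2 * t * (starRingEnd ℂ ζ) * (z - ζ)) *
    (2 * t * (starRingEnd ℂ ζ))))

lemma nk_mul (t : ℝ) (z ζ : ℂ) : (z - ζ) * nk t z ζ =
    z^2 * (Complex.exp (2 * t * (starRingEnd ℂ ζ) * (z - ζ)) - 1) := by
  rw [← expE_mul, nk]; ring

lemma nk_deriv (t : ℝ) (z ζ : ℂ) : HasDerivAt (fun z => nk t z ζ) (nk' t z ζ) z := by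
  unfold nk nk'
  have h1 : HasDerivAt (fun z : ℂ => 2 * t * (starRingEnd ℂ ζ) * (z - ζ))
      (2 * t * (starRingEnd ℂ ζ)) z := by
    simpa using ((hasDerivAt_id z).sub_const ζ).const_mul (2 * t * (starRingEnd ℂ ζ))
  have h2 := (expE_diff (2 * t * (starRingEnd ℂ ζ) * (z - ζ))).hasDerivAt.comp z h1
  have h3 := (hasDerivAt_pow 2 z).mul (h2.const_mul (2 * t * (starRingEnd ℂ ζ)))
  refine HasDerivAt.congr_deriv (f := fun z => z^2 * (2 * t * (starRingEnd ℂ ζ) *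
    expE (2 * t * (starRingEnd ℂ ζ) * (z - ζ)))) h3 ?_
  simp

lemma nk_smooth (t : ℝ) : ContDiff ℝ 1 (fun p : ℂ × ℂ => nk t p.1 p.2) := by
  have hE : ContDiff ℝ 1 expE := (expE_diff.contDiff (n := 1)).restrict_scalars ℝ
  have hc : ContDiff ℝ 1 (fun p : ℂ × ℂ => (starRingEnd ℂ) p.2) :=
    Complex.conjCLE.contDiff.comp contDiff_snd
  unfold nk
  fun_prop

lemma nk'_smooth (t : ℝ) : ContDiff ℝ 1 (fun p : ℂ × ℂ => nk' t p.1 p.2) := by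
  have hE : ContDiff ℝ 1 expE := (expE_diff.contDiff (n := 1)).restrict_scalars ℝ
  have hE' : ContDiff ℝ 1 (deriv expE) := (expE_diff.deriv.contDiff (n := 1)).restrict_scalars ℝ
  have hc : ContDiff ℝ 1 (fun p : ℂ × ℂ => (starRingEnd ℂ) p.2) :=
    Complex.conjCLE.contDiff.comp contDiff_snd
  unfold nk'
  fun_prop

lemma nk_bounds (t M : ℝ) : ∃ D > 0, (∀ z ζ, ‖z‖ ≤ M → ‖ζ‖ ≤ M → ‖nk t z ζ‖ ≤ D) ∧
    (∀ z ζ, ‖z‖ ≤ M → ‖ζ‖ ≤ M → ‖nk' t z ζ‖ ≤ D) ∧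
    (∀ z w ζ, ‖z‖ ≤ M → ‖w‖ ≤ M → ‖ζ‖ ≤ M →
      ‖nk t w ζ - nk t z ζ - (w - z) * nk' t z ζ‖ ≤ D * ‖w - z‖^2) := by
  have hk : IsCompact (closedBall (0:ℂ) M ×ˢ closedBall (0:ℂ) M) :=
    (isCompact_closedBall _ _).prod (isCompact_closedBall _ _)
  obtain ⟨D1, h1⟩ := hk.exists_bound_of_continuousOn (nk_smooth t).continuous.continuousOn
  obtain ⟨D2, h2⟩ := hk.exists_bound_of_continuousOn (nk'_smooth t).continuous.continuousOn
  obtain ⟨D3, h3⟩ := (nk'_smooth t).locallyLipschitz.locallyLipschitzOn.exists_lipschitzOnWith_of_compact hk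
  have m : ∀ z ζ : ℂ, ‖z‖ ≤ M → ‖ζ‖ ≤ M → (z, ζ) ∈ closedBall (0:ℂ) M ×ˢ closedBall (0:ℂ) M :=
    fun z ζ hz hζ => ⟨by simpa using hz, by simpa using hζ⟩
  have hD3 : (0:ℝ) ≤ D3 := D3.2
  refine ⟨|D1| + |D2| + D3 + 1, by positivity, fun z ζ hz hζ => ?_, fun z ζ hz hζ => ?_, ?_⟩
  · have := h1 _ (m z ζ hz hζ)
    simp only at this
    linarith [le_abs_self D1, abs_nonneg D2]
  · have := h2 _ (m z ζ hz hζ)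
    simp only at this
    linarith [le_abs_self D2, abs_nonneg D1]
  · intro z w ζ hz hw hζ
    have hsub : segment ℝ z w ⊆ closedBall (0:ℂ) M :=
      (convex_closedBall (0:ℂ) M).segment_subset (by simpa using hz) (by simpa using hw)
    have key := (convex_segment (𝕜 := ℝ) z w).norm_image_sub_le_of_norm_hasDerivWithin_le
      (f := fun x => nk t x ζ - x * nk' t z ζ) (f' := fun x => nk' t x ζ - nk' t z ζ)
      (C := D3 * ‖w - z‖)
      (fun x hx => ((nk_deriv t x ζ).sub (by
        simpa using (hasDerivAt_id x).mul_const (nk' t z ζ))).hasDerivWithinAt)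
      (fun x hx => by
        have hx' : ‖x‖ ≤ M := by simpa using hsub hx
        have := h3.dist_le_mul _ (m x ζ hx' hζ) _ (m z ζ hz hζ)
        rw [dist_eq_norm] at this
        refine this.trans ?_
        have : dist (x, ζ) (z, ζ) ≤ ‖w - z‖ := by
          rw [dist_prod_same_right, dist_eq_norm]
          exact norm_sub_le_of_mem_segment hx
        gcongr)
      (left_mem_segment ℝ z w) (right_mem_segment ℝ z w)
    have e : nk t w ζ - nk t z ζ - (w - z) * nk' t z ζ =
      nk t w ζ - w * nk' t z ζ - (nk t z ζ - z * nk' t z ζ) := by ring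
    rw [e]
    refine key.trans ?_
    have : D3 * ‖w - z‖ * ‖w - z‖ = D3 * ‖w-z‖^2 := by ring
    rw [this]
    gcongr
    linarith [abs_nonneg D1, abs_nonneg D2]

lemma exp_neg_le {y : ℝ} (hy : 0 < y) : Real.exp (-y) ≤ y^(-(1/8):ℝ) := by
  rw [Real.exp_neg, Real.rpow_neg hy.le]
  refine inv_anti₀ (by positivity) ?_
  have he := Real.add_one_le_exp y
  rcases le_or_gt y 1 with h | h
  · have : y^(1/8:ℝ) ≤ 1 := Real.rpow_le_one hy.le h (by norm_num)
    linarith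
  · have : y^(1/8:ℝ) ≤ y := by
      simpa using Real.rpow_le_rpow_of_exponent_le h.le (show (1/8:ℝ) ≤ 1 by norm_num)
    linarith

set_option linter.unusedSectionVars false
variable {F : Type*} [NormedAddCommGroup F] [NormedSpace ℂ F]

lemma Adm.sub {g h : ℂ → F} {M B B' : ℝ} (hg : Adm g M B) (hh : Adm h M B') :
    Adm (fun ζ => g ζ - h ζ) M (B + B') :=
  ⟨hg.meas.sub hh.meas, add_nonneg hg.nn hh.nn, fun ζ => by
    refine (norm_sub_le _ _).trans ?_
    linarith [hg.bd ζ, hh.bd ζ], fun ζ hζ => by rw [hg.supp ζ hζ, hh.supp ζ hζ, sub_zero]⟩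

lemma Adm.smul {g : ℂ → F} {M B D : ℝ} {n : ℂ → ℂ} (hg : Adm g M B) (hn : Continuous n)
    (hD : 0 ≤ D) (hb : ∀ ζ, ‖ζ‖ ≤ M → ‖n ζ‖ ≤ D) : Adm (fun ζ => n ζ • g ζ) M (D * B) :=
  ⟨hn.aestronglyMeasurable.smul hg.meas, mul_nonneg hD hg.nn, fun ζ => by
    rcases le_or_gt ‖ζ‖ M with h | h
    · rw [norm_smul, mul_assoc]
      exact mul_le_mul (hb ζ h) (hg.bd ζ) (norm_nonneg _) hD
    · rw [hg.supp ζ h.le]; simp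
      have := hg.nn
      positivity, fun ζ hζ => by rw [hg.supp ζ hζ, smul_zero]⟩

lemma Adm.c0_sub {g h : ℂ → F} {M B B' : ℝ} (hg : Adm g M B) (hh : Adm h M B') :
    c0 (fun ζ => g ζ - h ζ) = c0 g - c0 h := by
  unfold c0
  simp only [smul_sub]
  rw [integral_sub (hg.int_pow 2 le_rfl) (hh.int_pow 2 le_rfl), smul_sub]; abel

lemma c0_smul (g : ℂ → F) (a : ℂ) : c0 (fun ζ => a • g ζ) = a • c0 g := by
  unfold c0
  have : (fun ζ : ℂ => (ζ^2)⁻¹ • a • g ζ) = fun ζ => a • ((ζ^2)⁻¹ • g ζ) := by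
    funext ζ; rw [smul_comm]
  rw [this, integral_smul, smul_neg, smul_comm]

/-- weighted solution operator -/
def TT (t : ℝ) (g : ℂ → F) (z : ℂ) : F :=
  CT g z - CT g 0 - z • c0 g - c0 (fun ζ => nk t z ζ • g ζ)

lemma nk_cont (t : ℝ) (z : ℂ) : Continuous (nk t z) :=
  (nk_smooth t).continuous.comp (continuous_const.prodMk continuous_id)

lemma nk'_cont (t : ℝ) (z : ℂ) : Continuous (nk' t z) :=
  (nk'_smooth t).continuous.comp (continuous_const.prodMk continuous_id)

lemma TT_zero (t : ℝ) (g : ℂ → F) : TT t g 0 = 0 := by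
  simp [TT, nk, c0]

lemma TT_eq {g : ℂ → F} {M B t : ℝ} (h : Adm g M B) {z : ℂ} (hz : z ≠ 0) :
    TT t g z = (Real.pi : ℂ)⁻¹ • ∫ ζ, (z^2 * ((ζ ^ 2)⁻¹ * (z - ζ)⁻¹) *
      Complex.exp (2 * t * (starRingEnd ℂ ζ) * (z - ζ))) • g ζ := by
  obtain ⟨D, hD, hb, -, -⟩ := nk_bounds t (max ‖z‖ M)
  have a2 : Adm (fun ζ => nk t z ζ • g ζ) M (D * B) := h.smul (nk_cont t z) hD.le
    (fun ζ hζ => hb z ζ (le_max_left _ _) (hζ.trans (le_max_right _ _)))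
  have i1 : Integrable (fun ζ => z^2 • (((ζ^2)⁻¹*(z-ζ)⁻¹) • g ζ)) := (h.int_two hz).smul (z^2)
  rw [TT, h.ct_eq, c0, sub_neg_eq_add, ← smul_add, ← integral_smul, ← integral_add
    i1 (a2.int_pow 2 le_rfl)]
  congr 1
  refine integral_congr_ae ?_
  filter_upwards [ae_ne z] with ζ hζ
  have hne : z - ζ ≠ 0 := sub_ne_zero.2 (Ne.symm hζ)
  simp only [smul_smul]
  rw [← add_smul]
  congr 1
  have : nk t z ζ = (z - ζ)⁻¹ * (z^2 * (Complex.exp (2 * t * (starRingEnd ℂ ζ) * (z - ζ)) - 1)) := by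
    rw [← nk_mul]; field_simp
  rw [this]; ring

lemma exp_weight (t : ℝ) (z ζ : ℂ) :
    ‖Complex.exp (2 * t * (starRingEnd ℂ ζ) * (z - ζ))‖ * Real.exp (t * ‖ζ‖^2) =
      Real.exp (t * ‖z‖^2) * Real.exp (-(t * ‖z - ζ‖^2)) := by
  rw [Complex.norm_exp, ← Real.exp_add, ← Real.exp_add]
  congr 1
  simp only [← Complex.normSq_eq_norm_sq, Complex.normSq_apply]
  simp
  ring

lemma TT_bound (M : ℝ) (hM : 0 < M) : ∃ C > 0, ∀ (t : ℝ) (g : ℂ → F) (B B' : ℝ), 0 < t →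
    Adm g M B' → 0 ≤ B → (∀ ζ, ‖g ζ‖ ≤ B * ‖ζ‖^(1/2:ℝ) * Real.exp (t * ‖ζ‖^2)) →
    ∀ z, ‖z‖ ≤ M → ‖TT t g z‖ ≤ C * t^(-(1/8):ℝ) * B * ‖z‖^(1/2:ℝ) * Real.exp (t * ‖z‖^2) := by
  obtain ⟨C, hC, hk⟩ := ker_int (a := 3/2) (b := 5/4) (by norm_num) (by norm_num) (by norm_num)
    (by norm_num) (by norm_num)
  refine ⟨Real.pi⁻¹ * C * M^(3/4:ℝ), by positivity, ?_⟩
  intro t g B B' ht h hB hg z hzM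
  rcases eq_or_ne z 0 with rfl | hz
  · rw [TT_zero]; simp
  obtain ⟨ki, kb⟩ := hk z hz
  have hzp : 0 < ‖z‖ := norm_pos_iff.2 hz
  rw [TT_eq h hz, norm_smul]
  set A := ‖z‖^2 * B * t^(-(1/8):ℝ) * Real.exp (t * ‖z‖^2) with hA
  have hA0 : 0 ≤ A := by positivity
  have I1 : ‖∫ ζ, (z^2 * ((ζ ^ 2)⁻¹ * (z - ζ)⁻¹) *
      Complex.exp (2 * t * (starRingEnd ℂ ζ) * (z - ζ))) • g ζ‖ ≤
      ∫ ζ, A * (‖ζ‖^(-(3/2):ℝ) * ‖z-ζ‖^(-(5/4):ℝ)) := by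
    refine norm_integral_le_of_norm_le (ki.const_mul A) ?_
    filter_upwards [ae_ne z, ae_ne 0] with ζ hζ hζ0
    have p1 : 0 < ‖z - ζ‖ := norm_pos_iff.2 (sub_ne_zero.2 (Ne.symm hζ))
    have p2 : 0 < ‖ζ‖ := norm_pos_iff.2 hζ0
    rw [norm_smul, norm_mul, norm_mul, norm_mul, norm_inv, norm_inv, norm_pow, norm_pow]
    have e1 : Real.exp (-(t * ‖z - ζ‖^2)) ≤ t^(-(1/8):ℝ) * ‖z - ζ‖^(-(1/4):ℝ) := by
      refine (exp_neg_le (by positivity)).trans (le_of_eq ?_)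
      rw [Real.mul_rpow ht.le (by positivity), ← Real.rpow_natCast, ← Real.rpow_mul p1.le]
      norm_num
    have e2 : (‖ζ‖^2)⁻¹ * ‖ζ‖^(1/2:ℝ) = ‖ζ‖^(-(3/2):ℝ) := by
      have := rpow_half_eq p2.le p2.ne' 2
      rw [this]; norm_num
    have e3 : ‖z - ζ‖⁻¹ * ‖z - ζ‖^(-(1/4):ℝ) = ‖z - ζ‖^(-(5/4):ℝ) := by
      rw [← Real.rpow_neg_one, ← Real.rpow_add p1]; norm_num
    calc ‖z‖^2 * ((‖ζ‖^2)⁻¹ * ‖z - ζ‖⁻¹) * ‖Complex.exp (2 * t * (starRingEnd ℂ ζ) * (z - ζ))‖ * ‖g ζ‖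
        ≤ ‖z‖^2 * ((‖ζ‖^2)⁻¹ * ‖z - ζ‖⁻¹) * ‖Complex.exp (2 * t * (starRingEnd ℂ ζ) * (z - ζ))‖ *
          (B * ‖ζ‖^(1/2:ℝ) * Real.exp (t * ‖ζ‖^2)) := by gcongr; exact hg ζ
      _ = ‖z‖^2 * B * ((‖ζ‖^2)⁻¹ * ‖ζ‖^(1/2:ℝ)) * ‖z - ζ‖⁻¹ *
          (‖Complex.exp (2 * t * (starRingEnd ℂ ζ) * (z - ζ))‖ * Real.exp (t * ‖ζ‖^2)) := by ring
      _ = ‖z‖^2 * B * ‖ζ‖^(-(3/2):ℝ) * ‖z - ζ‖⁻¹ *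
          (Real.exp (t * ‖z‖^2) * Real.exp (-(t * ‖z - ζ‖^2))) := by rw [exp_weight, e2]
      _ ≤ ‖z‖^2 * B * ‖ζ‖^(-(3/2):ℝ) * ‖z - ζ‖⁻¹ *
          (Real.exp (t * ‖z‖^2) * (t^(-(1/8):ℝ) * ‖z - ζ‖^(-(1/4):ℝ))) := by gcongr
      _ = A * (‖ζ‖^(-(3/2):ℝ) * (‖z - ζ‖⁻¹ * ‖z - ζ‖^(-(1/4):ℝ))) := by rw [hA]; ring
      _ = _ := by rw [e3]
  rw [integral_const_mul] at I1
  have I2 : A * ∫ ζ, (‖ζ‖^(-(3/2):ℝ) * ‖z-ζ‖^(-(5/4):ℝ)) ≤ A * (C * ‖z‖^(2 - 3/2 - 5/4:ℝ)) := by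
    gcongr
  have hpi : ‖(Real.pi:ℂ)⁻¹‖ = Real.pi⁻¹ := by
    rw [norm_inv, Complex.norm_real, Real.norm_of_nonneg Real.pi_pos.le]
  rw [hpi]
  have e4 : ‖z‖^2 * ‖z‖^(2 - 3/2 - 5/4:ℝ) = ‖z‖^(3/4:ℝ) * ‖z‖^(1/2:ℝ) := by
    rw [← Real.rpow_natCast, ← Real.rpow_add hzp, ← Real.rpow_add hzp]; norm_num
  have e5 : ‖z‖^(3/4:ℝ) ≤ M^(3/4:ℝ) := by gcongr
  calc _ ≤ Real.pi⁻¹ * (A * (C * ‖z‖^(2 - 3/2 - 5/4:ℝ))) := by gcongr; exact I1.trans I2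
    _ = Real.pi⁻¹ * C * (‖z‖^2 * ‖z‖^(2 - 3/2 - 5/4:ℝ)) * (t^(-(1/8):ℝ) * B * Real.exp (t * ‖z‖^2)) := by
      rw [hA]; ring
    _ = Real.pi⁻¹ * C * ‖z‖^(3/4:ℝ) * ‖z‖^(1/2:ℝ) * (t^(-(1/8):ℝ) * B * Real.exp (t * ‖z‖^2)) := by
      rw [e4]; ring
    _ ≤ Real.pi⁻¹ * C * M^(3/4:ℝ) * ‖z‖^(1/2:ℝ) * (t^(-(1/8):ℝ) * B * Real.exp (t * ‖z‖^2)) := by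
      gcongr
    _ = _ := by ring

end JHP
end

section
namespace JHP
open MeasureTheory

set_option linter.unusedSectionVars false
variable {F : Type*} [NormedAddCommGroup F] [NormedSpace ℂ F]

lemma sq_le_rpow {x : ℝ} (h0 : 0 ≤ x) (h1 : x ≤ 1) : x^2 ≤ x^(3/2:ℝ) := by
  rw [← Real.rpow_natCast]
  exact Real.rpow_le_rpow_of_exponent_ge' h0 h1 (by norm_num) (by norm_num)

lemma TT_taylor [CompleteSpace F] (t M : ℝ) (hM : 0 < M) : ∃ C > 0, ∀ (g : ℂ → F) (B : ℝ),
    Hol g M B → ∀ z0, ‖z0‖ ≤ M → ∃ c : F, ‖c‖ ≤ C * B ∧ ∀ h : ℂ, ‖h‖ < 1 →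
    ‖TT t g (z0 + h) - TT t g z0 - h • c - (starRingEnd ℂ h) • g z0‖ ≤ C * B * ‖h‖^(3/2:ℝ) := by
  obtain ⟨C, hC, hexp⟩ := ct_expand (F := F) M hM
  obtain ⟨C1, hC1, H1⟩ := Adm.c0_le (F := F) (M := M)
  obtain ⟨D, hD, b1, b2, b3⟩ := nk_bounds t (M+1)
  refine ⟨C + C1 + C1 * D, by positivity, ?_⟩
  intro g B H z0 hz0
  have nn := H.nn
  obtain ⟨c, hc, hT⟩ := hexp g B H z0 hz0
  have A' : Adm (fun ζ => nk' t z0 ζ • g ζ) M (D * B) := H.adm.smul (nk'_cont t z0) hD.le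
    (fun ζ hζ => b2 z0 ζ (by linarith) (by linarith))
  refine ⟨c - c0 g - c0 (fun ζ => nk' t z0 ζ • g ζ), ?_, fun h hh => ?_⟩
  · have e1 := H1 _ _ H.adm
    have e2 := H1 _ _ A'
    calc _ ≤ ‖c‖ + ‖c0 g‖ + ‖c0 (fun ζ => nk' t z0 ζ • g ζ)‖ :=
          (norm_sub_le _ _).trans (by gcongr; exact norm_sub_le _ _)
      _ ≤ C * B + C1 * B + C1 * (D * B) := by gcongr
      _ = _ := by ring
  · have hzh : ‖z0 + h‖ ≤ M + 1 := (norm_add_le _ _).trans (by linarith)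
    have A0 : Adm (fun ζ => nk t z0 ζ • g ζ) M (D * B) := H.adm.smul (nk_cont t z0) hD.le
      (fun ζ hζ => b1 z0 ζ (by linarith) (by linarith))
    have A1 : Adm (fun ζ => nk t (z0 + h) ζ • g ζ) M (D * B) := H.adm.smul (nk_cont t _) hD.le
      (fun ζ hζ => b1 _ ζ hzh (by linarith))
    have A2 : Adm (fun ζ => h • nk' t z0 ζ • g ζ) M (‖h‖ * (D * B)) :=
      A'.smul (n := fun _ => h) continuous_const (norm_nonneg _) (fun _ _ => le_rfl)
    have A3 : Adm (fun ζ => (nk t (z0+h) ζ - nk t z0 ζ - h * nk' t z0 ζ) • g ζ) M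
        (D * ‖h‖^2 * B) := by
      refine H.adm.smul (((nk_cont t _).sub (nk_cont t _)).sub
        (continuous_const.mul (nk'_cont t _))) (by positivity) (fun ζ hζ => ?_)
      have := b3 z0 (z0 + h) ζ (by linarith) hzh (by linarith)
      simpa using this
    have e : c0 (fun ζ => (nk t (z0+h) ζ - nk t z0 ζ - h * nk' t z0 ζ) • g ζ) =
        c0 (fun ζ => nk t (z0 + h) ζ • g ζ) - c0 (fun ζ => nk t z0 ζ • g ζ) -
        h • c0 (fun ζ => nk' t z0 ζ • g ζ) := by
      rw [← c0_smul, ← A1.c0_sub A0, ← (A1.sub A0).c0_sub A2]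
      congr 1
      funext ζ
      simp only [sub_smul, mul_smul]
    have e3 := H1 _ _ A3
    rw [e] at e3
    have e4 : TT t g (z0 + h) - TT t g z0 - h • (c - c0 g - c0 (fun ζ => nk' t z0 ζ • g ζ)) -
        (starRingEnd ℂ h) • g z0 =
        (CT g (z0 + h) - CT g z0 - h • c - (starRingEnd ℂ h) • g z0) -
        (c0 (fun ζ => nk t (z0 + h) ζ • g ζ) - c0 (fun ζ => nk t z0 ζ • g ζ) -
        h • c0 (fun ζ => nk' t z0 ζ • g ζ)) := by
      simp only [TT, smul_sub, add_smul]; abel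
    rw [e4]
    have e5 := sq_le_rpow (norm_nonneg h) hh.le
    calc _ ≤ C * B * ‖h‖^(3/2:ℝ) + C1 * (D * ‖h‖^2 * B) :=
          (norm_sub_le _ _).trans (add_le_add (hT h hh) e3)
      _ ≤ C * B * ‖h‖^(3/2:ℝ) + C1 * (D * ‖h‖^(3/2:ℝ) * B) := by gcongr
      _ = (C + C1 * D) * B * ‖h‖^(3/2:ℝ) := by ring
      _ ≤ _ := by gcongr; linarith

def LL (a b : F) : ℂ →L[ℝ] F :=
  (ContinuousLinearMap.id ℝ ℂ).smulRight a + (Complex.conjCLE : ℂ →L[ℝ] ℂ).smulRight b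

lemma LL_apply (a b : F) (h : ℂ) : LL a b h = h • a + (starRingEnd ℂ h) • b := by
  simp [LL]

lemma LL_norm (a b : F) : ‖LL a b‖ ≤ ‖a‖ + ‖b‖ := by
  refine ContinuousLinearMap.opNorm_le_bound _ (by positivity) fun h => ?_
  rw [LL_apply]
  refine (norm_add_le _ _).trans (le_of_eq ?_)
  rw [norm_smul, norm_smul, RCLike.norm_conj]; ring

lemma TT_reg [CompleteSpace F] (t M : ℝ) (hM : 0 < M) : ∃ C > 0, ∀ (g : ℂ → F) (B : ℝ),
    Hol g M B → (∀ z, ‖z‖ ≤ M → DifferentiableAt ℝ (TT t g) z ∧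
      fderiv ℝ (TT t g) z 1 + Complex.I • fderiv ℝ (TT t g) z Complex.I = (2:ℂ) • g z ∧
      ‖fderiv ℝ (TT t g) z‖ ≤ C * B) ∧
    fderiv ℝ (TT t g) 0 = 0 ∧
    ∀ z w, ‖z‖ ≤ M → ‖w‖ ≤ M →
      ‖fderiv ℝ (TT t g) z - fderiv ℝ (TT t g) w‖ ≤ C * B * ‖z - w‖^(1/2:ℝ) := by
  obtain ⟨C, hC, hT⟩ := TT_taylor (F := F) t M hM
  obtain ⟨C2, hC2, H2⟩ := Adm.expand0 (F := F) (M := M)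
  obtain ⟨D, hD, b1, b2, b3⟩ := nk_bounds t (M+1)
  refine ⟨(C + M^(1/2:ℝ)) + (5 * C + 2 * (C + M^(1/2:ℝ)) * (2 / 1)^(1/2:ℝ)), by positivity, ?_⟩
  intro g B H
  have nn := H.nn
  choose! c hc hTc using hT g B H
  have hexp : ∀ z0 ∈ closedBall (0:ℂ) M, ∀ z, ‖z - z0‖ < 1 →
      ‖TT t g z - TT t g z0 - LL (c z0) (g z0) (z - z0)‖ ≤ (C * B) * ‖z - z0‖^(3/2:ℝ) := by
    intro z0 h0 z hz
    have := hTc z0 (by simpa using h0) (z - z0) hz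
    rw [LL_apply, ← sub_sub]
    simpa using this
  have hfd : ∀ z, ‖z‖ ≤ M → HasFDerivAt (TT t g) (LL (c z) (g z)) z := fun z hz =>
    hasFDeriv_of_taylor one_pos (hexp z (by simpa using hz))
  have hLn : ∀ z ∈ closedBall (0:ℂ) M, ‖LL (c z) (g z)‖ ≤ (C + M^(1/2:ℝ)) * B := by
    intro z hz
    have hz : ‖z‖ ≤ M := by simpa using hz
    refine (LL_norm _ _).trans ?_
    have e1 := hc z hz
    have e2 : ‖g z‖ ≤ B * M^(1/2:ℝ) := (H.adm.bd z).trans (by gcongr)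
    linarith
  refine ⟨fun z hz => ⟨(hfd z hz).differentiableAt, ?_, ?_⟩, ?_, fun z w hz hw => ?_⟩
  · rw [(hfd z hz).fderiv, LL_apply, LL_apply]
    simp only [one_smul, map_one, Complex.conj_I, smul_add, smul_smul, Complex.I_mul_I,
      neg_smul, two_smul, smul_neg]
    abel
  · rw [(hfd z hz).fderiv]
    refine (hLn z (by simpa using hz)).trans ?_
    gcongr ?_ * _
    have : 0 ≤ (5 * C + 2 * (C + M^(1/2:ℝ)) * (2 / 1)^(1/2:ℝ)) := by positivity
    linarith
  · refine HasFDerivAt.fderiv (hasFDeriv_of_taylor (σ := 1) (C := C2 * B + C2 * (D * B)) one_pos ?_)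
    intro z hz
    rw [sub_zero] at hz
    have e1 := (H2 g B H.adm).2 z
    have A3 : Adm (fun ζ => nk t z ζ • g ζ) M (D * ‖z‖^2 * B) := by
      refine H.adm.smul (nk_cont t _) (by positivity) (fun ζ hζ => ?_)
      have := b3 0 z ζ (by simp; linarith) (by linarith) (by linarith)
      have n0 : nk t 0 ζ = 0 := by simp [nk]
      have n1 : nk' t 0 ζ = 0 := by simp [nk']
      simpa [n0, n1] using this
    have e2 := (H2 _ _ A3).1
    rw [TT_zero, sub_zero, sub_zero, TT]
    simp only [_root_.zero_apply, sub_zero]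
    have e5 := sq_le_rpow (norm_nonneg z) hz.le
    calc _ ≤ C2 * B * ‖z‖^(3/2:ℝ) + C2 * (D * ‖z‖^2 * B) :=
          (norm_sub_le _ _).trans (add_le_add e1 e2)
      _ ≤ C2 * B * ‖z‖^(3/2:ℝ) + C2 * (D * ‖z‖^(3/2:ℝ) * B) := by gcongr
      _ = _ := by ring
  · rw [(hfd z hz).fderiv, (hfd w hw).fderiv]
    have := conv_taylor' (by positivity) one_pos hLn hexp (by simpa using hz) (by simpa using hw)
    refine this.trans ?_
    rw [norm_sub_rev w z]
    gcongr ?_ * _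
    have : 0 ≤ (C + M^(1/2:ℝ)) * B := by positivity
    linarith

lemma TT_sub {t M B B' : ℝ} {g g' : ℂ → F} (h : Hol g M B) (h' : Hol g' M B') (z : ℂ) :
    TT t (fun ζ => g ζ - g' ζ) z = TT t g z - TT t g' z := by
  obtain ⟨D, hD, b1, -, -⟩ := nk_bounds t (max ‖z‖ M)
  have bb : ∀ {g : ℂ → F} {B : ℝ}, Hol g M B → ∀ ζ, ‖g ζ‖ ≤ B * |M|^(1/2:ℝ) := by
    intro g B h ζ
    have nn := h.nn
    rcases le_or_gt M ‖ζ‖ with hz | hz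
    · rw [h.supp ζ hz, norm_zero]; positivity
    · refine (h.adm.bd ζ).trans ?_
      gcongr
      exact hz.le.trans (le_abs_self M)
  have i : ∀ {g : ℂ → F} {B : ℝ}, Hol g M B → ∀ z, Integrable (fun ζ => (z - ζ)⁻¹ • g ζ) :=
    fun h z => int_CT h.adm.meas (bb h) h.supp z
  have A : ∀ {g : ℂ → F} {B : ℝ}, Hol g M B → Adm (fun ζ => nk t z ζ • g ζ) M (D * B) :=
    fun h => h.adm.smul (nk_cont t z) hD.le
      (fun ζ hζ => b1 z ζ (le_max_left _ _) (hζ.trans (le_max_right _ _)))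
  simp only [TT, smul_sub]
  rw [CT_sub (i h z) (i h' z), CT_sub (i h 0) (i h' 0), h.adm.c0_sub h'.adm,
    (A h).c0_sub (A h'), smul_sub]
  abel

lemma Hol.sub {M B B' : ℝ} {g g' : ℂ → F} (h : Hol g M B) (h' : Hol g' M B') :
    Hol (fun ζ => g ζ - g' ζ) M (B + B') :=
  ⟨by simp [h.zero, h'.zero], add_nonneg h.nn h'.nn, fun x y => by
    have : g x - g' x - (g y - g' y) = (g x - g y) - (g' x - g' y) := by abel
    rw [this]
    refine (norm_sub_le _ _).trans ?_
    linarith [h.hol x y, h'.hol x y], fun ζ hζ => by rw [h.supp ζ hζ, h'.supp ζ hζ, sub_zero]⟩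

end JHP
end

section
namespace JHP
open MeasureTheory

set_option linter.unusedSectionVars false
variable {F : Type*} [NormedAddCommGroup F] [NormedSpace ℂ F]

structure Pn (t κ M : ℝ) (g : ℂ → F) (B : ℝ) : Prop where
  nn : 0 ≤ B
  pt : ∀ z, ‖g z‖ ≤ B * ‖z‖^(1/2:ℝ) * Real.exp (t * ‖z‖^2)
  hol : ∀ x y, ‖g x - g y‖ ≤ κ * B * ‖x - y‖^(1/2:ℝ)
  supp : ∀ ζ, M ≤ ‖ζ‖ → g ζ = 0

lemma Pn.Hol {t κ M B : ℝ} {g : ℂ → F} (h : Pn t κ M g B) (hκ : 0 ≤ κ) : Hol g M (κ * B) :=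
  ⟨by have := h.pt 0; simpa using this, mul_nonneg hκ h.nn, h.hol, h.supp⟩

lemma Pn.zero {t κ M B : ℝ} (hκ : 0 ≤ κ) (hB : 0 ≤ B) : Pn t κ M (fun _ => (0:F)) B :=
  ⟨hB, fun z => by simp; positivity, fun x y => by simp; positivity, fun _ _ => rfl⟩

lemma Pn.add {t κ M B B' : ℝ} {g h : ℂ → F} (hg : Pn t κ M g B) (hh : Pn t κ M h B') :
    Pn t κ M (fun z => g z + h z) (B + B') :=
  ⟨add_nonneg hg.nn hh.nn, fun z => by
    refine (norm_add_le _ _).trans ((add_le_add (hg.pt z) (hh.pt z)).trans (le_of_eq ?_))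
    ring, fun x y => by
    rw [add_sub_add_comm]
    refine (norm_add_le _ _).trans ((add_le_add (hg.hol x y) (hh.hol x y)).trans (le_of_eq ?_))
    ring, fun ζ h => by rw [hg.supp ζ h, hh.supp ζ h, add_zero]⟩

lemma Pn.lim {t κ M B : ℝ} {g : ℕ → ℂ → F} {h : ℂ → F} (k : ℕ)
    (hg : ∀ m, k ≤ m → Pn t κ M (g m) B)
    (hl : ∀ z, Tendsto (fun m => g m z) atTop (𝓝 (h z))) : Pn t κ M h B :=
  ⟨(hg k le_rfl).nn, fun z => le_of_tendsto (hl z).norm (by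
      filter_upwards [eventually_ge_atTop k] with m hm using (hg m hm).pt z),
    fun x y => le_of_tendsto ((hl x).sub (hl y)).norm (by
      filter_upwards [eventually_ge_atTop k] with m hm using (hg m hm).hol x y),
    fun ζ hζ => tendsto_nhds_unique (hl ζ) (tendsto_const_nhds.congr' (by
      filter_upwards [eventually_ge_atTop k] with m hm using ((hg m hm).supp ζ hζ).symm))⟩

lemma fixpt [CompleteSpace F] {t κ M ρ : ℝ} (hκ : 0 ≤ κ) (hρ : 0 ≤ ρ) (Ψ : (ℂ → F) → (ℂ → F))
    (hinv : ∀ g, Pn t κ M g ρ → Pn t κ M (Ψ g) ρ)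
    (hcon : ∀ g g' B, Pn t κ M g ρ → Pn t κ M g' ρ → Pn t κ M (fun z => g z - g' z) B →
      Pn t κ M (fun z => Ψ g z - Ψ g' z) (B / 2)) :
    ∃ g, Pn t κ M g ρ ∧ ∀ z, Ψ g z = g z := by
  let s : ℕ → ℂ → F := fun k => Ψ^[k] (fun _ => 0)
  have s0 : s 0 = fun _ => 0 := rfl
  have ss : ∀ k, s (k+1) = Ψ (s k) := fun k => Function.iterate_succ_apply' _ _ _
  have hP : ∀ k, Pn t κ M (s k) ρ := by
    intro k
    induction k with
    | zero => exact Pn.zero hκ hρ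
    | succ k ih => rw [ss]; exact hinv _ ih
  have hD : ∀ k m, k ≤ m → Pn t κ M (fun z => s m z - s k z) (ρ * (1/2)^k) := by
    intro k
    induction k with
    | zero => intro m _; simpa [s0] using hP m
    | succ k ih =>
      intro m hm
      obtain ⟨m, rfl⟩ : ∃ m', m = m' + 1 := ⟨m - 1, by omega⟩
      have := hcon _ _ _ (hP m) (hP k) (ih m (by omega))
      rw [ss, ss]
      convert this using 1
      rw [pow_succ]; ring
  have hlim0 : ∀ b : ℝ, Tendsto (fun k : ℕ => ρ * (1/2:ℝ)^k * b) atTop (𝓝 0) := by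
    intro b
    have := ((tendsto_pow_atTop_nhds_zero_of_lt_one (r := (1/2:ℝ)) (by norm_num)
      (by norm_num)).const_mul ρ).mul_const b
    simpa using this
  have hex : ∀ z, ∃ y, Tendsto (fun m => s m z) atTop (𝓝 y) := by
    intro z
    refine cauchySeq_tendsto_of_complete (cauchySeq_of_le_tendsto_0'
      (fun k => ρ * (1/2)^k * (‖z‖^(1/2:ℝ) * Real.exp (t * ‖z‖^2))) ?_ (hlim0 _))
    intro k m hkm
    rw [dist_comm, dist_eq_norm, ← mul_assoc]
    exact (hD k m hkm).pt z
  choose g hg using hex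
  have hgP : Pn t κ M g ρ := Pn.lim 0 (fun m _ => hP m) hg
  refine ⟨g, hgP, fun z => ?_⟩
  have h1 : ∀ k, Pn t κ M (fun z => g z - s k z) (ρ * (1/2)^k) := fun k =>
    Pn.lim (g := fun m z => s m z - s k z) k (fun m hm => hD k m hm)
      (fun z => (hg z).sub_const _)
  have h2 : Tendsto (fun k => s (k+1) z) atTop (𝓝 (Ψ g z)) := by
    rw [tendsto_iff_norm_sub_tendsto_zero]
    refine squeeze_zero (fun _ => norm_nonneg _) (fun k => ?_)
      (hlim0 (1/2 * (‖z‖^(1/2:ℝ) * Real.exp (t * ‖z‖^2))))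
    have := (hcon _ _ _ hgP (hP k) (h1 k)).pt z
    rw [norm_sub_rev, ss]
    refine this.trans (le_of_eq ?_)
    ring
  exact tendsto_nhds_unique h2 ((tendsto_add_atTop_iff_nat 1).2 (hg z))

/-- extension of Hoelder bounds from the closed ball for functions vanishing outside -/
lemma hol_ext {g : ℂ → F} {M K : ℝ} (hM : 0 < M) (hK : 0 ≤ K)
    (h : ∀ x y, ‖x‖ ≤ M → ‖y‖ ≤ M → ‖g x - g y‖ ≤ K * ‖x - y‖^(1/2:ℝ))
    (hs : ∀ z, M ≤ ‖z‖ → g z = 0) (x y : ℂ) : ‖g x - g y‖ ≤ K * ‖x - y‖^(1/2:ℝ) := by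
  have main : ∀ x y : ℂ, ‖x‖ ≤ M → M < ‖y‖ → ‖g x - g y‖ ≤ K * ‖x - y‖^(1/2:ℝ) := by
    intro x y hx hy
    have hc : ContinuousOn (fun s : ℝ => ‖x + (s:ℂ) * (y - x)‖) (Icc 0 1) := by fun_prop
    obtain ⟨s, hs1, hs2⟩ : M ∈ (fun s : ℝ => ‖x + (s:ℂ) * (y - x)‖) '' Icc 0 1 :=
      intermediate_value_Icc zero_le_one hc ⟨by simpa using hx, by simpa using hy.le⟩
    simp only at hs2
    rw [hs y hy.le, ← hs _ hs2.ge]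
    refine (h _ _ hx hs2.le).trans ?_
    have e : ‖x - (x + (s:ℂ) * (y - x))‖ ≤ ‖x - y‖ := by
      rw [sub_add_cancel_left, norm_neg, norm_mul, Complex.norm_real, Real.norm_of_nonneg hs1.1,
        norm_sub_rev y x]
      exact mul_le_of_le_one_left (norm_nonneg _) hs1.2
    gcongr
  rcases le_or_gt ‖x‖ M with hx | hx <;> rcases le_or_gt ‖y‖ M with hy | hy
  · exact h x y hx hy
  · exact main x y hx hy
  · rw [norm_sub_rev, norm_sub_rev x]; exact main y x hy hx
  · rw [hs x hx.le, hs y hy.le, sub_zero, norm_zero]; positivity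

structure NL {G : Type*} [NormedAddCommGroup G] (A : ℂ → F → G) (Λ δ M : ℝ) : Prop where
  zero : ∀ z, A z 0 = 0
  supp : ∀ z Y, M ≤ ‖z‖ → A z Y = 0
  sd : ∀ z w Y Y' X X', ‖z‖ ≤ M → ‖w‖ ≤ M → ‖Y‖ ≤ δ → ‖Y'‖ ≤ δ → ‖X‖ ≤ δ → ‖X'‖ ≤ δ →
    ‖(A z Y - A z Y') - (A w X - A w X')‖ ≤ Λ * ‖(Y - Y') - (X - X')‖ +
      Λ * (‖z - w‖^(1/2:ℝ) + ‖Y - X‖ + ‖Y' - X'‖) * ‖X - X'‖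

lemma NL.lip {G : Type*} [NormedAddCommGroup G] {A : ℂ → F → G} {Λ δ M : ℝ} (H : NL A Λ δ M)
    {z : ℂ} {Y Y' : F} (hz : ‖z‖ ≤ M) (h1 : ‖Y‖ ≤ δ) (h2 : ‖Y'‖ ≤ δ) :
    ‖A z Y - A z Y'‖ ≤ Λ * ‖Y - Y'‖ := by
  have h0 : ‖(0:F)‖ ≤ δ := by rw [norm_zero]; exact (norm_nonneg _).trans h1
  simpa using H.sd z z Y Y' 0 0 hz hz h1 h2 h0 h0

lemma NL.bd {G : Type*} [NormedAddCommGroup G] {A : ℂ → F → G} {Λ δ M : ℝ} (H : NL A Λ δ M)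
    {z : ℂ} {Y : F} (hz : ‖z‖ ≤ M) (h1 : ‖Y‖ ≤ δ) : ‖A z Y‖ ≤ Λ * ‖Y‖ := by
  have h0 : ‖(0:F)‖ ≤ δ := by rw [norm_zero]; exact (norm_nonneg _).trans h1
  simpa [H.zero] using H.lip hz h1 h0

lemma NL.hol {G : Type*} [NormedAddCommGroup G] {A : ℂ → F → G} {Λ δ M : ℝ} (H : NL A Λ δ M)
    {z w : ℂ} {Y X : F} (hz : ‖z‖ ≤ M) (hw : ‖w‖ ≤ M) (h1 : ‖Y‖ ≤ δ) (h2 : ‖X‖ ≤ δ) :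
    ‖A z Y - A w X‖ ≤ Λ * ‖Y - X‖ + Λ * (‖z - w‖^(1/2:ℝ) + ‖Y - X‖) * ‖X‖ := by
  have h0 : ‖(0:F)‖ ≤ δ := by rw [norm_zero]; exact (norm_nonneg _).trans h1
  simpa [H.zero] using H.sd z w Y 0 X 0 hz hw h1 h0 h2 h0

lemma nl_pt {A : ℂ → F → F} {D : ℂ → F → (F →L[ℝ] F)} {Λ δ M q : ℝ} (hΛ : 0 ≤ Λ)
    (HA : NL A Λ δ M) (HD : NL D Λ δ M) {z : ℂ} {Y Y' Z Z' : F} (hz : ‖z‖ ≤ M)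
    (hqδ : q ≤ δ) (hq1 : q ≤ 1) (h1 : ‖Y‖ ≤ q) (h2 : ‖Y'‖ ≤ q) (h3 : ‖Z‖ ≤ q) :
    ‖(A z Y + D z Y Z) - (A z Y' + D z Y' Z')‖ ≤ 2 * Λ * ‖Y - Y'‖ + Λ * q * ‖Z - Z'‖ := by
  have hq : 0 ≤ q := (norm_nonneg _).trans h1
  have e : (A z Y + D z Y Z) - (A z Y' + D z Y' Z') =
      (A z Y - A z Y') + (D z Y - D z Y') Z + D z Y' (Z - Z') := by
    simp only [map_sub, _root_.sub_apply]; abel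
  rw [e]
  have b1 := HA.lip hz (h1.trans hqδ) (h2.trans hqδ)
  have b2 : ‖(D z Y - D z Y') Z‖ ≤ Λ * ‖Y - Y'‖ * 1 :=
    (ContinuousLinearMap.le_opNorm _ _).trans
      (mul_le_mul (HD.lip hz (h1.trans hqδ) (h2.trans hqδ)) (h3.trans hq1) (norm_nonneg _)
        (by positivity))
  have b3 : ‖D z Y' (Z - Z')‖ ≤ Λ * q * ‖Z - Z'‖ := by
    refine (ContinuousLinearMap.le_opNorm _ _).trans ?_
    gcongr
    refine (HD.bd hz (h2.trans hqδ)).trans ?_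
    gcongr
  refine (norm_add₃_le).trans ?_
  linarith

lemma nl_hol {A : ℂ → F → F} {D : ℂ → F → (F →L[ℝ] F)} {Λ δ M q α β γ h : ℝ} (hΛ : 0 ≤ Λ)
    (HA : NL A Λ δ M) (HD : NL D Λ δ M) {x y : ℂ} {Y Y' Z Z' X X' V V' : F}
    (hx : ‖x‖ ≤ M) (hy : ‖y‖ ≤ M) (hh : h = ‖x - y‖^(1/2:ℝ)) (hα : 0 ≤ α) (hβ : 0 ≤ β) (hγ : 0 ≤ γ)
    (hqδ : q ≤ δ) (hq1 : q ≤ 1) (h1 : ‖Y‖ ≤ q) (h2 : ‖Y'‖ ≤ q) (h3 : ‖Z‖ ≤ q)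
    (h1' : ‖X‖ ≤ q) (h2' : ‖X'‖ ≤ q)
    (k1 : ‖Y - X‖ ≤ q * h) (k2 : ‖Y' - X'‖ ≤ q * h) (k3 : ‖Z - V‖ ≤ q * h)
    (d1 : ‖X - X'‖ ≤ α) (d2 : ‖(Y - Y') - (X - X')‖ ≤ β * h)
    (d3 : ‖Z - Z'‖ ≤ γ) (d4 : ‖(Z - Z') - (V - V')‖ ≤ γ * h) :
    ‖((A x Y + D x Y Z) - (A x Y' + D x Y' Z')) - ((A y X + D y X V) - (A y X' + D y X' V'))‖ ≤
      Λ * (2 * β + 7 * α + 4 * q * γ) * h := by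
  have hq : 0 ≤ q := (norm_nonneg _).trans h1
  have hh0 : 0 ≤ h := by rw [hh]; positivity
  have e : ((A x Y + D x Y Z) - (A x Y' + D x Y' Z')) - ((A y X + D y X V) - (A y X' + D y X' V'))
      = ((A x Y - A x Y') - (A y X - A y X')) + (((D x Y - D x Y') - (D y X - D y X')) Z +
        (D y X - D y X') (Z - V)) + ((D x Y' - D y X') (Z - Z') +
          D y X' ((Z - Z') - (V - V'))) := by
    simp only [map_sub, _root_.sub_apply]; abel
  have S : Λ * ‖(Y - Y') - (X - X')‖ + Λ * (‖x - y‖^(1/2:ℝ) + ‖Y - X‖ + ‖Y' - X'‖) * ‖X - X'‖ ≤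
      Λ * (β + 3 * α) * h := by
    rw [← hh]
    calc _ ≤ Λ * (β * h) + Λ * (h + 1 * h + 1 * h) * α := by
          gcongr
          · exact k1.trans (by gcongr)
          · exact k2.trans (by gcongr)
      _ = _ := by ring
  have t1 := (HA.sd x y Y Y' X X' hx hy (h1.trans hqδ) (h2.trans hqδ) (h1'.trans hqδ)
    (h2'.trans hqδ)).trans S
  have t2 := (HD.sd x y Y Y' X X' hx hy (h1.trans hqδ) (h2.trans hqδ) (h1'.trans hqδ)
    (h2'.trans hqδ)).trans S
  have t3 : ‖((D x Y - D x Y') - (D y X - D y X')) Z‖ ≤ Λ * (β + 3 * α) * h * 1 :=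
    (ContinuousLinearMap.le_opNorm _ _).trans
      (mul_le_mul t2 (h3.trans hq1) (norm_nonneg _) (by positivity))
  have t4 : ‖(D y X - D y X') (Z - V)‖ ≤ Λ * α * (1 * h) := by
    refine (ContinuousLinearMap.le_opNorm _ _).trans
      (mul_le_mul ?_ (k3.trans (by gcongr)) (norm_nonneg _) (by positivity))
    exact (HD.lip hy (h1'.trans hqδ) (h2'.trans hqδ)).trans (by gcongr)
  have t5 : ‖(D x Y' - D y X') (Z - Z')‖ ≤ (Λ * (q * h) + Λ * (h + 1 * h) * q) * γ := by
    refine (ContinuousLinearMap.le_opNorm _ _).trans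
      (mul_le_mul ?_ d3 (norm_nonneg _) (by positivity))
    refine (HD.hol hx hy (h2.trans hqδ) (h2'.trans hqδ)).trans ?_
    rw [← hh]
    gcongr
    exact k2.trans (by gcongr)
  have t6 : ‖D y X' ((Z - Z') - (V - V'))‖ ≤ Λ * q * (γ * h) := by
    refine (ContinuousLinearMap.le_opNorm _ _).trans
      (mul_le_mul ?_ d4 (norm_nonneg _) (by positivity))
    exact (HD.bd hy (h2'.trans hqδ)).trans (by gcongr)
  rw [e]
  refine (norm_add₃_le).trans ?_
  have u1 := norm_add_le (((D x Y - D x Y') - (D y X - D y X')) Z) ((D y X - D y X') (Z - V))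
  have u2 := norm_add_le ((D x Y' - D y X') (Z - Z')) (D y X' ((Z - Z') - (V - V')))
  nlinarith

end JHP
end

section
namespace JHP
open MeasureTheory

set_option linter.unusedSectionVars false
variable {F : Type*} [NormedAddCommGroup F] [NormedSpace ℂ F]

structure Pk (M τ t κ K : ℝ) (W : ℂ → F) (g : ℂ → F) (B : ℝ) : Prop where
  zero : W 0 = 0
  fd0 : fderiv ℝ W 0 = 0
  diff : ∀ z, ‖z‖ ≤ M → DifferentiableAt ℝ W z
  eq : ∀ z, ‖z‖ ≤ M → fderiv ℝ W z 1 + Complex.I • fderiv ℝ W z Complex.I = (2:ℂ) • g z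
  pt : ∀ z, ‖z‖ ≤ M → ‖W z‖ ≤ τ * B * ‖z‖^(1/2:ℝ) * Real.exp (t * ‖z‖^2)
  fd : ∀ z, ‖z‖ ≤ M → ‖fderiv ℝ W z‖ ≤ K * κ * B
  fdh : ∀ z w, ‖z‖ ≤ M → ‖w‖ ≤ M → ‖fderiv ℝ W z - fderiv ℝ W w‖ ≤ K * κ * B * ‖z - w‖^(1/2:ℝ)
  lip : ∀ z w, ‖z‖ ≤ M → ‖w‖ ≤ M → ‖W z - W w‖ ≤ K * κ * B * ‖z - w‖

lemma TT_pack [CompleteSpace F] (M : ℝ) (hM : 0 < M) : ∃ C0 > 0, ∀ t > 0, ∃ K > 0,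
    ∀ (κ : ℝ) (g : ℂ → F) (B : ℝ), 0 ≤ κ → Pn t κ M g B →
      Pk M (C0 * t^(-(1/8):ℝ)) t κ K (TT t g) g B := by
  obtain ⟨C0, hC0, H0⟩ := TT_bound (F := F) M hM
  refine ⟨C0, hC0, fun t ht => ?_⟩
  obtain ⟨K, hK, HK⟩ := TT_reg (F := F) t M hM
  refine ⟨K, hK, fun κ g B hκ hg => ?_⟩
  obtain ⟨r1, r2, r3⟩ := HK g _ (hg.Hol hκ)
  have fd : ∀ z, ‖z‖ ≤ M → ‖fderiv ℝ (TT t g) z‖ ≤ K * κ * B := fun z hz => by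
    have := (r1 z hz).2.2
    rwa [← mul_assoc] at this
  refine ⟨TT_zero t g, r2, fun z hz => (r1 z hz).1, fun z hz => (r1 z hz).2.1,
    fun z hz => H0 t g B _ ht (hg.Hol hκ).adm hg.nn hg.pt z hz, fd,
    fun z w hz hw => ?_, fun z w hz hw => ?_⟩
  · have := r3 z w hz hw
    rwa [← mul_assoc K κ B] at this
  · exact (convex_closedBall (0:ℂ) M).norm_image_sub_le_of_norm_fderiv_le (𝕜 := ℝ)
      (fun x hx => (r1 x (by simpa using hx)).1) (fun x hx => fd x (by simpa using hx))
      (by simpa using hw) (by simpa using hz)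

lemma half_le {M : ℝ} {z w : ℂ} (hz : ‖z‖ ≤ M) (hw : ‖w‖ ≤ M) :
    ‖z - w‖ ≤ (2*M)^(1/2:ℝ) * ‖z - w‖^(1/2:ℝ) := by
  have h1 : ‖z - w‖ ≤ 2 * M := (norm_sub_le _ _).trans (by linarith)
  have h2 : ‖z - w‖ = ‖z - w‖^(1/2:ℝ) * ‖z - w‖^(1/2:ℝ) := by
    rw [← Real.rpow_add_of_nonneg (norm_nonneg _) (by norm_num) (by norm_num)]; norm_num
  calc ‖z - w‖ = ‖z - w‖^(1/2:ℝ) * ‖z - w‖^(1/2:ℝ) := h2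
    _ ≤ _ := by gcongr

lemma norm_half_le {M : ℝ} {z : ℂ} (hz : ‖z‖ ≤ M) :
    ‖z‖ ≤ M^(1/2:ℝ) * ‖z‖^(1/2:ℝ) := by
  have h2 : ‖z‖ = ‖z‖^(1/2:ℝ) * ‖z‖^(1/2:ℝ) := by
    rw [← Real.rpow_add_of_nonneg (norm_nonneg _) (by norm_num) (by norm_num)]; norm_num
  calc ‖z‖ = ‖z‖^(1/2:ℝ) * ‖z‖^(1/2:ℝ) := h2
    _ ≤ _ := by gcongr

lemma op_I {G : Type*} [NormedAddCommGroup G] [NormedSpace ℝ G] (L : ℂ →L[ℝ] G) :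
    ‖L Complex.I‖ ≤ ‖L‖ := by
  simpa using L.le_opNorm Complex.I

/-- the bounds for `Y = W + z c`, `Z = W_y + i c`. -/
lemma Pk.qb {M τ t κ K B : ℝ} {W g : ℂ → F} (h : Pk M τ t κ K W g B) (hM : 0 < M)
    (c : F) {q : ℝ}
    (hq : (K * κ * B + ‖c‖) * (1 + M + (2*M)^(1/2:ℝ)) ≤ q) :
    (∀ z, ‖z‖ ≤ M → ‖W z + z • c‖ ≤ q ∧
      ‖fderiv ℝ W z Complex.I + Complex.I • c‖ ≤ q) ∧
    ∀ z w, ‖z‖ ≤ M → ‖w‖ ≤ M → ‖(W z + z • c) - (W w + w • c)‖ ≤ q * ‖z - w‖^(1/2:ℝ) ∧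
      ‖(fderiv ℝ W z Complex.I + Complex.I • c) - (fderiv ℝ W w Complex.I + Complex.I • c)‖ ≤
        q * ‖z - w‖^(1/2:ℝ) := by
  have h0 : 0 ≤ K * κ * B := (norm_nonneg _).trans (h.fd 0 (by simpa using hM.le))
  have hm : 0 ≤ (2*M)^(1/2:ℝ) := by positivity
  set m := (2*M)^(1/2:ℝ)
  have hc := norm_nonneg c
  set S := K * κ * B + ‖c‖ with hS
  have hS0 : 0 ≤ S := by positivity
  have q1 : S ≤ q := by nlinarith [mul_nonneg hS0 hM.le, mul_nonneg hS0 hm]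
  have q2 : S * M ≤ q := by nlinarith [mul_nonneg hS0 hM.le, mul_nonneg hS0 hm]
  have q3 : S * m ≤ q := by nlinarith [mul_nonneg hS0 hM.le, mul_nonneg hS0 hm]
  have lip : ∀ z w, ‖z‖ ≤ M → ‖w‖ ≤ M → ‖(W z + z • c) - (W w + w • c)‖ ≤ S * ‖z - w‖ := by
    intro z w hz hw
    rw [add_sub_add_comm, ← sub_smul]
    refine (norm_add_le _ _).trans ?_
    rw [norm_smul]
    have := h.lip z w hz hw
    rw [hS]; nlinarith
  refine ⟨fun z hz => ⟨?_, ?_⟩, fun z w hz hw => ⟨?_, ?_⟩⟩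
  · have := lip z 0 hz (by simpa using hM.le)
    simp only [h.zero, zero_smul, add_zero, sub_zero] at this
    refine this.trans (le_trans ?_ q2)
    gcongr
  · refine (norm_add_le _ _).trans (le_trans ?_ q1)
    rw [norm_smul, Complex.norm_I, one_mul, hS]
    have := (op_I _).trans (h.fd z hz)
    linarith
  · refine (lip z w hz hw).trans ?_
    calc S * ‖z - w‖ ≤ S * (m * ‖z - w‖^(1/2:ℝ)) := by gcongr; exact half_le hz hw
      _ = S * m * ‖z - w‖^(1/2:ℝ) := by ring
      _ ≤ _ := by gcongr
  · rw [add_sub_add_right_eq_sub, ← _root_.sub_apply]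
    refine (op_I _).trans ((h.fdh z w hz hw).trans ?_)
    gcongr
    linarith

/-- interpolation -/
lemma interp {a u v k Q s : ℝ} (ha : 0 ≤ a) (hs : 0 ≤ s) (hk : 0 ≤ k + Q) (hu : a ≤ u * (s * s))
    (hv : a ≤ v) (huv : u * v ≤ (k + Q)^2) : a ≤ (k + Q) * s := by
  refine (pow_le_pow_iff_left₀ ha (by positivity) two_ne_zero).1 ?_
  have hv0 : 0 ≤ v := ha.trans hv
  calc a^2 = a * a := by ring
    _ ≤ (u * (s * s)) * v := mul_le_mul hu hv ha (ha.trans hu)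
    _ = u * v * s^2 := by ring
    _ ≤ (k+Q)^2 * s^2 := by gcongr
    _ = _ := by ring

end JHP
end

section
namespace JHP
open MeasureTheory

set_option linter.unusedSectionVars false
variable {F : Type*} [NormedAddCommGroup F] [NormedSpace ℂ F]

def Psi (A : ℂ → F → F) (D : ℂ → F → (F →L[ℝ] F)) (t : ℝ) (c : F) (g : ℂ → F) (z : ℂ) : F :=
  A z (TT t g z + z • c) + D z (TT t g z + z • c) (fderiv ℝ (TT t g) z Complex.I + Complex.I • c)

lemma Psi_contract {A : ℂ → F → F} {D : ℂ → F → (F →L[ℝ] F)} {Λ δ M t κ K τ ρ B q σ Q : ℝ}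
    (hM : 0 < M) (ht : 0 < t) (hΛ : 0 ≤ Λ) (HA : NL A Λ δ M) (HD : NL D Λ δ M) (hκ : 0 ≤ κ)
    (hK : 0 < K) (hτ : 0 ≤ τ)
    (hp : ∀ (g : ℂ → F) (B : ℝ), Pn t κ M g B → Pk M τ t κ K (TT t g) g B)
    {c : F} (hq : (K * κ * ρ + ‖c‖) * (1 + M + (2*M)^(1/2:ℝ)) ≤ q) (hqδ : q ≤ δ) (hq1 : q ≤ 1)
    (hσ : 0 ≤ σ) (hQ : 0 ≤ Q)
    (s1 : 2 * Λ * τ ≤ 1/4) (s2 : Λ * q * (K * κ) ≤ 1/4)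
    (s3 : K * κ * (2 * (τ * M^(1/2:ℝ) * Real.exp (t * M^2))) ≤ (σ * κ + Q)^2)
    (s4 : Λ * (2 * (σ * κ + Q) + 7 * (τ * M^(1/2:ℝ) * Real.exp (t * M^2)) + 4 * q * (K * κ)) ≤ κ / 2)
    {g g' : ℂ → F} (hg : Pn t κ M g ρ) (hg' : Pn t κ M g' ρ)
    (hd : Pn t κ M (fun z => g z - g' z) B) :
    Pn t κ M (fun z => Psi A D t c g z - Psi A D t c g' z) (B / 2) := by
  have P1 := hp g ρ hg
  have P2 := hp g' ρ hg'
  have P3 := hp _ B hd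
  obtain ⟨a1, a2⟩ := P1.qb hM c hq
  obtain ⟨b1, b2⟩ := P2.qb hM c hq
  have hB := hd.nn
  have hE : (TT t fun z => g z - g' z) = fun z => TT t g z - TT t g' z := by
    funext z; exact TT_sub (hg.Hol hκ) (hg'.Hol hκ) z
  rw [hE] at P3
  have hfd : ∀ z, ‖z‖ ≤ M → fderiv ℝ (fun z => TT t g z - TT t g' z) z =
      fderiv ℝ (TT t g) z - fderiv ℝ (TT t g') z := fun z hz =>
    fderiv_fun_sub (P1.diff z hz) (P2.diff z hz)
  have hq0 : 0 ≤ q := (norm_nonneg _).trans (a1 0 (by simpa using hM.le)).1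
  set e := τ * M^(1/2:ℝ) * Real.exp (t * M^2) with he
  have he0 : 0 ≤ e := by positivity
  have hα : ∀ z, ‖z‖ ≤ M → ‖TT t g z - TT t g' z‖ ≤ e * B := by
    intro z hz
    refine (P3.pt z hz).trans ?_
    rw [he]
    calc _ ≤ τ * B * M^(1/2:ℝ) * Real.exp (t * M^2) := by gcongr
      _ = _ := by ring
  have hYd : ∀ z, (TT t g z + z • c) - (TT t g' z + z • c) = TT t g z - TT t g' z := fun z => by abel
  have hZd : ∀ z, ‖z‖ ≤ M → (fderiv ℝ (TT t g) z Complex.I + Complex.I • c) -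
      (fderiv ℝ (TT t g') z Complex.I + Complex.I • c) =
      fderiv ℝ (fun z => TT t g z - TT t g' z) z Complex.I := fun z hz => by
    rw [hfd z hz, _root_.sub_apply]; abel
  have hsupp : ∀ ζ, M ≤ ‖ζ‖ → Psi A D t c g ζ - Psi A D t c g' ζ = 0 := fun ζ hζ => by
    simp [Psi, HA.supp ζ _ hζ, HD.supp ζ _ hζ]
  have hM0 : ‖(0:ℂ)‖ ≤ M := by simpa using hM.le
  refine ⟨by positivity, fun z => ?_, hol_ext hM (by positivity) (fun x y hx hy => ?_) hsupp, hsupp⟩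
  · rcases le_or_gt M ‖z‖ with hz | hz
    · simp only [hsupp z hz, norm_zero]; positivity
    have hz := hz.le
    have := nl_pt hΛ HA HD (Y := TT t g z + z • c) (Y' := TT t g' z + z • c)
      (Z := fderiv ℝ (TT t g) z Complex.I + Complex.I • c)
      (Z' := fderiv ℝ (TT t g') z Complex.I + Complex.I • c) hz hqδ hq1 (a1 z hz).1 (b1 z hz).1
      (a1 z hz).2
    refine this.trans ?_
    rw [hYd, hZd z hz]
    have h1 := P3.pt z hz
    have h2 : ‖fderiv ℝ (fun z => TT t g z - TT t g' z) z Complex.I‖ ≤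
        K * κ * B * ‖z‖^(1/2:ℝ) := by
      have := P3.fdh z 0 hz hM0
      rw [P3.fd0, sub_zero, sub_zero] at this
      exact (op_I _).trans this
    set X := ‖z‖^(1/2:ℝ) with hX
    have hX0 : 0 ≤ X := by positivity
    have hex : 1 ≤ Real.exp (t * ‖z‖^2) := Real.one_le_exp (by positivity)
    set e' := Real.exp (t * ‖z‖^2)
    calc _ ≤ 2 * Λ * (τ * B * X * e') + Λ * q * (K * κ * B * X) := by gcongr
      _ = (2 * Λ * τ) * (B * X * e') + (Λ * q * (K * κ)) * (B * X * 1) := by ring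
      _ ≤ 1/4 * (B * X * e') + 1/4 * (B * X * e') := by gcongr
      _ = _ := by ring
  · have := nl_hol (α := e * B) (β := (σ * κ + Q) * B) (γ := K * κ * B) hΛ HA HD
      (Y := TT t g x + x • c) (Y' := TT t g' x + x • c)
      (Z := fderiv ℝ (TT t g) x Complex.I + Complex.I • c)
      (Z' := fderiv ℝ (TT t g') x Complex.I + Complex.I • c)
      (X := TT t g y + y • c) (X' := TT t g' y + y • c)
      (V := fderiv ℝ (TT t g) y Complex.I + Complex.I • c)
      (V' := fderiv ℝ (TT t g') y Complex.I + Complex.I • c) hx hy rfl (by positivity)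
      (by positivity) (by positivity) hqδ hq1 (a1 x hx).1 (b1 x hx).1
      (a1 x hx).2 (a1 y hy).1 (b1 y hy).1 (a2 x y hx hy).1 (b2 x y hx hy).1 (a2 x y hx hy).2
      (by rw [hYd]; exact hα y hy)
      (by
        rw [hYd, hYd]
        have := interp (a := ‖(TT t g x - TT t g' x) - (TT t g y - TT t g' y)‖)
          (u := K * κ * B) (v := 2 * (e * B)) (k := σ * κ * B) (Q := Q * B)
          (s := ‖x - y‖^(1/2:ℝ)) (norm_nonneg _) (by positivity) (by positivity) (by
            rw [← Real.rpow_add_of_nonneg (norm_nonneg _) (by norm_num) (by norm_num)]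
            norm_num
            exact P3.lip x y hx hy) (by
            refine (norm_sub_le _ _).trans ?_
            linarith [hα x hx, hα y hy]) (by
            calc K * κ * B * (2 * (e * B)) = K * κ * (2 * e) * B^2 := by ring
              _ ≤ (σ * κ + Q)^2 * B^2 := by gcongr
              _ = _ := by ring)
        rwa [add_mul])
      (by rw [hZd x hx]; exact (op_I _).trans (P3.fd x hx))
      (by
        rw [hZd x hx, hZd y hy, ← _root_.sub_apply]
        exact (op_I _).trans (P3.fdh x y hx hy))
    refine this.trans ?_
    gcongr ?_ * _
    calc _ = Λ * (2 * (σ * κ + Q) + 7 * e + 4 * q * (K * κ)) * B := by ring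
      _ ≤ κ / 2 * B := by gcongr
      _ = _ := by ring

lemma Psi_zero {A : ℂ → F → F} {D : ℂ → F → (F →L[ℝ] F)} {Λ δ M t κ K τ ρ q : ℝ}
    (hM : 0 < M) (ht : 0 < t) (hΛ : 0 ≤ Λ) (HA : NL A Λ δ M) (HD : NL D Λ δ M) (hκ : 1 ≤ κ)
    (hK : 0 < K) (hρ : 0 ≤ ρ)
    (hp : ∀ (g : ℂ → F) (B : ℝ), Pn t κ M g B → Pk M τ t κ K (TT t g) g B)
    {c : F} (hq : (K * κ * ρ + ‖c‖) * (1 + M + (2*M)^(1/2:ℝ)) ≤ q) (hqδ : q ≤ δ) (hq1 : q ≤ 1) :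
    Pn t κ M (Psi A D t c (fun _ => 0))
      ((2 * Λ * M^(1/2:ℝ) + Λ * (2 * (2*M)^(1/2:ℝ) + 7 * M + 4)) * ‖c‖) := by
  have P1 := hp _ 0 (Pn.zero (zero_le_one.trans hκ) le_rfl)
  have P2 : Pk M τ t κ K (TT t (fun _ => (0:F))) (fun _ => 0) ρ :=
    hp _ ρ (Pn.zero (zero_le_one.trans hκ) hρ)
  obtain ⟨a1, a2⟩ := P2.qb hM c hq
  have hM0 : ‖(0:ℂ)‖ ≤ M := by simpa using hM.le
  have hq0 : 0 ≤ q := (norm_nonneg _).trans (a1 0 hM0).1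
  have hW : ∀ z, ‖z‖ ≤ M → TT t (fun _ => (0:F)) z = 0 := fun z hz => by
    have := P1.pt z hz; simpa using this
  have hW' : ∀ z, ‖z‖ ≤ M → fderiv ℝ (TT t (fun _ => (0:F))) z = 0 := fun z hz => by
    have := P1.fd z hz; simpa using this
  have hc1 : ‖c‖ ≤ q := by
    have := (a1 0 hM0).2
    rw [hW' 0 hM0] at this
    simpa [norm_smul] using this
  have hsupp : ∀ ζ, M ≤ ‖ζ‖ → Psi A D t c (fun _ => 0) ζ = 0 := fun ζ hζ => by
    simp [Psi, HA.supp ζ _ hζ, HD.supp ζ _ hζ]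
  have hPsi : ∀ z, ‖z‖ ≤ M → Psi A D t c (fun _ => 0) z =
      A z (z • c) + D z (z • c) (Complex.I • c) := fun z hz => by
    simp [Psi, hW z hz, hW' z hz]
  have y1 : ∀ z, ‖z‖ ≤ M → ‖z • c‖ ≤ q := fun z hz => by
    have := (a1 z hz).1
    rwa [hW z hz, zero_add] at this
  have y2 : ∀ z w, ‖z‖ ≤ M → ‖w‖ ≤ M → ‖z • c - w • c‖ ≤ q * ‖z - w‖^(1/2:ℝ) := fun z w hz hw => by
    have := (a2 z w hz hw).1
    rwa [hW z hz, hW w hw, zero_add, zero_add] at this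
  have hIc : ‖Complex.I • c‖ = ‖c‖ := by rw [norm_smul, Complex.norm_I, one_mul]
  have hc := norm_nonneg c
  set m := (2*M)^(1/2:ℝ) with hm
  have hm0 : 0 ≤ m := by positivity
  refine ⟨by positivity, fun z => ?_, hol_ext hM (by positivity) (fun x y hx hy => ?_) hsupp, hsupp⟩
  · rcases le_or_gt M ‖z‖ with hz | hz
    · simp only [hsupp z hz, norm_zero]; positivity
    have hz := hz.le
    rw [hPsi z hz]
    have h1 := HA.bd hz ((y1 z hz).trans hqδ)
    have h2 : ‖D z (z • c) (Complex.I • c)‖ ≤ Λ * ‖z • c‖ * 1 := by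
      refine (ContinuousLinearMap.le_opNorm _ _).trans
        (mul_le_mul (HD.bd hz ((y1 z hz).trans hqδ)) ?_ (norm_nonneg _) (by positivity))
      rw [hIc]; exact hc1.trans hq1
    have hex : 1 ≤ Real.exp (t * ‖z‖^2) := Real.one_le_exp (by positivity)
    have h3 := norm_half_le hz
    calc _ ≤ Λ * ‖z • c‖ + Λ * ‖z • c‖ * 1 := (norm_add_le _ _).trans (add_le_add h1 h2)
      _ = 2 * Λ * ‖c‖ * ‖z‖ := by rw [norm_smul]; ring
      _ ≤ 2 * Λ * ‖c‖ * (M^(1/2:ℝ) * ‖z‖^(1/2:ℝ)) := by gcongr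
      _ = (2 * Λ * M^(1/2:ℝ) + 0) * ‖c‖ * ‖z‖^(1/2:ℝ) * 1 := by ring
      _ ≤ _ := by gcongr; positivity
  · rw [hPsi x hx, hPsi y hy]
    have := nl_hol (α := M * ‖c‖) (β := m * ‖c‖) (γ := ‖c‖) hΛ HA HD
      (Y := x • c) (Y' := 0) (Z := Complex.I • c) (Z' := 0)
      (X := y • c) (X' := 0) (V := Complex.I • c) (V' := 0) hx hy rfl (by positivity)
      (by positivity) (by positivity) hqδ hq1 (y1 x hx) (by simpa using hq0)
      (by rw [hIc]; exact hc1) (y1 y hy) (by simpa using hq0) (y2 x y hx hy)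
      (by simp; positivity) (by simp; positivity)
      (by rw [sub_zero, norm_smul]; gcongr)
      (by
        rw [sub_zero, sub_zero, ← sub_smul, norm_smul]
        calc _ ≤ (m * ‖x - y‖^(1/2:ℝ)) * ‖c‖ := by gcongr; exact half_le hx hy
          _ = _ := by ring)
      (by rw [sub_zero, hIc]) (by simp; positivity)
    simp only [HA.zero, map_zero, add_zero, sub_zero] at this
    refine this.trans ?_
    gcongr ?_ * _
    calc Λ * (2 * (m * ‖c‖) + 7 * (M * ‖c‖) + 4 * q * ‖c‖)
        ≤ Λ * (2 * (m * ‖c‖) + 7 * (M * ‖c‖) + 4 * 1 * ‖c‖) := by gcongr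
      _ = 1 * ((0 + Λ * (2 * m + 7 * M + 4)) * ‖c‖) := by ring
      _ ≤ _ := by gcongr; positivity

set_option maxHeartbeats 2000000 in
theorem fix_main [CompleteSpace F] {A : ℂ → F → F} {D : ℂ → F → (F →L[ℝ] F)} {Λ δ M : ℝ}
    (hM : 0 < M) (hδ : 0 < δ) (hΛ : 0 ≤ Λ) (HA : NL A Λ δ M) (HD : NL D Λ δ M) :
    ∃ C > 0, ∃ s > 0, ∀ c : F, ‖c‖ < s → ∃ Y : ℂ → F, Y 0 = 0 ∧
      (∀ z, ‖z‖ ≤ M → DifferentiableAt ℝ Y z ∧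
        fderiv ℝ Y z 1 + Complex.I • fderiv ℝ Y z Complex.I =
          (2:ℂ) • (A z (Y z) + D z (Y z) (fderiv ℝ Y z Complex.I)) ∧ ‖Y z‖ ≤ C * ‖c‖) ∧
      ∀ h : ℂ, fderiv ℝ Y 0 h = h • c := by
  obtain ⟨C0, hC0, H0⟩ := TT_pack (F := F) M hM
  -- choose t
  obtain ⟨t, ht, htτ⟩ : ∃ t > 0, 2 * Λ * (C0 * t^(-(1/8):ℝ)) ≤ 1/4 := by
    have h1 : Tendsto (fun t : ℝ => 2 * Λ * (C0 * t^(-(1/8):ℝ))) atTop (𝓝 0) := by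
      have := ((tendsto_rpow_neg_atTop (y := 1/8) (by norm_num)).const_mul C0).const_mul (2 * Λ)
      simpa using this
    obtain ⟨t, h2, h3⟩ := ((h1.eventually_lt_const (show (0:ℝ) < 1/4 by norm_num)).and
      (eventually_gt_atTop 0)).exists
    exact ⟨t, h3, h2.le⟩
  obtain ⟨K, hK, HK⟩ := H0 t ht
  set τ := C0 * t^(-(1/8):ℝ) with hτ
  have hτ0 : 0 ≤ τ := by positivity
  set e := τ * M^(1/2:ℝ) * Real.exp (t * M^2) with he
  have he0 : 0 ≤ e := by positivity
  set σ : ℝ := 1 / (16 * (Λ + 1)) with hσ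
  have hσ0 : 0 < σ := by positivity
  have hσΛ : Λ * (2 * σ) ≤ 1/8 := by
    rw [hσ]
    have : Λ * (2 * (1 / (16 * (Λ + 1)))) = Λ / (Λ + 1) * (1/8) := by field_simp; ring
    rw [this]
    have : Λ / (Λ + 1) ≤ 1 := by rw [div_le_one (by positivity)]; linarith
    linarith
  set Q : ℝ := K * e / (2 * σ) with hQ
  have hQ0 : 0 ≤ Q := by positivity
  have hQe : K * (2 * e) = 4 * σ * Q := by rw [hQ]; field_simp; ring
  set κ : ℝ := 1 + 8 * Λ * (2 * Q + 7 * e) with hκ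
  have hκ1 : 1 ≤ κ := by rw [hκ]; have : 0 ≤ 8 * Λ * (2 * Q + 7 * e) := by positivity
                         linarith
  have hκ0 : 0 ≤ κ := by linarith
  have hp := fun (g : ℂ → F) (B : ℝ) (h : Pn t κ M g B) => HK κ g B hκ0 h
  set C1 : ℝ := 2 * Λ * M^(1/2:ℝ) + Λ * (2 * (2*M)^(1/2:ℝ) + 7 * M + 4) with hC1
  have hC10 : 0 ≤ C1 := by positivity
  set S : ℝ := (K * κ * (2 * C1) + 1) * (1 + M + (2*M)^(1/2:ℝ)) with hS
  have hS0 : 0 < S := by positivity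
  obtain ⟨q, hq0, hqδ, hq1, hq2⟩ : ∃ q > 0, q ≤ δ ∧ q ≤ 1 ∧ q * (32 * Λ * K * κ) ≤ 1 := by
    refine ⟨min δ (min 1 (1 / (32 * Λ * K * κ + 1))), by positivity, min_le_left _ _,
      (min_le_right _ _).trans (min_le_left _ _), ?_⟩
    have hX : 0 ≤ 32 * Λ * K * κ := by positivity
    calc _ ≤ (1 / (32 * Λ * K * κ + 1)) * (32 * Λ * K * κ) := by
          gcongr; exact (min_le_right _ _).trans (min_le_right _ _)
      _ ≤ 1 := by
        rw [one_div, inv_mul_le_one₀ (by positivity)]; linarith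
  refine ⟨S, hS0, q / S, by positivity, fun c hc => ?_⟩
  rw [lt_div_iff₀ hS0] at hc
  set ρ := 2 * C1 * ‖c‖ with hρ
  have hρ0 : 0 ≤ ρ := by positivity
  have hqS : (K * κ * ρ + ‖c‖) * (1 + M + (2*M)^(1/2:ℝ)) = S * ‖c‖ := by rw [hρ, hS]; ring
  have hqq : (K * κ * ρ + ‖c‖) * (1 + M + (2*M)^(1/2:ℝ)) ≤ q := by rw [hqS]; linarith
  have s2 : Λ * q * (K * κ) ≤ 1/4 := by
    have : q * (32 * Λ * K * κ) = 32 * (Λ * q * (K * κ)) := by ring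
    linarith
  have con : ∀ g g' B, Pn t κ M g ρ → Pn t κ M g' ρ → Pn t κ M (fun z => g z - g' z) B →
      Pn t κ M (fun z => Psi A D t c g z - Psi A D t c g' z) (B / 2) := by
    intro g g' B h1 h2 h3
    refine Psi_contract hM ht hΛ HA HD hκ0 hK hτ0 hp hqq hqδ hq1 hσ0.le hQ0 htτ s2 ?_ ?_ h1 h2 h3
    · calc K * κ * (2 * e) = κ * (K * (2 * e)) := by ring
        _ = κ * (4 * σ * Q) := by rw [hQe]
        _ ≤ _ := by nlinarith [sq_nonneg (σ * κ - Q)]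
    · have u1 : Λ * (2 * σ) * κ ≤ 1/8 * κ := by gcongr
      have u2 : 4 * (Λ * q * (K * κ)) ≤ 1/8 := by
        have : q * (32 * Λ * K * κ) = 32 * (Λ * q * (K * κ)) := by ring
        linarith
      have u3 : 8 * (Λ * (2 * Q + 7 * e)) ≤ κ := by rw [hκ]; linarith
      calc Λ * (2 * (σ * κ + Q) + 7 * e + 4 * q * (K * κ)) =
          Λ * (2 * σ) * κ + Λ * (2 * Q + 7 * e) + 4 * (Λ * q * (K * κ)) := by ring
        _ ≤ κ / 2 := by linarith
  have hz := Psi_zero hM ht hΛ HA HD hκ1 hK hρ0 hp hqq hqδ hq1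
  have inv : ∀ g, Pn t κ M g ρ → Pn t κ M (Psi A D t c g) ρ := by
    intro g hg
    have h1 := con g (fun _ => 0) ρ hg (Pn.zero hκ0 hρ0) (by simpa using hg)
    have h2 := h1.add hz
    have e1 : ρ / 2 + (2 * Λ * M^(1/2:ℝ) + Λ * (2 * (2*M)^(1/2:ℝ) + 7 * M + 4)) * ‖c‖ = ρ := by
      rw [hρ, hC1]; ring
    rw [e1] at h2
    simpa using h2
  obtain ⟨g, hg, hfix⟩ := fixpt hκ0 hρ0 (Psi A D t c) inv con
  have P := hp g ρ hg
  have hM0 : ‖(0:ℂ)‖ ≤ M := by simpa using hM.le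
  have hYd : ∀ z, ‖z‖ ≤ M → HasFDerivAt (fun z => TT t g z + z • c)
      (fderiv ℝ (TT t g) z + (ContinuousLinearMap.id ℝ ℂ).smulRight c) z := fun z hz =>
    (P.diff z hz).hasFDerivAt.add ((hasFDerivAt_id (𝕜 := ℝ) z).smul_const c)
  refine ⟨fun z => TT t g z + z • c, by simp [P.zero], fun z hz => ⟨(hYd z hz).differentiableAt, ?_, ?_⟩,
    fun h => ?_⟩
  · have e1 : fderiv ℝ (fun z => TT t g z + z • c) z 1 = fderiv ℝ (TT t g) z 1 + c := by
      rw [(hYd z hz).fderiv]; simp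
    have e2 : fderiv ℝ (fun z => TT t g z + z • c) z Complex.I =
        fderiv ℝ (TT t g) z Complex.I + Complex.I • c := by
      rw [(hYd z hz).fderiv]; simp
    rw [e1, e2]
    have h1 := P.eq z hz
    have h2 := hfix z
    rw [Psi] at h2
    rw [h2, ← h1, smul_add, smul_smul, Complex.I_mul_I, neg_one_smul]
    abel
  · have := ((P.qb hM c le_rfl).1 z hz).1
    rwa [hqS] at this
  · rw [(hYd 0 hM0).fderiv, P.fd0]; simp

end JHP
end

section
namespace JHP
open MeasureTheory

lemma lip_compact {X G : Type*} [NormedAddCommGroup X] [NormedSpace ℝ X]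
    [NormedAddCommGroup G] [NormedSpace ℝ G] {U K : Set X} (hU : IsOpen U) {f : X → G}
    (hf : ContDiffOn ℝ 1 f U) (hK : IsCompact K) (hKU : K ⊆ U) :
    ∃ C : ℝ, 0 ≤ C ∧ (∀ x ∈ K, ∀ y ∈ K, ‖f x - f y‖ ≤ C * ‖x - y‖) ∧ ∀ x ∈ K, ‖f x‖ ≤ C := by
  have h1 : LocallyLipschitzOn K f := by
    intro x hx
    obtain ⟨C, t, ht, h⟩ := (hf.contDiffAt (hU.mem_nhds (hKU hx))).exists_lipschitzOnWith
    exact ⟨C, t, mem_nhdsWithin_of_mem_nhds ht, h⟩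
  obtain ⟨C, hC⟩ := h1.exists_lipschitzOnWith_of_compact hK
  obtain ⟨C2, hC2⟩ := hK.exists_bound_of_continuousOn (hf.continuousOn.mono hKU)
  refine ⟨C + |C2|, by positivity, fun x hx y hy => ?_, fun x hx => ?_⟩
  · have := hC.dist_le_mul x hx y hy
    rw [dist_eq_norm, dist_eq_norm] at this
    refine this.trans ?_
    gcongr
    linarith [abs_nonneg C2]
  · have : (0:ℝ) ≤ C := C.2
    linarith [hC2 x hx, le_abs_self C2]

lemma sd_lemma {T F G : Type*} [NormedAddCommGroup T] [NormedSpace ℝ T]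
    [NormedAddCommGroup F] [NormedSpace ℝ F] [ProperSpace F]
    [NormedAddCommGroup G] [NormedSpace ℝ G] {U : Set (T × F)} (hU : IsOpen U) {f : T × F → G}
    (hf : ContDiffOn ℝ 2 f U) {K : Set T} (hK : IsCompact K) (hKU : ∀ θ ∈ K, (θ, (0:F)) ∈ U) :
    ∃ δ > 0, ∃ Λ : ℝ, 0 ≤ Λ ∧ (∀ θ ∈ K, ∀ Y : F, ‖Y‖ ≤ δ → (θ, Y) ∈ U) ∧
      ∀ θ ∈ K, ∀ η ∈ K, ∀ Y Y' X X' : F, ‖Y‖ ≤ δ → ‖Y'‖ ≤ δ → ‖X‖ ≤ δ → ‖X'‖ ≤ δ →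
      ‖(f (θ, Y) - f (θ, Y')) - (f (η, X) - f (η, X'))‖ ≤ Λ * ‖(Y - Y') - (X - X')‖ +
        Λ * (‖θ - η‖ + ‖Y - X‖ + ‖Y' - X'‖) * ‖X - X'‖ := by
  obtain ⟨u, v, -, hv, hKu, h0v, huv⟩ := generalized_tube_lemma hK (isCompact_singleton (x := (0:F)))
    hU (by rintro ⟨a, b⟩ ⟨ha, hb⟩; obtain rfl : b = 0 := hb; exact hKU a ha)
  obtain ⟨δ, hδ, hδv⟩ := Metric.nhds_basis_closedBall.mem_iff.1 (hv.mem_nhds (h0v rfl))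
  have hKδ : K ×ˢ closedBall (0:F) δ ⊆ U := (prod_mono hKu hδv).trans huv
  have hf' : ContDiffOn ℝ 1 (fderiv ℝ f) U := hf.fderiv_of_isOpen hU (by norm_num)
  obtain ⟨C, hC0, hCl, hCb⟩ := lip_compact hU hf' (hK.prod (isCompact_closedBall (0:F) δ)) hKδ
  refine ⟨δ, hδ, C, hC0, fun θ hθ Y hY => hKδ ⟨hθ, by simpa using hY⟩, ?_⟩
  intro θ hθ η hη Y Y' X X' hY hY' hX hX'
  have hseg : ∀ {Y Y' : F}, ‖Y‖ ≤ δ → ‖Y'‖ ≤ δ → ∀ s ∈ Icc (0:ℝ) 1, ‖Y' + s • (Y - Y')‖ ≤ δ := by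
    intro Y Y' hY hY' s hs
    have := (convex_closedBall (0:F) δ).add_smul_sub_mem (x := Y') (y := Y) (by simpa using hY')
      (by simpa using hY) hs
    simpa using this
  have hder : ∀ {θ : T} {Y Y' : F}, θ ∈ K → ‖Y‖ ≤ δ → ‖Y'‖ ≤ δ → ∀ s ∈ Icc (0:ℝ) 1,
      HasDerivAt (fun s : ℝ => f (θ, Y' + s • (Y - Y')))
        (fderiv ℝ f (θ, Y' + s • (Y - Y')) (0, Y - Y')) s := by
    intro θ Y Y' hθ hY hY' s hs
    have hm : (θ, Y' + s • (Y - Y')) ∈ U := hKδ ⟨hθ, by simpa using hseg hY hY' s hs⟩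
    have h1 := ((hf.contDiffAt (hU.mem_nhds hm)).differentiableAt (by norm_num)).hasFDerivAt
    have h2 : HasDerivAt (fun s : ℝ => (θ, Y' + s • (Y - Y'))) ((0:T), Y - Y') s := by
      refine (hasDerivAt_const s θ).prodMk ?_
      simpa using ((hasDerivAt_id s).smul_const (Y - Y')).const_add Y'
    exact h1.comp_hasDerivAt s h2
  have key := norm_image_sub_le_of_norm_deriv_le_segment_01'
    (f := fun s : ℝ => f (θ, Y' + s • (Y - Y')) - f (η, X' + s • (X - X')))
    (f' := fun s => fderiv ℝ f (θ, Y' + s • (Y - Y')) (0, Y - Y') -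
      fderiv ℝ f (η, X' + s • (X - X')) (0, X - X'))
    (C := C * ‖(Y - Y') - (X - X')‖ + C * (‖θ - η‖ + ‖Y - X‖ + ‖Y' - X'‖) * ‖X - X'‖)
    (fun s hs => ((hder hθ hY hY' s hs).sub (hder hη hX hX' s hs)).hasDerivWithinAt)
    (fun s hs => by
      have hs : s ∈ Icc (0:ℝ) 1 := Ico_subset_Icc_self hs
      have m1 : (θ, Y' + s • (Y - Y')) ∈ K ×ˢ closedBall (0:F) δ :=
        ⟨hθ, by simpa using hseg hY hY' s hs⟩
      have m2 : (η, X' + s • (X - X')) ∈ K ×ˢ closedBall (0:F) δ :=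
        ⟨hη, by simpa using hseg hX hX' s hs⟩
      have e : fderiv ℝ f (θ, Y' + s • (Y - Y')) (0, Y - Y') -
          fderiv ℝ f (η, X' + s • (X - X')) (0, X - X') =
          fderiv ℝ f (θ, Y' + s • (Y - Y')) (0, (Y - Y') - (X - X')) +
          (fderiv ℝ f (θ, Y' + s • (Y - Y')) - fderiv ℝ f (η, X' + s • (X - X'))) (0, X - X') := by
        have : ((0:T), (Y - Y') - (X - X')) = (0, Y - Y') - (0, X - X') := by simp
        rw [this, map_sub, _root_.sub_apply]; abel
      rw [e]
      have n0 : ∀ v : F, ‖((0:T), v)‖ = ‖v‖ := fun v => by simp [Prod.norm_def]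
      refine (norm_add_le _ _).trans (add_le_add ?_ ?_)
      · refine (ContinuousLinearMap.le_opNorm _ _).trans ?_
        rw [n0]
        gcongr
        exact hCb _ m1
      · refine (ContinuousLinearMap.le_opNorm _ _).trans ?_
        rw [n0]
        gcongr
        refine (hCl _ m1 _ m2).trans ?_
        gcongr
        have e2 : Y' + s • (Y - Y') - (X' + s • (X - X')) = (1 - s) • (Y' - X') + s • (Y - X) := by
          module
        rw [Prod.mk_sub_mk, Prod.norm_def, e2]
        have n1 : ‖(1 - s) • (Y' - X') + s • (Y - X)‖ ≤ ‖Y - X‖ + ‖Y' - X'‖ := by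
          refine (norm_add_le _ _).trans ?_
          rw [norm_smul, norm_smul, Real.norm_of_nonneg hs.1, Real.norm_of_nonneg (by linarith [hs.2])]
          have := mul_le_of_le_one_left (norm_nonneg (Y - X)) hs.2
          have := mul_le_of_le_one_left (norm_nonneg (Y' - X')) (show 1 - s ≤ 1 by linarith [hs.1])
          linarith
        exact max_le (by linarith [norm_nonneg (Y - X), norm_nonneg (Y' - X')])
          (by simp only; linarith [norm_nonneg (θ - η)]))
  simp only [one_smul, zero_smul, add_zero, add_sub_cancel] at key
  refine le_trans (le_of_eq ?_) key
  congr 1; abel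

variable {F : Type*} [NormedAddCommGroup F] [NormedSpace ℂ F]

lemma NL.mono {G : Type*} [NormedAddCommGroup G] {A : ℂ → F → G} {Λ δ M Λ' δ' : ℝ}
    (H : NL A Λ δ M) (h1 : Λ ≤ Λ') (h2 : δ' ≤ δ) : NL A Λ' δ' M :=
  ⟨H.zero, H.supp, fun z w Y Y' X X' a b c d e f =>
    (H.sd z w Y Y' X X' a b (c.trans h2) (d.trans h2) (e.trans h2) (f.trans h2)).trans
      (by gcongr)⟩

lemma nl_of_smooth {X G : Type*} [NormedAddCommGroup X] [NormedSpace ℝ X] [ProperSpace F]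
    [NormedAddCommGroup G] [NormedSpace ℝ G] {U : Set (X × F)} (hU : IsOpen U) {f : X × F → G}
    (hf : ContDiffOn ℝ 2 f U) {K : Set X} (hK : IsCompact K) (hKU : ∀ θ ∈ K, (θ, (0:F)) ∈ U)
    (hf0 : ∀ θ ∈ K, f (θ, 0) = 0) {θ : ℂ → X} {χ : ℂ → ℝ} {M k l : ℝ}
    (hθ : ∀ z, ‖z‖ ≤ M → θ z ∈ K)
    (hθh : ∀ z w, ‖z‖ ≤ M → ‖w‖ ≤ M → ‖θ z - θ w‖ ≤ k * ‖z - w‖^(1/2:ℝ)) (hk : 0 ≤ k) (hl : 0 ≤ l)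
    (hχ : ∀ z, |χ z| ≤ 1) (hχs : ∀ z, M ≤ ‖z‖ → χ z = 0)
    (hχl : ∀ z w, ‖z‖ ≤ M → ‖w‖ ≤ M → |χ z - χ w| ≤ l * ‖z - w‖^(1/2:ℝ)) :
    ∃ δ > 0, ∃ Λ : ℝ, 0 ≤ Λ ∧ (∀ θ ∈ K, ∀ Y : F, ‖Y‖ ≤ δ → (θ, Y) ∈ U) ∧
      NL (fun z Y => χ z • f (θ z, Y)) Λ δ M := by
  obtain ⟨δ, hδ, Λ, hΛ, hU', hsd⟩ := sd_lemma hU hf hK hKU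
  refine ⟨δ, hδ, Λ * (1 + k + l), by positivity, hU', ?_⟩
  constructor
  · intro z
    rcases le_or_gt M ‖z‖ with h | h
    · simp [hχs z h]
    · simp [hf0 _ (hθ z h.le)]
  · intro z Y h; simp [hχs z h]
  · intro z w Y Y' X X' hz hw h1 h2 h3 h4
    have e : (χ z • f (θ z, Y) - χ z • f (θ z, Y')) - (χ w • f (θ w, X) - χ w • f (θ w, X')) =
        χ z • ((f (θ z, Y) - f (θ z, Y')) - (f (θ w, X) - f (θ w, X'))) +
        (χ z - χ w) • (f (θ w, X) - f (θ w, X')) := by module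
    have h0 : ‖(0:F)‖ ≤ δ := by simpa using hδ.le
    have b1 := hsd _ (hθ z hz) _ (hθ w hw) Y Y' X X' h1 h2 h3 h4
    have b2 : ‖f (θ w, X) - f (θ w, X')‖ ≤ Λ * ‖X - X'‖ := by
      simpa using hsd _ (hθ w hw) _ (hθ w hw) X X' 0 0 h3 h4 h0 h0
    rw [e]
    refine (norm_add_le _ _).trans ?_
    rw [norm_smul, norm_smul, Real.norm_eq_abs, Real.norm_eq_abs]
    set h := ‖z - w‖^(1/2:ℝ) with hh
    have hh0 : 0 ≤ h := by positivity
    have t1 : Λ * ‖(Y - Y') - (X - X')‖ ≤ Λ * (1 + k + l) * ‖(Y - Y') - (X - X')‖ := by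
      gcongr
      nlinarith [mul_nonneg hΛ hk, mul_nonneg hΛ hl]
    calc _ ≤ 1 * (Λ * ‖(Y - Y') - (X - X')‖ + Λ * (‖θ z - θ w‖ + ‖Y - X‖ + ‖Y' - X'‖) * ‖X - X'‖) +
          (l * h) * (Λ * ‖X - X'‖) := by
          gcongr
          · exact hχ z
          · exact hχl z w hz hw
      _ ≤ 1 * (Λ * ‖(Y - Y') - (X - X')‖ + Λ * (k * h + ‖Y - X‖ + ‖Y' - X'‖) * ‖X - X'‖) +
          (l * h) * (Λ * ‖X - X'‖) := by gcongr; exact hθh z w hz hw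
      _ = Λ * ‖(Y - Y') - (X - X')‖ + Λ * ((k + l) * h + 1 * ‖Y - X‖ + 1 * ‖Y' - X'‖) * ‖X - X'‖ := by ring
      _ ≤ Λ * (1 + k + l) * ‖(Y - Y') - (X - X')‖ +
          Λ * ((1 + k + l) * h + (1 + k + l) * ‖Y - X‖ + (1 + k + l) * ‖Y' - X'‖) * ‖X - X'‖ := by
        gcongr ?_ + Λ * (?_ * h + ?_ * _ + ?_ * _) * _ <;> linarith
      _ = _ := by ring

end JHP
end

section
namespace JHP
open MeasureTheory

/-- A complexification of a real space. -/
structure Cx {E F : Type*} [NormedAddCommGroup E] [NormedSpace ℝ E] [NormedAddCommGroup F]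
    [NormedSpace ℂ F] (P Q : F →L[ℝ] E) (ι : E →L[ℝ] F) : Prop where
  PI : ∀ Y, P (Complex.I • Y) = - Q Y
  QI : ∀ Y, Q (Complex.I • Y) = P Y
  Pι : ∀ v, P (ι v) = v
  Qι : ∀ v, Q (ι v) = 0

lemma exists_Cx (E : Type*) [NormedAddCommGroup E] [NormedSpace ℝ E] [FiniteDimensional ℝ E] :
    ∃ (P Q : (Fin (Module.finrank ℝ E) → ℂ) →L[ℝ] E)
      (ι : E →L[ℝ] (Fin (Module.finrank ℝ E) → ℂ)), Cx P Q ι := by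
  let e : E ≃L[ℝ] (Fin (Module.finrank ℝ E) → ℝ) :=
    ContinuousLinearEquiv.ofFinrankEq (by simp)
  let P0 : (Fin (Module.finrank ℝ E) → ℂ) →L[ℝ] (Fin (Module.finrank ℝ E) → ℝ) :=
    { toFun := fun Y k => (Y k).re
      map_add' := fun x y => by ext; simp
      map_smul' := fun x y => by ext; simp
      cont := by fun_prop }
  let Q0 : (Fin (Module.finrank ℝ E) → ℂ) →L[ℝ] (Fin (Module.finrank ℝ E) → ℝ) :=
    { toFun := fun Y k => (Y k).im
      map_add' := fun x y => by ext; simp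
      map_smul' := fun x y => by ext; simp
      cont := by fun_prop }
  let ι0 : (Fin (Module.finrank ℝ E) → ℝ) →L[ℝ] (Fin (Module.finrank ℝ E) → ℂ) :=
    { toFun := fun Y k => (Y k : ℂ)
      map_add' := fun x y => by ext; simp
      map_smul' := fun x y => by ext; simp
      cont := by fun_prop }
  refine ⟨(e.symm : _ →L[ℝ] E).comp P0, (e.symm : _ →L[ℝ] E).comp Q0,
    ι0.comp (e : E →L[ℝ] _), ⟨fun Y => ?_, fun Y => ?_, fun v => ?_, fun v => ?_⟩⟩
  · change e.symm (P0 _) = - e.symm (Q0 _)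
    rw [← map_neg]; congr 1; ext k; simp [P0, Q0]
  · change e.symm (Q0 _) = e.symm (P0 _)
    congr 1; ext k; simp [P0, Q0]
  · change e.symm (P0 (ι0 (e v))) = v
    rw [ContinuousLinearEquiv.symm_apply_eq]; ext k; simp [P0, ι0]
  · change e.symm (Q0 (ι0 (e v))) = 0
    rw [ContinuousLinearEquiv.symm_apply_eq]; ext k; simp [Q0, ι0]

section
variable {E F : Type*} [NormedAddCommGroup E] [NormedSpace ℝ E] [NormedAddCommGroup F]
    [NormedSpace ℂ F]

def UU (J : E → E →L[ℝ] E) (P Q : F →L[ℝ] E) (x : (E × E × E) × F) : E :=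
  x.1.1 + (P x.2 + J x.1.1 (Q x.2))

def AA (J : E → E →L[ℝ] E) (P Q : F →L[ℝ] E) (ι : E →L[ℝ] F) (x : (E × E × E) × F) : F :=
  ι (-(fderiv ℝ J x.1.1 x.1.2.1 (Q x.2) + J (UU J P Q x) (fderiv ℝ J x.1.1 x.1.2.2 (Q x.2)) +
    (J (UU J P Q x) - J x.1.1) x.1.2.2))

def BB (J : E → E →L[ℝ] E) (P Q : F →L[ℝ] E) (ι : E →L[ℝ] F) (x : (E × E × E) × F) : F →L[ℝ] F :=
  ι.comp ((-(J (UU J P Q x) - J x.1.1)).comp (P + (J x.1.1).comp Q))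

def DU (Ω : Set E) (J : E → E →L[ℝ] E) (P Q : F →L[ℝ] E) : Set ((E × E × E) × F) :=
  {x | x.1.1 ∈ Ω} ∩ UU J P Q ⁻¹' Ω

variable {Ω : Set E} {J : E → E →L[ℝ] E} {P Q : F →L[ℝ] E} {ι : E →L[ℝ] F}

lemma UU_smooth (hJ : ContDiffOn ℝ 3 J Ω) :
    ContDiffOn ℝ 2 (UU J P Q) {x | x.1.1 ∈ Ω} := by
  have h1 : ContDiffOn ℝ 2 (fun x : (E × E × E) × F => J x.1.1) {x | x.1.1 ∈ Ω} :=
    (hJ.of_le (by norm_num)).comp (by fun_prop) (fun x hx => hx)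
  have h2 : ContDiffOn ℝ 2 (fun x : (E × E × E) × F => Q x.2) {x | x.1.1 ∈ Ω} := by fun_prop
  have h3 : ContDiffOn ℝ 2 (fun x : (E × E × E) × F => P x.2) {x | x.1.1 ∈ Ω} := by fun_prop
  have h4 : ContDiffOn ℝ 2 (fun x : (E × E × E) × F => x.1.1) {x | x.1.1 ∈ Ω} := by fun_prop
  exact h4.add (h3.add (h1.clm_apply h2))

lemma DU_open (hΩ : IsOpen Ω) (hJ : ContDiffOn ℝ 3 J Ω) : IsOpen (DU Ω J P Q) :=
  (UU_smooth hJ).continuousOn.isOpen_inter_preimage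
    (hΩ.preimage (by fun_prop : Continuous fun x : (E × E × E) × F => x.1.1)) hΩ

lemma Ju_smooth (hJ : ContDiffOn ℝ 3 J Ω) :
    ContDiffOn ℝ 2 (fun x => J (UU J P Q x)) (DU Ω J P Q) ∧
    ContDiffOn ℝ 2 (fun x : (E × E × E) × F => J x.1.1) (DU Ω J P Q) :=
  ⟨(hJ.of_le (by norm_num)).comp ((UU_smooth hJ).mono inter_subset_left) (fun x hx => hx.2),
    (hJ.of_le (by norm_num)).comp (by fun_prop) (fun x hx => hx.1)⟩

lemma AA_smooth (hΩ : IsOpen Ω) (hJ : ContDiffOn ℝ 3 J Ω) :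
    ContDiffOn ℝ 2 (AA J P Q ι) (DU Ω J P Q) := by
  obtain ⟨h1, h2⟩ := Ju_smooth (P := P) (Q := Q) hJ
  have h3 : ContDiffOn ℝ 2 (fun x : (E × E × E) × F => fderiv ℝ J x.1.1) (DU Ω J P Q) :=
    (hJ.fderiv_of_isOpen (m := 2) hΩ (by norm_num)).comp (by fun_prop) (fun x hx => hx.1)
  have h4 : ContDiffOn ℝ 2 (fun x : (E × E × E) × F => x.1.2.1) (DU Ω J P Q) := by fun_prop
  have h5 : ContDiffOn ℝ 2 (fun x : (E × E × E) × F => x.1.2.2) (DU Ω J P Q) := by fun_prop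
  have h6 : ContDiffOn ℝ 2 (fun x : (E × E × E) × F => Q x.2) (DU Ω J P Q) := by fun_prop
  exact ι.contDiff.comp_contDiffOn ((((h3.clm_apply h4).clm_apply h6).add
    (h1.clm_apply ((h3.clm_apply h5).clm_apply h6))).add ((h1.sub h2).clm_apply h5)).neg

lemma BB_smooth (hJ : ContDiffOn ℝ 3 J Ω) :
    ContDiffOn ℝ 2 (BB J P Q ι) (DU Ω J P Q) := by
  obtain ⟨h1, h2⟩ := Ju_smooth (P := P) (Q := Q) hJ
  exact contDiffOn_const.clm_comp ((h1.sub h2).neg.clm_comp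
    (contDiffOn_const.add (h2.clm_comp contDiffOn_const)))

lemma AA_zero (θ : E × E × E) : AA J P Q ι (θ, 0) = 0 := by simp [AA, UU]
lemma BB_zero (θ : E × E × E) : BB J P Q ι (θ, 0) = 0 := by ext; simp [BB, UU]

lemma alg_eq (hc : Cx P Q ι) {p ξ η : E} {Y Yx Yy : F} (hsq : ∀ v, J p (J p v) = -v)
    (h0 : ξ + J p η = 0)
    (h : Yx + Complex.I • Yy = AA J P Q ι ((p, ξ, η), Y) + BB J P Q ι ((p, ξ, η), Y) Yy) :
    (ξ + (fderiv ℝ J p ξ (Q Y) + (P Yx + J p (Q Yx)))) +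
      J (UU J P Q ((p, ξ, η), Y)) (η + (fderiv ℝ J p η (Q Y) + (P Yy + J p (Q Yy)))) = 0 := by
  have h1 : Yx = AA J P Q ι ((p, ξ, η), Y) + BB J P Q ι ((p, ξ, η), Y) Yy - Complex.I • Yy := by
    rw [← h]; abel
  set u := UU J P Q ((p, ξ, η), Y) with hu
  have e1 : P Yx + J p (Q Yx) = -(fderiv ℝ J p ξ (Q Y) + J u (fderiv ℝ J p η (Q Y)) +
    (J u - J p) η) - (J u - J p) (P Yy + J p (Q Yy)) + Q Yy - J p (P Yy) := by
    rw [h1]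
    simp only [AA, BB, ← hu, map_add, map_sub, hc.PI, hc.QI, hc.Pι, hc.Qι,
      ContinuousLinearMap.comp_apply, map_zero, _root_.neg_apply, _root_.add_apply]
    simp only [map_neg, _root_.sub_apply]
    abel
  rw [e1]
  simp only [map_add, map_neg, _root_.sub_apply, hsq]
  have e2 : ξ = - J p η := eq_neg_of_add_eq_zero_left h0
  rw [e2]
  simp only [map_add, map_neg, _root_.neg_apply]
  abel
end
end JHP
end

section
namespace JHP
open MeasureTheory
section
variable {E F : Type*} [NormedAddCommGroup E] [NormedSpace ℝ E] [NormedAddCommGroup F]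
    [NormedSpace ℂ F]
variable {Ω : Set E} {J : E → E →L[ℝ] E} {P Q : F →L[ℝ] E} {ι : E →L[ℝ] F}

lemma u_deriv {f : ℂ → E} {Y : ℂ → F} {z : ℂ} (hf : DifferentiableAt ℝ f z)
    (hY : DifferentiableAt ℝ Y z) (hJ : DifferentiableAt ℝ J (f z)) :
    DifferentiableAt ℝ (fun z => f z + (P (Y z) + J (f z) (Q (Y z)))) z ∧
    ∀ h, fderiv ℝ (fun z => f z + (P (Y z) + J (f z) (Q (Y z)))) z h =
      fderiv ℝ f z h + (fderiv ℝ J (f z) (fderiv ℝ f z h) (Q (Y z)) +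
        (P (fderiv ℝ Y z h) + J (f z) (Q (fderiv ℝ Y z h)))) := by
  have h1 := hf.hasFDerivAt
  have h2 := hY.hasFDerivAt
  have h3 : HasFDerivAt (fun z => J (f z)) ((fderiv ℝ J (f z)).comp (fderiv ℝ f z)) z :=
    hJ.hasFDerivAt.comp z h1
  have h4 : HasFDerivAt (fun z => Q (Y z)) (Q.comp (fderiv ℝ Y z)) z :=
    Q.hasFDerivAt.comp z h2
  have h5 : HasFDerivAt (fun z => P (Y z)) (P.comp (fderiv ℝ Y z)) z :=
    P.hasFDerivAt.comp z h2
  have h6 := h1.add (h5.add (h3.clm_apply h4))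
  refine ⟨h6.differentiableAt, fun h => ?_⟩
  have h7 := congrArg (fun L => L h) h6.fderiv
  refine Eq.trans h7 ?_
  simp
  abel

lemma cont_of_hol_cb {X : Type*} [NormedAddCommGroup X] {θ : ℂ → X} {k M : ℝ}
    (hθh : ∀ z w, ‖z‖ ≤ M → ‖w‖ ≤ M → ‖θ z - θ w‖ ≤ k * ‖z - w‖^(1/2:ℝ)) :
    ContinuousOn θ (closedBall 0 M) := by
  intro w hw
  rw [ContinuousWithinAt, tendsto_iff_norm_sub_tendsto_zero]
  have h1 : Tendsto (fun z : ℂ => k * ‖z - w‖^(1/2:ℝ)) (𝓝[closedBall 0 M] w) (𝓝 0) := by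
    have : Continuous fun z : ℂ => k * ‖z - w‖^(1/2:ℝ) :=
      continuous_const.mul ((by fun_prop : Continuous fun z : ℂ => ‖z - w‖).rpow_const
        (fun _ => Or.inr (by norm_num)))
    have h := this.tendsto w
    simp only [sub_self, norm_zero] at h
    rw [Real.zero_rpow (by norm_num), mul_zero] at h
    exact h.mono_left nhdsWithin_le_nhds
  refine squeeze_zero' (Eventually.of_forall fun _ => norm_nonneg _) ?_ h1
  filter_upwards [self_mem_nhdsWithin] with z hz
  exact hθh z w (by simpa using hz) (by simpa using hw)

lemma theta_hol {f : ℂ → E} {r' M K : ℝ} (hM : M < r') (hM0 : 0 < M) (hK : 0 < K)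
    (hd : ∀ z ∈ ball (0:ℂ) r', DifferentiableAt ℝ f z)
    (hb : ∀ z ∈ ball (0:ℂ) r', ‖fderiv ℝ f z‖ ≤ K)
    (hh : ∀ z ∈ ball (0:ℂ) r', ∀ w ∈ ball (0:ℂ) r',
      ‖fderiv ℝ f z - fderiv ℝ f w‖ ≤ K * ‖z - w‖ ^ (1/2:ℝ)) :
    ∀ z w, ‖z‖ ≤ M → ‖w‖ ≤ M →
      ‖(f z, fderiv ℝ f z 1, fderiv ℝ f z Complex.I) -
        (f w, fderiv ℝ f w 1, fderiv ℝ f w Complex.I)‖ ≤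
        (K * ((2 * M)^(1/2:ℝ) + 1)) * ‖z - w‖^(1/2:ℝ) := by
  intro z w hz hw
  have mz : z ∈ ball (0:ℂ) r' := by simpa using hz.trans_lt hM
  have mw : w ∈ ball (0:ℂ) r' := by simpa using hw.trans_lt hM
  have a1 := Convex.norm_image_sub_le_of_norm_fderiv_le hd hb (convex_ball 0 r') mw mz
  have a2 := half_le hz hw
  have a3 := hh z mz w mw
  have n1 : 0 ≤ (2 * M)^(1/2:ℝ) := by positivity
  have n2 : 0 ≤ ‖z - w‖^(1/2:ℝ) := by positivity
  have key : ∀ h : ℂ, ‖h‖ = 1 → ‖fderiv ℝ f z h - fderiv ℝ f w h‖ ≤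
      (K * ((2 * M)^(1/2:ℝ) + 1)) * ‖z - w‖^(1/2:ℝ) := by
    intro h hh1
    rw [← _root_.sub_apply]
    refine (ContinuousLinearMap.le_opNorm _ _).trans ?_
    rw [hh1, mul_one]
    refine a3.trans ?_
    gcongr
    nlinarith [mul_nonneg hK.le n1]
  rw [Prod.mk_sub_mk, Prod.mk_sub_mk, Prod.norm_def, Prod.norm_def]
  refine max_le ?_ (max_le (key 1 (by simp)) (key _ (by simp)))
  refine a1.trans ?_
  calc K * ‖z - w‖ ≤ K * ((2 * M) ^ (1/2:ℝ) * ‖z - w‖^(1/2:ℝ)) := by gcongr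
    _ ≤ _ := by nlinarith [mul_nonneg hK.le n2]

lemma chi_hol {χ : ℂ → ℝ} {K M : ℝ} (hχ : ContDiff ℝ (⊤:ℕ∞) χ) (hK0 : 0 ≤ K)
    (hK : ∀ z, ‖fderiv ℝ χ z‖ ≤ K) :
    ∀ z w, ‖z‖ ≤ M → ‖w‖ ≤ M →
      |(1/2) * χ z - (1/2) * χ w| ≤ (K * (2 * M)^(1/2:ℝ)) * ‖z - w‖^(1/2:ℝ) := by
  intro z w hz hw
  have a1 := Convex.norm_image_sub_le_of_norm_fderiv_le (𝕜 := ℝ) (f := χ) (s := univ) (x := w) (y := z)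
    (fun x _ => hχ.contDiffAt.differentiableAt (by simp)) (fun x _ => hK x) convex_univ trivial trivial
  have a2 := half_le hz hw
  rw [← mul_sub, abs_mul, ← Real.norm_eq_abs (χ z - χ w)]
  have : K * ‖z - w‖ ≤ K * ((2 * M) ^ (1/2:ℝ) * ‖z - w‖^(1/2:ℝ)) := by gcongr
  have e : |(1/2:ℝ)| = 1/2 := by norm_num
  rw [e]
  nlinarith [norm_nonneg (χ z - χ w)]

set_option maxHeartbeats 1600000 in
theorem main_abs [ProperSpace F] [CompleteSpace F] (hc : Cx P Q ι) (hΩ : IsOpen Ω)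
    (hJ : ContDiffOn ℝ 3 J Ω) (hsq : ∀ x ∈ Ω, ∀ v, J x (J x v) = -v) {f : ℂ → E} {ρ R : ℝ}
    (hρ : 0 < ρ) (hρR : ρ < R) (hm : MapsTo f (ball 0 R) Ω)
    (hd : ∀ z ∈ ball (0:ℂ) R, DifferentiableAt ℝ f z)
    (he : ∀ z ∈ ball (0:ℂ) R, fderiv ℝ f z 1 + J (f z) (fderiv ℝ f z Complex.I) = 0) :
    ∃ C : ℝ, ∃ s > 0, ∀ v, ‖v - fderiv ℝ f 0 1‖ < s → ∃ u : ℂ → E,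
      (∀ z ∈ ball (0:ℂ) ρ, DifferentiableAt ℝ u z ∧ u z ∈ Ω ∧
        fderiv ℝ u z 1 + J (u z) (fderiv ℝ u z Complex.I) = 0 ∧
        ‖u z - f z‖ ≤ C * ‖v - fderiv ℝ f 0 1‖) ∧ u 0 = f 0 ∧ fderiv ℝ u 0 1 = v := by
  obtain ⟨M, hM⟩ : ∃ M, M = (3 * ρ + R) / 4 := ⟨_, rfl⟩
  obtain ⟨r', hr'⟩ : ∃ r', r' = (ρ + R) / 2 := ⟨_, rfl⟩
  obtain ⟨r, hr⟩ : ∃ r, r = (ρ + 3 * R) / 4 := ⟨_, rfl⟩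
  have hM0 : 0 < M := by linarith
  have hMr : M < r' := by linarith
  have hr1 : r' < r := by linarith
  have hrR : r < R := by linarith
  have hρM : ρ < M := by linarith
  have sub1 : closedBall (0:ℂ) r ⊆ ball 0 R := closedBall_subset_ball hrR
  have hcont : ContinuousOn f (closedBall 0 r) := fun z hz =>
    (hd z (sub1 hz)).continuousAt.continuousWithinAt
  obtain ⟨Λ0, hΛ0, hlip, hbd⟩ := lip_compact hΩ (hJ.of_le (by norm_num))
    ((isCompact_closedBall (0:ℂ) r).image_of_continuousOn hcont)
    (by rintro _ ⟨z, hz, rfl⟩; exact hm (sub1 hz))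
  have Hj : Jh f (fun z => J (f z)) (ball 0 r) Λ0 :=
    ⟨fun z hz => hd z (sub1 (ball_subset_closedBall hz)),
     fun z hz => hsq _ (hm (sub1 (ball_subset_closedBall hz))), hΛ0,
     fun z hz => hbd _ ⟨z, ball_subset_closedBall hz, rfl⟩,
     fun z hz => he z (sub1 (ball_subset_closedBall hz)),
     fun z hz w hw => hlip _ ⟨z, ball_subset_closedBall hz, rfl⟩ _
      ⟨w, ball_subset_closedBall hw, rfl⟩⟩
  obtain ⟨K, hK, hKb, hKh⟩ := jh_reg hr1 Hj
  have hθh := theta_hol hMr hM0 hK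
    (fun z hz => hd z (sub1 (ball_subset_closedBall (ball_subset_ball hr1.le hz)))) hKb hKh
  obtain ⟨θ, hθ⟩ : ∃ θ : ℂ → E × E × E, θ = fun z => (f z, fderiv ℝ f z 1, fderiv ℝ f z Complex.I) :=
    ⟨_, rfl⟩
  have hθh' : ∀ z w, ‖z‖ ≤ M → ‖w‖ ≤ M →
      ‖θ z - θ w‖ ≤ (K * ((2 * M)^(1/2:ℝ) + 1)) * ‖z - w‖^(1/2:ℝ) := by
    rw [hθ]; exact hθh
  have hKc : IsCompact (θ '' closedBall 0 M) :=
    (isCompact_closedBall (0:ℂ) M).image_of_continuousOn (cont_of_hol_cb hθh')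
  have sub2 : ∀ z : ℂ, ‖z‖ ≤ M → z ∈ ball (0:ℂ) R := fun z hz => by
    simp only [mem_ball_zero_iff]; linarith
  have hKU : ∀ t ∈ θ '' closedBall 0 M, (t, (0:F)) ∈ DU Ω J P Q := by
    rintro _ ⟨z, hz, rfl⟩
    have : f z ∈ Ω := hm (sub2 z (by simpa using hz))
    rw [hθ]
    exact ⟨this, by simpa [UU] using this⟩
  have hθm : ∀ z, ‖z‖ ≤ M → θ z ∈ θ '' closedBall 0 M := fun z hz => ⟨z, by simpa using hz, rfl⟩
  obtain ⟨χ, Kχ, hχ, hχ1, hχ0, hχb, hχd, hKχ⟩ := cutoff ρ M hρ hρM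
  have hχb' : ∀ z, |1 / 2 * χ z| ≤ 1 := fun z => by
    rw [abs_le]; constructor <;> linarith [(hχb z).1, (hχb z).2]
  have hχ0' : ∀ z, M ≤ ‖z‖ → 1 / 2 * χ z = 0 := fun z hz => by rw [hχ0 z hz, mul_zero]
  have hχl := chi_hol (M := M) hχ hKχ hχd
  have k0 : 0 ≤ K * ((2 * M)^(1/2:ℝ) + 1) := by positivity
  have l0 : 0 ≤ Kχ * (2 * M)^(1/2:ℝ) := by positivity
  have hO : IsOpen (DU Ω J P Q) := DU_open hΩ hJ
  have hA2 : ContDiffOn ℝ 2 (AA J P Q ι) (DU Ω J P Q) := AA_smooth hΩ hJ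
  have hB2 : ContDiffOn ℝ 2 (BB J P Q ι) (DU Ω J P Q) := BB_smooth hJ
  obtain ⟨δ1, hδ1, L1, hL1, hU1, HA⟩ := nl_of_smooth (F := F) (X := E × E × E) (G := F)
    (U := DU Ω J P Q) (f := AA J P Q ι) (θ := θ) (χ := fun z => 1 / 2 * χ z) hO hA2 hKc hKU
    (fun t _ => AA_zero t) hθm hθh' k0 l0 hχb' hχ0' hχl
  obtain ⟨δ2, hδ2, L2, hL2, hU2, HB⟩ := nl_of_smooth (F := F) (X := E × E × E)
    (G := F →L[ℝ] F) (U := DU Ω J P Q) (f := BB J P Q ι) (θ := θ) (χ := fun z => 1 / 2 * χ z) hO hB2 hKc hKU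
    (fun t _ => BB_zero t) hθm hθh' k0 l0 hχb' hχ0' hχl
  have hδ : 0 < min δ1 δ2 := lt_min hδ1 hδ2
  obtain ⟨C, hC, s, hs, hfix⟩ := fix_main hM0 hδ (hL1.trans (le_max_left L1 L2))
    (HA.mono (le_max_left L1 L2) (min_le_left δ1 δ2))
    (HB.mono (le_max_right L1 L2) (min_le_right δ1 δ2))
  have nι : 0 < ‖ι‖ + 1 := by positivity
  refine ⟨(‖P‖ + Λ0 * ‖Q‖) * (C * (‖ι‖ + 1)), min (s / (‖ι‖ + 1)) (δ1 / (C * (‖ι‖ + 1))),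
    by positivity, fun v hv => ?_⟩
  obtain ⟨hv1, hv2⟩ := lt_min_iff.1 hv
  rw [lt_div_iff₀ nι] at hv1
  rw [lt_div_iff₀ (by positivity)] at hv2
  have hcn : ‖ι (v - fderiv ℝ f 0 1)‖ ≤ (‖ι‖ + 1) * ‖v - fderiv ℝ f 0 1‖ := by
    refine (ι.le_opNorm _).trans ?_
    gcongr
    linarith
  obtain ⟨Y, hY0, hY, hY1⟩ := hfix (ι (v - fderiv ℝ f 0 1)) (by linarith)
  have hYb : ∀ z : ℂ, ‖z‖ ≤ M → ‖Y z‖ ≤ C * (‖ι‖ + 1) * ‖v - fderiv ℝ f 0 1‖ := fun z hz => by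
    refine (hY z hz).2.2.trans ?_
    rw [mul_assoc]
    gcongr
  have hJd : ∀ z : ℂ, ‖z‖ ≤ M → DifferentiableAt ℝ J (f z) := fun z hz =>
    (hJ.contDiffAt (hΩ.mem_nhds (hm (sub2 z hz)))).differentiableAt (by norm_num)
  refine ⟨fun z => f z + (P (Y z) + J (f z) (Q (Y z))), ?_, ?_, ?_⟩
  · intro z hz
    have hzρ : ‖z‖ ≤ ρ := by simpa using (ball_subset_closedBall hz)
    have hzM : ‖z‖ ≤ M := hzρ.trans hρM.le
    obtain ⟨d1, d2⟩ := u_deriv (P := P) (Q := Q) (hd z (sub2 z hzM)) (hY z hzM).1 (hJd z hzM)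
    refine ⟨d1, ?_, ?_, ?_⟩
    · have := (hU1 _ (hθm z hzM) (Y z) ((hYb z hzM).trans (by linarith))).2
      simpa [UU, hθ] using this
    · rw [d2, d2]
      have h3 := (hY z hzM).2.1
      rw [hχ1 z hzρ] at h3
      have h4 : fderiv ℝ Y z 1 + Complex.I • fderiv ℝ Y z Complex.I =
          AA J P Q ι (θ z, Y z) + BB J P Q ι (θ z, Y z) (fderiv ℝ Y z Complex.I) := by
        rw [h3, _root_.smul_apply, ← smul_add, ← Complex.coe_smul, smul_smul]
        norm_num
      rw [hθ] at h4
      exact alg_eq hc (hsq _ (hm (sub2 z hzM))) (he z (sub2 z hzM)) h4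
    · simp only [add_sub_cancel_left]
      have b1 : ‖J (f z)‖ ≤ Λ0 := hbd _ ⟨z, by simp only [mem_closedBall_zero_iff]; linarith, rfl⟩
      calc ‖P (Y z) + J (f z) (Q (Y z))‖ ≤ ‖P‖ * ‖Y z‖ + Λ0 * (‖Q‖ * ‖Y z‖) := by
            refine (norm_add_le _ _).trans (add_le_add (P.le_opNorm _) ?_)
            refine ((J (f z)).le_opNorm _).trans ?_
            gcongr
            exact Q.le_opNorm _
        _ = (‖P‖ + Λ0 * ‖Q‖) * ‖Y z‖ := by ring
        _ ≤ (‖P‖ + Λ0 * ‖Q‖) * (C * (‖ι‖ + 1) * ‖v - fderiv ℝ f 0 1‖) := by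
            gcongr
            exact hYb z hzM
        _ = _ := by ring
  · simp [hY0]
  · have h0M : ‖(0:ℂ)‖ ≤ M := by simpa using hM0.le
    rw [(u_deriv (P := P) (Q := Q) (hd 0 (sub2 0 h0M)) (hY 0 h0M).1 (hJd 0 h0M)).2, hY0, hY1]
    simp [hc.Pι, hc.Qι]
end
end JHP
end

/-- a `J`-holomorphic disc of radius `R` in direction `v₀` can be perturbed,
for every `ε ∈ (0, R)`, to `J`-holomorphic discs of radius `R - ε` in all nearby
directions `v`, converging uniformly to the original disc as `v → v₀`. -/
theorem jholo_disc_perturbation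
    (n : ℕ) (hn : 1 ≤ n) (Ω : Set (Cn n)) (hΩ : IsOpen Ω) (hne : Ω.Nonempty)
    (J : Cn n → (Cn n →L[ℝ] Cn n)) (hJ : IsAlmostComplexOn n Ω J)
    (R : ℝ) (hR : 0 < R) (f : ℂ → Cn n) (hf : IsJHolomorphicOn n Ω J R f)
    (p v₀ : Cn n) (hf0 : f 0 = p) (hfv : fderiv ℝ f 0 1 = v₀)
    (ε : ℝ) (hε : ε ∈ Set.Ioo 0 R) :
    ∃ V : Set (Cn n), IsOpen V ∧ v₀ ∈ V ∧
      ∃ F : Cn n → ℂ → Cn n,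
        (∀ v ∈ V, IsJHolomorphicOn n Ω J (R - ε) (F v) ∧ F v 0 = p ∧
          fderiv ℝ (F v) 0 1 = v) ∧
        TendstoUniformlyOn F f (𝓝 v₀) (ball (0:ℂ) (R - ε)) := by
  obtain ⟨hJs, hJsq⟩ := hJ
  obtain ⟨hm, hfd⟩ := hf
  obtain ⟨P, Q, ι, hc⟩ := JHP.exists_Cx (Cn n)
  have hsq : ∀ x ∈ Ω, ∀ v, J x (J x v) = -v := fun x hx v => by
    have := congrArg (fun L => L v) (hJsq x hx)
    simpa using this
  have hJ3 : ContDiffOn ℝ 3 J Ω := hJs.of_le ((WithTop.coe_le_coe.2 (le_top : (3:ℕ∞) ≤ ⊤) :))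
  obtain ⟨C, s, hs, H⟩ := JHP.main_abs hc hΩ hJ3 hsq (sub_pos.2 hε.2)
    (sub_lt_self R hε.1) hm (fun z hz => (hfd z hz).1) (fun z hz => by
      have h := (hfd z hz).2 1
      rw [mul_one] at h
      rw [h, hsq _ (hm hz)]
      simp)
  rw [hfv] at H
  choose! F hF1 hF2 hF3 using H
  refine ⟨ball v₀ s, isOpen_ball, mem_ball_self hs, F, fun v hv => ?_, ?_⟩
  · rw [mem_ball, dist_eq_norm] at hv
    refine ⟨⟨fun z hz => (hF1 v hv z hz).2.1, fun z hz => ⟨(hF1 v hv z hz).1, fun ξ => ?_⟩⟩,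
      (hF2 v hv).trans hf0, hF3 v hv⟩
    obtain ⟨-, hu, he, -⟩ := hF1 v hv z hz
    have e1 : fderiv ℝ (F v) z 1 = - J (F v z) (fderiv ℝ (F v) z Complex.I) :=
      eq_neg_of_add_eq_zero_left he
    have e2 : J (F v z) (fderiv ℝ (F v) z 1) = fderiv ℝ (F v) z Complex.I := by
      rw [e1, map_neg, hsq _ hu, neg_neg]
    have d1 : ξ = ξ.re • (1:ℂ) + ξ.im • Complex.I := by
      apply Complex.ext <;> simp
    have d2 : Complex.I * ξ = ξ.re • Complex.I - ξ.im • (1:ℂ) := by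
      apply Complex.ext <;> simp
    rw [d2]
    conv_rhs => rw [d1]
    rw [map_sub, map_add, map_add, map_smul, map_smul, map_smul, map_smul, map_smul, map_smul,
      e2, e1, smul_neg, sub_neg_eq_add]
  · rw [Metric.tendstoUniformlyOn_iff]
    intro η hη
    have h1 : Tendsto (fun v : Cn n => C * ‖v - v₀‖) (𝓝 v₀) (𝓝 0) := by
      have : Continuous fun v : Cn n => C * ‖v - v₀‖ := by fun_prop
      simpa using this.tendsto v₀
    filter_upwards [h1.eventually_lt_const hη, ball_mem_nhds v₀ hs] with v hv1 hv2 z hz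
    rw [mem_ball, dist_eq_norm] at hv2
    rw [dist_comm, dist_eq_norm]
    exact (hF1 v hv2 z hz).2.2.2.trans_lt hv1
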